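/- Let γ > 2, let (u₀^ε)_ε satisfy assumption (H) with constants c̄, R̄, and suppose in addition that each I₀^ε is a discrete octagon. Let u₁^ε be a minimizer of u ↦ ℱ^{τ,γ}_ε(u,u₀^ε). Then there exists ε̄ > 0 such that for every ε ≤ ε̄ the set I₁^ε is a discrete octagon contained in I₀^ε, and ∂⁺I₁^ε = Z₁^ε. -/

import Mathlib

open scoped ENNReal symmDiff Classical
open MeasureTheory

namespace BEG

/-- Lattice points (the lattice `εℤ²` in lattice units). -/
abbrev Pt : Type := ℤ × ℤ

/-- Lattice `ℓ¹` distance (in lattice units). -/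
def d1 (p q : Pt) : ℕ := (p.1 - q.1).natAbs + (p.2 - q.2).natAbs

/-- Lattice `ℓ∞` distance (in lattice units). -/
def dinf (p q : Pt) : ℕ := max (p.1 - q.1).natAbs (p.2 - q.2).natAbs

/-- The four nearest neighbours `𝒩(p)`. -/
def nbrs (p : Pt) : Set Pt := {q | d1 p q = 1}

/-- Combinatorial `ℓ¹` distance from a point to a set (in lattice units). -/
noncomputable def distTo (p : Pt) (S : Set Pt) : ℝ≥0∞ := ⨅ q ∈ S, ((d1 p q : ℕ) : ℝ≥0∞)

/-- Combinatorial distance to the (discrete) boundary of `I`, in lattice units;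
the physical distance `d₁^ε(p,∂I)` is `ε * dB p I`. -/
noncomputable def dB (p : Pt) (I : Set Pt) : ℝ≥0∞ :=
  if p ∈ I then distTo p Iᶜ else distTo p I

/-- The exterior boundary `∂⁺I`. -/
def bdryOut (I : Set Pt) : Set Pt := {p | p ∉ I ∧ dB p I = 1}
/-- The interior boundary `∂⁻I`. -/
def bdryIn (I : Set Pt) : Set Pt := {p | p ∈ I ∧ dB p I = 1}

/-- `𝕆 I = {p ∈ ∂⁺I : #(𝒩(p) ∩ I) = 2}`. -/
def Ocorner (I : Set Pt) : Set Pt := {p ∈ bdryOut I | (nbrs p ∩ I).ncard = 2}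
/-- `𝕀 I = {p ∈ ∂⁻I : #(𝒩(p) ∩ I) = 2}`. -/
def Icorner (I : Set Pt) : Set Pt := {p ∈ bdryIn I | (nbrs p ∩ I).ncard = 2}

/-- Spin configurations `𝒜_ε`: maps `εℤ² → {-1,0,1}` with finitely many zeros. -/
structure Config where
  val : Pt → ℤ
  val_mem : ∀ p, val p = -1 ∨ val p = 0 ∨ val p = 1
  finiteZero : {p | val p = 0}.Finite

/-- `I_u = {u = 1}`. -/
def Iset (u : Config) : Set Pt := {p | u.val p = 1}
/-- `Z_u = {u = 0}`. -/
def Zset (u : Config) : Set Pt := {p | u.val p = 0}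

/-- Energy of one nearest-neighbour bond: `ε (1 - ab - k (1 - (ab)²))`. -/
noncomputable def bond (ε k : ℝ) (a b : ℤ) : ℝ≥0∞ :=
  ENNReal.ofReal (ε * (1 - (a : ℝ) * (b : ℝ) - k * (1 - ((a : ℝ) * (b : ℝ)) ^ 2)))

/-- The energy `ℰ_ε(u)`: the sum over unordered nearest-neighbour pairs. -/
noncomputable def energy (ε k : ℝ) (u : Config) : ℝ≥0∞ :=
  ∑' p : Pt, (bond ε k (u.val p) (u.val (p + (1, 0))) + bond ε k (u.val p) (u.val (p + (0, 1))))

/-- The local energy `ℰ_ε(u, I)`: bonds with at least one endpoint in `I`, each counted once. -/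
noncomputable def localEnergy (ε k : ℝ) (u : Config) (I : Set Pt) : ℝ≥0∞ :=
  ∑' p : Pt,
    ((if p ∈ I ∨ p + (1, 0) ∈ I then bond ε k (u.val p) (u.val (p + (1, 0))) else 0) +
     (if p ∈ I ∨ p + (0, 1) ∈ I then bond ε k (u.val p) (u.val (p + (0, 1))) else 0))

/-- The dissipation `𝒟¹_ε(I_u, I_w) = Σ_{p ∈ I_u △ I_w} ε² d₁^ε(p, ∂I_w)`
(each summand is `ε² ⋅ ε ⋅ dB`). -/
noncomputable def diss1 (ε : ℝ) (Iu Iw : Set Pt) : ℝ≥0∞ :=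
  ∑' p : Pt, if p ∈ Iu ∆ Iw then ENNReal.ofReal (ε ^ 3) * dB p Iw else 0

/-- The dissipation `𝒟⁰_ε(Z_u, Z_w) = |#Z_u - #Z_w|`. -/
noncomputable def diss0 (Zu Zw : Set Pt) : ℝ≥0∞ := ((Nat.dist Zu.ncard Zw.ncard : ℕ) : ℝ≥0∞)

/-- The total functional `ℱ^{τ,γ}_ε(u,w)` with `τ = ζ ε`. -/
noncomputable def totalF (ε k ζ γ : ℝ) (u w : Config) : ℝ≥0∞ :=
  energy ε k u + (ENNReal.ofReal (ζ * ε))⁻¹ *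
    (diss1 ε (Iset u) (Iset w) + ENNReal.ofReal (ε ^ γ) * diss0 (Zset u) (Zset w))

/-- `u₁` is a minimizer of `u ↦ ℱ^{τ,γ}_ε(u, u₀)`. -/
def Minimizes (ε k ζ γ : ℝ) (u₁ u₀ : Config) : Prop :=
  ∀ v : Config, totalF ε k ζ γ u₁ u₀ ≤ totalF ε k ζ γ v u₀

/-- One step of a strongly continuous path inside `S`. -/
def stStep (S : Set Pt) (a b : Pt) : Prop := a ∈ S ∧ b ∈ S ∧ d1 a b = 1
/-- One step of a weakly continuous path inside `S`. -/
def wkStep (S : Set Pt) (a b : Pt) : Prop := a ∈ S ∧ b ∈ S ∧ dinf a b = 1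

def StronglyConnected (S : Set Pt) : Prop :=
  ∀ p ∈ S, ∀ q ∈ S, Relation.ReflTransGen (stStep S) p q
def WeaklyConnected (S : Set Pt) : Prop :=
  ∀ p ∈ S, ∀ q ∈ S, Relation.ReflTransGen (wkStep S) p q

/-- The strongly connected component of `p` in `S`. -/
def stComp (S : Set Pt) (p : Pt) : Set Pt := {q | Relation.ReflTransGen (stStep S) p q}
/-- The weakly connected component of `p` in `S`. -/
def wkComp (S : Set Pt) (p : Pt) : Set Pt := {q | Relation.ReflTransGen (wkStep S) p q}

def HConvex (S : Set Pt) : Prop :=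
  ∀ p ∈ S, ∀ q ∈ S, p.2 = q.2 → ∀ r : Pt, r.2 = p.2 → p.1 ≤ r.1 → r.1 ≤ q.1 → r ∈ S
def VConvex (S : Set Pt) : Prop :=
  ∀ p ∈ S, ∀ q ∈ S, p.1 = q.1 → ∀ r : Pt, r.1 = p.1 → p.2 ≤ r.2 → r.2 ≤ q.2 → r ∈ S

/-- Staircase sets: strongly connected and horizontally and vertically convex. -/
def IsStaircase (S : Set Pt) : Prop := StronglyConnected S ∧ HConvex S ∧ VConvex S

/-- Discrete rectangles. -/
def IsDiscreteRectangle (S : Set Pt) : Prop :=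
  ∃ a b c d : ℤ, a ≤ b ∧ c ≤ d ∧ S = {p : Pt | a ≤ p.1 ∧ p.1 ≤ b ∧ c ≤ p.2 ∧ p.2 ≤ d}

/-- `R_S`: the smallest discrete rectangle containing `S`. -/
def Rbox (S : Set Pt) : Set Pt :=
  {p : Pt | (∃ q ∈ S, q.1 ≤ p.1) ∧ (∃ q ∈ S, p.1 ≤ q.1) ∧
            (∃ q ∈ S, q.2 ≤ p.2) ∧ (∃ q ∈ S, p.2 ≤ q.2)}

/-- The perimeter `Per(A_I)` of the union of the `ε`-cells centred at points of `I`: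
`ε` times the number of boundary edges. -/
noncomputable def perim (ε : ℝ) (I : Set Pt) : ℝ≥0∞ :=
  ENNReal.ofReal ε * (({pq : Pt × Pt | pq.1 ∈ I ∧ pq.2 ∉ I ∧ d1 pq.1 pq.2 = 1}).encard : ℝ≥0∞)

/-- `Σ_i Per(B_i)`, the sum of the perimeters of the strongly connected components of `S`. -/
noncomputable def compPerimSum (ε : ℝ) (S : Set Pt) : ℝ≥0∞ :=
  ENNReal.ofReal ε *
    (({pq : Pt × Pt | pq.1 ∈ S ∧ pq.2 ∉ stComp S pq.1 ∧ d1 pq.1 pq.2 = 1}).encard : ℝ≥0∞)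

/-- The closed `ε`-cell of side `ε` centred at the lattice point `p`. -/
def cell (ε : ℝ) (p : Pt) : Set (ℝ × ℝ) :=
  {x | |x.1 - ε * (p.1 : ℝ)| ≤ ε / 2 ∧ |x.2 - ε * (p.2 : ℝ)| ≤ ε / 2}

/-- `A_I ⊆ ℝ²`. -/
def Aset (ε : ℝ) (I : Set Pt) : Set (ℝ × ℝ) := ⋃ p ∈ I, cell ε p

/-- `𝒞_{ε^μ}(I) = {p ∈ I : d₁^ε(p,∂I) ≤ ε^μ}`. -/
def closeLayer (ε μ : ℝ) (I : Set Pt) : Set Pt :=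
  {p ∈ I | ENNReal.ofReal ε * dB p I ≤ ENNReal.ofReal (ε ^ μ)}

/-- Assumption (H): `I` is a staircase set contained in a ball of radius `Rbar`, each of whose
four extreme slices contains at least `cbar/ε` lattice points. -/
def AssumpH (cbar Rbar ε : ℝ) (I : Set Pt) : Prop :=
  IsStaircase I ∧ I.Finite ∧
  (∃ x : ℝ × ℝ, ∀ p ∈ I, (ε * (p.1 : ℝ) - x.1) ^ 2 + (ε * (p.2 : ℝ) - x.2) ^ 2 ≤ Rbar ^ 2) ∧
  (∃ yLo yHi xLo xHi : ℤ,
    (∀ p ∈ I, yLo ≤ p.2 ∧ p.2 ≤ yHi ∧ xLo ≤ p.1 ∧ p.1 ≤ xHi) ∧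
    cbar / ε ≤ ({p ∈ I | p.2 = yLo}.ncard : ℝ) ∧
    cbar / ε ≤ ({p ∈ I | p.2 = yHi}.ncard : ℝ) ∧
    cbar / ε ≤ ({p ∈ I | p.1 = xLo}.ncard : ℝ) ∧
    cbar / ε ≤ ({p ∈ I | p.1 = xHi}.ncard : ℝ))

/-- `p` is a surfactant in the corner for `u` (up to a rotation of the lattice). -/
def SurfCorner (u : Config) (p : Pt) : Prop :=
  ∃ e : Pt, d1 p (p + e) = 1 ∧
    u.val p = 0 ∧ u.val (p + e) = 0 ∧ u.val (p + (-e.2, e.1)) = 0 ∧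
    u.val (p - e) = u.val (p - (-e.2, e.1)) ∧ u.val (p - e) ≠ 0

/-- A horizontal discrete segment. -/
def segH (x₁ x₂ y : ℤ) : Set Pt := {p : Pt | p.2 = y ∧ x₁ ≤ p.1 ∧ p.1 ≤ x₂}

/-- A (possibly degenerate) octagon of the class `𝒲`, described through the positions of
its eight supporting lines: the region is
`{x : yLo ≤ x₂ ≤ yHi, xLo ≤ x₁ ≤ xHi, sLo ≤ x₁+x₂ ≤ sHi, mLo ≤ x₁-x₂ ≤ mHi}`. -/
structure Oct where
  yLo : ℝ
  yHi : ℝ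
  xLo : ℝ
  xHi : ℝ
  sLo : ℝ
  sHi : ℝ
  mLo : ℝ
  mHi : ℝ

namespace Oct

def region (O : Oct) : Set (ℝ × ℝ) :=
  {x | O.yLo ≤ x.2 ∧ x.2 ≤ O.yHi ∧ O.xLo ≤ x.1 ∧ x.1 ≤ O.xHi ∧
       O.sLo ≤ x.1 + x.2 ∧ x.1 + x.2 ≤ O.sHi ∧ O.mLo ≤ x.1 - x.2 ∧ x.1 - x.2 ≤ O.mHi}

/-- Lengths `P_i` of the four axis-parallel sides (bottom, left, top, right). -/
noncomputable def P (O : Oct) : Fin 4 → ℝ :=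
  ![max 0 (min (min O.xHi (O.sHi - O.yLo)) (O.mHi + O.yLo) -
      max (max O.xLo (O.sLo - O.yLo)) (O.mLo + O.yLo)),
    max 0 (min (min O.yHi (O.sHi - O.xLo)) (O.xLo - O.mLo) -
      max (max O.yLo (O.sLo - O.xLo)) (O.xLo - O.mHi)),
    max 0 (min (min O.xHi (O.sHi - O.yHi)) (O.mHi + O.yHi) -
      max (max O.xLo (O.sLo - O.yHi)) (O.mLo + O.yHi)),
    max 0 (min (min O.yHi (O.sHi - O.xHi)) (O.xHi - O.mLo) -
      max (max O.yLo (O.sLo - O.xHi)) (O.xHi - O.mHi))]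

/-- Lengths `D_i` of the four diagonal sides (lower-left, upper-left, upper-right, lower-right). -/
noncomputable def D (O : Oct) : Fin 4 → ℝ :=
  ![Real.sqrt 2 * max 0 (min (min O.xHi (O.sLo - O.yLo)) ((O.mHi + O.sLo) / 2) -
      max (max O.xLo (O.sLo - O.yHi)) ((O.mLo + O.sLo) / 2)),
    Real.sqrt 2 * max 0 (min (min O.xHi (O.mLo + O.yHi)) ((O.sHi + O.mLo) / 2) -
      max (max O.xLo (O.mLo + O.yLo)) ((O.sLo + O.mLo) / 2)),
    Real.sqrt 2 * max 0 (min (min O.xHi (O.sHi - O.yLo)) ((O.mHi + O.sHi) / 2) -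
      max (max O.xLo (O.sHi - O.yHi)) ((O.mLo + O.sHi) / 2)),
    Real.sqrt 2 * max 0 (min (min O.xHi (O.mHi + O.yHi)) ((O.sHi + O.mHi) / 2) -
      max (max O.xLo (O.mHi + O.yLo)) ((O.sLo + O.mHi) / 2))]

/-- The positions of the four diagonal supporting lines. -/
def diagPos (O : Oct) : Fin 4 → ℝ := ![O.sLo, O.mLo, O.sHi, O.mHi]

/-- A nondegenerate octagon: all eight sides have positive length. -/
def Nondeg (O : Oct) : Prop := (∀ i, 0 < O.P i) ∧ (∀ i, 0 < O.D i)

/-- The region is an (axis-parallel, possibly degenerate) rectangle. -/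
def IsRect (O : Oct) : Prop :=
  ∃ x₁ x₂ y₁ y₂ : ℝ, O.region = {z : ℝ × ℝ | x₁ ≤ z.1 ∧ z.1 ≤ x₂ ∧ y₁ ≤ z.2 ∧ z.2 ≤ y₂}

end Oct

/-- A discrete octagon: the trace on the lattice of an octagon of the class `𝒲`
(some sides may have zero length). -/
def IsDiscreteOctagon (I : Set Pt) : Prop :=
  ∃ O : Oct, O.region.Nonempty ∧ I = {p : Pt | ((p.1 : ℝ), (p.2 : ℝ)) ∈ O.region}

/-- `A_I ⊆ O`. -/
def OctContains (O : Oct) (ε : ℝ) (I : Set Pt) : Prop := Aset ε I ⊆ O.region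

/-- `O` is the smallest octagon of the class `𝒲` containing `A_I`. -/
def OctMinimal (O : Oct) (ε : ℝ) (I : Set Pt) : Prop :=
  OctContains O ε I ∧ ∀ O' : Oct, OctContains O' ε I → O.region ⊆ O'.region

/-- Extremal coordinates of a (finite nonempty) set of lattice points. -/
noncomputable def xmin (S : Set Pt) : ℤ := sInf (Prod.fst '' S)
noncomputable def xmax (S : Set Pt) : ℤ := sSup (Prod.fst '' S)
noncomputable def ymin (S : Set Pt) : ℤ := sInf (Prod.snd '' S)
noncomputable def ymax (S : Set Pt) : ℤ := sSup (Prod.snd '' S)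

/-- Displacements (in lattice units) `α_i = a_i/ε` of the four axis-parallel sides
(bottom, left, top, right) between `I` and `I' ⊆ I`. -/
noncomputable def alpha (I I' : Set Pt) : Fin 4 → ℤ :=
  ![ymin I' - ymin I, xmin I' - xmin I, ymax I - ymax I', xmax I - xmax I']

/-- The four extreme slices `𝒫_i` (bottom, left, top, right) of `S`. -/
def extSlice (S : Set Pt) : Fin 4 → Set Pt :=
  ![{p ∈ S | ∀ q ∈ S, p.2 ≤ q.2}, {p ∈ S | ∀ q ∈ S, p.1 ≤ q.1},
    {p ∈ S | ∀ q ∈ S, q.2 ≤ p.2}, {p ∈ S | ∀ q ∈ S, q.1 ≤ p.1}]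

/-- The four diagonal sides `𝒟_i` (lower-left, upper-left, upper-right, lower-right) of a
discrete octagon `S`. -/
def diagSlice (S : Set Pt) : Fin 4 → Set Pt :=
  ![{p ∈ S | ∀ q ∈ S, p.1 + p.2 ≤ q.1 + q.2}, {p ∈ S | ∀ q ∈ S, q.2 - q.1 ≤ p.2 - p.1},
    {p ∈ S | ∀ q ∈ S, q.1 + q.2 ≤ p.1 + p.2}, {p ∈ S | ∀ q ∈ S, q.1 - q.2 ≤ p.1 - p.2}]

/-- The four corner components `T_i` of `R_S ∖ S` for a discrete octagon `S`. -/
def Tcorner (S : Set Pt) : Fin 4 → Set Pt :=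
  ![{p | p ∈ Rbox S ∧ p ∉ S ∧ ∀ q ∈ S, p.1 + p.2 < q.1 + q.2},
    {p | p ∈ Rbox S ∧ p ∉ S ∧ ∀ q ∈ S, q.2 - q.1 < p.2 - p.1},
    {p | p ∈ Rbox S ∧ p ∉ S ∧ ∀ q ∈ S, q.1 + q.2 < p.1 + p.2},
    {p | p ∈ Rbox S ∧ p ∉ S ∧ ∀ q ∈ S, q.1 - q.2 < p.1 - p.2}]

/-- `I` is an `ε`-quasi-rectangle with inner octagon `Itil` and corner decorations `Δ`. -/
def IsQuasiRectWith (ε : ℝ) (C : ℕ) (I Itil : Set Pt) (Δ : Fin 4 → Set Pt) : Prop :=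
  IsStaircase I ∧
  I = Itil ∪ (⋃ i, extSlice I i) ∪ (⋃ i, Δ i) ∧
  IsDiscreteOctagon Itil ∧
  Itil ⊆ I \ (⋃ i, extSlice I i) ∧
  (∀ i : Fin 4,
    (diagSlice Itil i).ncard = max (⌈4 * Real.sqrt (C : ℝ)⌉₊) (⌈ε ^ (-(7 : ℝ) / 8)⌉₊)) ∧
  (∀ i : Fin 4, Δ i ⊆ Tcorner Itil i) ∧
  StronglyConnected (Itil ∪ ⋃ i, Δ i)

def IsQuasiRect (ε : ℝ) (C : ℕ) (I : Set Pt) : Prop :=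
  ∃ Itil Δ, IsQuasiRectWith ε C I Itil Δ

/-- Good minimizers. -/
def GoodMinimizer (ε k ζ γ : ℝ) (C : ℕ) (u₁ u₀ : Config) : Prop :=
  Minimizes ε k ζ γ u₁ u₀ ∧
  (IsQuasiRect ε C (Iset u₀) →
    ∃ Itil Δ, IsQuasiRectWith ε C (Iset u₁) Itil Δ ∧
      ∀ p ∈ Ocorner (Iset u₁) ∩ Rbox Itil,
        dB p (Iset u₀) ≤ ENNReal.ofReal
          (((min (min (alpha (Iset u₀) (Iset u₁) 0) (alpha (Iset u₀) (Iset u₁) 1))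
              (min (alpha (Iset u₀) (Iset u₁) 2) (alpha (Iset u₀) (Iset u₁) 3)) : ℤ) : ℝ)))

/-- Distance of a real number from `ℕ`. -/
noncomputable def distToNat (x : ℝ) : ℝ := ⨅ n : ℕ, |x - (n : ℝ)|

/-- The differential inclusion for the velocity of an axis-parallel side of length `Pl`. -/
def PVel (ζ k v Pl : ℝ) : Prop :=
  ((¬ ∃ n : ℕ, (n : ℝ) = 2 * ζ * (1 - k) / Pl) →
      v = (1 / ζ) * ((⌊2 * ζ * (1 - k) / Pl⌋ : ℤ) : ℝ)) ∧
  ((∃ n : ℕ, (n : ℝ) = 2 * ζ * (1 - k) / Pl) →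
      v ∈ Set.Icc (2 * (1 - k) / Pl - 1 / ζ) (2 * (1 - k) / Pl))

/-- The differential inclusion for the velocity of a diagonal side of length `Dl`. -/
def DVel (ζ k v Dl : ℝ) : Prop :=
  ((¬ ∃ n : ℕ, (n : ℝ) = 2 * Real.sqrt 2 * ζ * (1 - k) / Dl) →
      v = (Real.sqrt 2 / (2 * ζ)) * ((⌊2 * Real.sqrt 2 * ζ * (1 - k) / Dl⌋ : ℤ) : ℝ)) ∧
  ((∃ n : ℕ, (n : ℝ) = 2 * Real.sqrt 2 * ζ * (1 - k) / Dl) →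
      v ∈ Set.Icc (2 * (1 - k) / Dl - Real.sqrt 2 / (2 * ζ)) (2 * (1 - k) / Dl))

/-- The differential inclusion for the velocity of a side of a rectangle of side length `Pl`
(the `γ < 2` regime). -/
def PVelRect (ζ k v Pl : ℝ) : Prop :=
  ((¬ ∃ n : ℕ, (n : ℝ) = 2 * ζ * (1 - k) / Pl) →
      v ∈ Set.Icc ((1 / ζ) * ((⌊2 * ζ * (1 - k) / Pl⌋ : ℤ) : ℝ))
            ((1 / ζ) * ((⌈2 * ζ * (1 - k) / Pl⌉ : ℤ) : ℝ))) ∧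
  ((∃ n : ℕ, (n : ℝ) = 2 * ζ * (1 - k) / Pl) →
      v ∈ Set.Icc (2 * (1 - k) / Pl - 1 / ζ) (2 * (1 - k) / Pl + 1 / ζ))


section

/-- The spin values. -/
def IsSpin (a : ℤ) : Prop := a = -1 ∨ a = 0 ∨ a = 1

/-- The cost of a bond in units of `ε`, with `κ = 1 - k`. -/
noncomputable def bc (κ : ℝ) (a b : ℤ) : ℝ := if a = 0 ∨ b = 0 then κ else if a = b then 0 else 2

theorem bc_zero_left (κ : ℝ) (b : ℤ) : bc κ 0 b = κ := by simp [bc]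
theorem bc_zero_right (κ : ℝ) (a : ℤ) : bc κ a 0 = κ := by simp [bc]
theorem bc_neg_neg (κ : ℝ) : bc κ (-1) (-1) = 0 := by simp [bc]
theorem bc_one_one (κ : ℝ) : bc κ 1 1 = 0 := by simp [bc]

theorem bc_one_neg (κ : ℝ) : bc κ 1 (-1) = 2 := by norm_num [bc]
theorem bc_neg_one (κ : ℝ) : bc κ (-1) 1 = 2 := by norm_num [bc]

theorem bc_comm (κ : ℝ) (a b : ℤ) : bc κ a b = bc κ b a := by
  simp only [bc, or_comm, eq_comm]

theorem bc_nonneg {κ : ℝ} (hκ : 0 ≤ κ) (a b : ℤ) : 0 ≤ bc κ a b := by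
  unfold bc; split_ifs <;> linarith

theorem bc_le_two {κ : ℝ} (hκ : κ ≤ 2) (a b : ℤ) : bc κ a b ≤ 2 := by
  unfold bc; split_ifs <;> linarith

/-- Submodularity of the bond cost. -/
theorem bc_submodular {κ : ℝ} (h0 : 0 ≤ κ) (h1 : κ ≤ 2) {a b c d : ℤ}
    (ha : IsSpin a) (hb : IsSpin b) (hc : IsSpin c) (hd : IsSpin d) :
    bc κ (max a c) (max b d) + bc κ (min a c) (min b d) ≤ bc κ a b + bc κ c d := by
  rcases ha with rfl | rfl | rfl <;> rcases hb with rfl | rfl | rfl <;>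
    rcases hc with rfl | rfl | rfl <;> rcases hd with rfl | rfl | rfl <;>
    norm_num [bc] <;> linarith

/-- The indicator of a zero. -/
noncomputable def zi (a : ℤ) : ℝ := if a = 0 then 1 else 0

theorem zi_zero : zi 0 = 1 := by simp [zi]
theorem zi_of_ne {a : ℤ} (h : a ≠ 0) : zi a = 0 := by simp [zi, h]
theorem zi_one : zi 1 = 0 := by simp [zi]
theorem zi_neg_one : zi (-1) = 0 := by simp [zi]

theorem zi_nonneg (a : ℤ) : 0 ≤ zi a := by unfold zi; split_ifs <;> norm_num

theorem zi_le_bc_left {κ : ℝ} (hκ : 0 ≤ κ) (a b : ℤ) : κ * zi a ≤ bc κ a b := by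
  unfold zi; split_ifs with h
  · subst h; simp [bc]
  · simpa using bc_nonneg hκ a b

theorem zi_le_bc_right {κ : ℝ} (hκ : 0 ≤ κ) (a b : ℤ) : κ * zi b ≤ bc κ a b := by
  rw [bc_comm]; exact zi_le_bc_left hκ b a

theorem zi_max_add_min (a b : ℤ) : zi (max a b) + zi (min a b) = zi a + zi b := by
  rcases le_total a b with h | h <;> simp [h, add_comm]

/-- Energy of a line inside the window `[-K, K]`. -/
noncomputable def lineE (κ : ℝ) (K : ℤ) (f : ℤ → ℤ) : ℝ :=
  ∑ t ∈ Finset.Ico (-K) K, bc κ (f t) (f (t + 1))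

/-- Number of zeros on a line. -/
noncomputable def lineZ (K : ℤ) (f : ℤ → ℤ) : ℝ := ∑ t ∈ Finset.Ico (-K) K, zi (f t)

/-- A line configuration which is `-1` outside the window. -/
structure LineCfg (K : ℤ) (f : ℤ → ℤ) : Prop where
  spin : ∀ t, IsSpin (f t)
  supp : ∀ t, f t ≠ -1 → -K < t ∧ t < K

theorem sum_Ico_split (g : ℤ → ℝ) {a b c : ℤ} (hab : a ≤ b) (hbc : b ≤ c) :
    ∑ t ∈ Finset.Ico a c, g t = ∑ t ∈ Finset.Ico a b, g t + ∑ t ∈ Finset.Ico b c, g t := by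
  rw [← Finset.Ico_union_Ico_eq_Ico hab hbc,
    Finset.sum_union (Finset.Ico_disjoint_Ico_consecutive a b c)]

theorem sum_Ico_first (g : ℤ → ℝ) {a c : ℤ} (h : a < c) :
    ∑ t ∈ Finset.Ico a c, g t = g a + ∑ t ∈ Finset.Ico (a + 1) c, g t := by
  rw [sum_Ico_split g (b := a + 1) (by omega) (by omega)]
  have : Finset.Ico a (a + 1) = {a} := by ext t; simp; omega
  simp [this]

theorem sum_Ico_last (g : ℤ → ℝ) {a c : ℤ} (h : a < c) :
    ∑ t ∈ Finset.Ico a c, g t = ∑ t ∈ Finset.Ico a (c - 1), g t + g (c - 1) := by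
  rw [sum_Ico_split g (b := c - 1) (by omega) (by omega)]
  have : Finset.Ico (c - 1) c = {c - 1} := by ext t; simp; omega
  simp [this]

theorem sum_Ico_shift (g : ℤ → ℝ) (a c : ℤ) :
    ∑ t ∈ Finset.Ico a c, g (t + 1) = ∑ t ∈ Finset.Ico (a + 1) (c + 1), g t :=
  Finset.sum_nbij (fun t => t + 1) (fun t ht => by simp at ht ⊢; omega)
    (fun a _ b _ h => by simpa using h)
    (fun t ht => ⟨t - 1, by simp at ht ⊢; omega, by simp⟩) (fun _ _ => rfl)

variable {κ : ℝ} {K : ℤ} {f : ℤ → ℤ}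

theorem sum_zi_le_left (hκ : 0 ≤ κ) (a c : ℤ) :
    κ * ∑ t ∈ Finset.Ico a c, zi (f t) ≤ ∑ t ∈ Finset.Ico a c, bc κ (f t) (f (t + 1)) := by
  rw [Finset.mul_sum]
  exact Finset.sum_le_sum fun t _ => zi_le_bc_left hκ _ _

theorem sum_zi_le_right (hκ : 0 ≤ κ) (a c : ℤ) :
    κ * ∑ t ∈ Finset.Ico (a + 1) (c + 1), zi (f t) ≤
      ∑ t ∈ Finset.Ico a c, bc κ (f t) (f (t + 1)) := by
  rw [← sum_Ico_shift (fun t => zi (f t)), Finset.mul_sum]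
  exact Finset.sum_le_sum fun t _ => zi_le_bc_right hκ _ _

theorem lineZ_nonneg : 0 ≤ lineZ K f := Finset.sum_nonneg fun _ _ => zi_nonneg _

theorem lineE_ge_zeros (hκ : 0 ≤ κ) : κ * lineZ K f ≤ lineE κ K f := sum_zi_le_left hκ _ _

/-- `1` if the end is not occupied by a zero. -/
noncomputable def nz (a : ℤ) : ℝ := if a = 0 then 0 else 1

theorem nz_zero : nz 0 = 0 := by simp [nz]
theorem nz_of_ne {a : ℤ} (h : a ≠ 0) : nz a = 1 := by simp [nz, h]

theorem nz_nonneg (a : ℤ) : 0 ≤ nz a := by unfold nz; split_ifs <;> norm_num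

theorem right_end_cost (hκ : 0 ≤ κ) (hf : LineCfg K f) {q : ℤ} (hq : f q = 1)
    (hmax : ∀ t, q < t → f t ≠ 1) :
    κ * (∑ t ∈ Finset.Ico q K, zi (f t) + 1) + (2 - κ) * nz (f (q + 1)) ≤
      ∑ t ∈ Finset.Ico q K, bc κ (f t) (f (t + 1)) := by
  have hqK := (hf.supp q (by omega)).2
  rw [sum_Ico_first _ hqK, sum_Ico_first _ hqK, hq]
  have h := sum_zi_le_left (κ := κ) (f := f) hκ (q + 1) K
  have h1 := hmax (q + 1) (by omega)
  rcases hf.spin (q + 1) with h2 | h2 | h2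
  · rw [h2, zi_one, bc_one_neg, nz_of_ne (by norm_num)]; linarith
  · rw [h2, zi_one, bc_zero_right, nz_zero]; linarith
  · exact absurd h2 h1

theorem left_end_cost (hκ : 0 ≤ κ) (hf : LineCfg K f) {q : ℤ} (hq : f q = 1)
    (hmin : ∀ t, t < q → f t ≠ 1) :
    κ * (∑ t ∈ Finset.Ico (-K) q, zi (f t) + 1) + (2 - κ) * nz (f (q - 1)) ≤
      ∑ t ∈ Finset.Ico (-K) q, bc κ (f t) (f (t + 1)) := by
  have hqK := (hf.supp q (by omega)).1
  have hK : f (-K) = -1 := by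
    by_contra h; have := hf.supp _ h; omega
  rw [sum_Ico_last (fun t => bc κ (f t) (f (t + 1))) hqK]
  have h := sum_zi_le_right (κ := κ) (f := f) hκ (-K) (q - 1)
  rw [show q - 1 + 1 = q by ring] at h ⊢
  rw [hq, sum_Ico_first (fun t => zi (f t)) hqK, hK, zi_neg_one]
  have h1 := hmin (q - 1) (by omega)
  rcases hf.spin (q - 1) with h2 | h2 | h2
  · rw [h2, bc_neg_one, nz_of_ne (by norm_num)]; linarith
  · rw [h2, bc_zero_left, nz_zero]; linarith
  · exact absurd h2 h1

theorem lineE_ge_of_ends (hκ : 0 ≤ κ) (hf : LineCfg K f) {q₁ q₂ : ℤ}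
    (h₁ : f q₁ = 1) (hmin : ∀ t, t < q₁ → f t ≠ 1) (h₂ : f q₂ = 1)
    (hmax : ∀ t, q₂ < t → f t ≠ 1) :
    κ * (lineZ K f + 2) + (2 - κ) * (nz (f (q₁ - 1)) + nz (f (q₂ + 1))) ≤ lineE κ K f := by
  have hq : q₁ ≤ q₂ := by
    by_contra h
    exact hmax q₁ (by omega) h₁
  have ha := hf.supp q₁ (by omega)
  have hb := hf.supp q₂ (by omega)
  unfold lineZ lineE
  rw [sum_Ico_split _ (b := q₁) (by omega) (by omega),
    sum_Ico_split _ (a := q₁) (b := q₂) (by omega) (by omega),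
    sum_Ico_split (fun t => bc κ (f t) (f (t + 1))) (b := q₁) (by omega) (by omega),
    sum_Ico_split (fun t => bc κ (f t) (f (t + 1))) (a := q₁) (b := q₂) (by omega) (by omega)]
  have e₁ := left_end_cost hκ hf h₁ hmin
  have e₂ := right_end_cost hκ hf h₂ hmax
  have e₃ := sum_zi_le_left (κ := κ) (f := f) hκ q₁ q₂
  nlinarith

theorem exists_max_of_bdd {P : ℤ → Prop} {a b : ℤ} (hP : ∃ t, P t)
    (hb : ∀ t, P t → a ≤ t ∧ t ≤ b) : ∃ q, P q ∧ ∀ t, q < t → ¬ P t := by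
  obtain ⟨q, hq, h⟩ := Int.exists_greatest_of_bdd (P := P) ⟨b, fun z hz => (hb z hz).2⟩ hP
  exact ⟨q, hq, fun t ht hPt => by have := h t hPt; omega⟩

theorem exists_min_of_bdd {P : ℤ → Prop} {a b : ℤ} (hP : ∃ t, P t)
    (hb : ∀ t, P t → a ≤ t ∧ t ≤ b) : ∃ q, P q ∧ ∀ t, t < q → ¬ P t := by
  obtain ⟨q, hq, h⟩ := Int.exists_least_of_bdd (P := P) ⟨a, fun z hz => (hb z hz).1⟩ hP
  exact ⟨q, hq, fun t ht hPt => by have := h t hPt; omega⟩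

theorem LineCfg.exists_max (hf : LineCfg K f) (h : ∃ t, f t = 1) :
    ∃ q, f q = 1 ∧ ∀ t, q < t → f t ≠ 1 :=
  exists_max_of_bdd (P := fun t => f t = 1) (a := -K) (b := K) h fun t ht => by
    have := hf.supp t (by omega); omega

theorem LineCfg.exists_min (hf : LineCfg K f) (h : ∃ t, f t = 1) :
    ∃ q, f q = 1 ∧ ∀ t, t < q → f t ≠ 1 :=
  exists_min_of_bdd (P := fun t => f t = 1) (a := -K) (b := K) h fun t ht => by
    have := hf.supp t (by omega); omega

theorem lineE_ge_of_nonempty (hκ : 0 ≤ κ) (hκ2 : κ ≤ 2) (hf : LineCfg K f) (h : ∃ t, f t ≠ -1) :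
    κ * (lineZ K f + 1) ≤ lineE κ K f := by
  by_cases h1 : ∃ t, f t = 1
  · obtain ⟨q₂, h₂, hmax⟩ := hf.exists_max h1
    obtain ⟨q₁, h₁, hmin⟩ := hf.exists_min h1
    have := lineE_ge_of_ends hκ hf h₁ hmin h₂ hmax
    have := nz_nonneg (f (q₁ - 1))
    have := nz_nonneg (f (q₂ + 1))
    nlinarith
  · push Not at h1
    obtain ⟨q, hq, hmin⟩ := exists_min_of_bdd (P := fun t => f t ≠ -1) (a := -K) (b := K) h
      fun t ht => by have := hf.supp t ht; omega
    have hq0 : f q = 0 := by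
      rcases hf.spin q with h | h | h
      · exact absurd h hq
      · exact h
      · exact absurd h (h1 q)
    have hqK := hf.supp q hq
    have hq1 : f (q - 1) = -1 := by simpa using hmin (q - 1) (by omega)
    unfold lineZ lineE
    rw [sum_Ico_split _ (b := q - 1) (by omega) (by omega),
      sum_Ico_first _ (a := q - 1) (by omega),
      sum_Ico_split (fun t => bc κ (f t) (f (t + 1))) (b := q - 1) (by omega) (by omega),
      sum_Ico_first (fun t => bc κ (f t) (f (t + 1))) (a := q - 1) (by omega)]
    have e₁ := sum_zi_le_left (κ := κ) (f := f) hκ (-K) (q - 1)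
    have e₂ := sum_zi_le_left (κ := κ) (f := f) hκ (q - 1 + 1) K
    rw [show q - 1 + 1 = q by ring] at *
    rw [hq0, hq1, bc_zero_right]
    norm_num [zi] at *
    nlinarith

/-- Reaching `-1` from `1` costs at least `2κ`. -/
theorem two_mul_le_of_plus (hκ : 0 ≤ κ) (hκ1 : κ ≤ 1) (hf : LineCfg K f) {a : ℤ}
    (h : ∃ t, a ≤ t ∧ f t = 1) :
    2 * κ ≤ ∑ t ∈ Finset.Ico a K, bc κ (f t) (f (t + 1)) := by
  obtain ⟨t, hat, ht⟩ := h
  obtain ⟨q, hq, hmax⟩ := hf.exists_max ⟨t, ht⟩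
  have htq : t ≤ q := by
    by_contra h
    exact hmax t (by omega) ht
  have := hf.supp q (by omega)
  rw [sum_Ico_split _ (b := q) (by omega) (by omega), sum_Ico_first _ this.2]
  have e := right_end_cost hκ hf hq hmax
  have e1 : 0 ≤ ∑ t ∈ Finset.Ico a q, bc κ (f t) (f (t + 1)) :=
    Finset.sum_nonneg fun _ _ => bc_nonneg hκ _ _
  rw [sum_Ico_first (fun t => bc κ (f t) (f (t + 1))) this.2,
    sum_Ico_first (fun t => zi (f t)) this.2] at e
  have e2 : 0 ≤ ∑ t ∈ Finset.Ico (q + 1) K, zi (f t) := Finset.sum_nonneg fun _ _ => zi_nonneg _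
  by_cases h0 : f (q + 1) = 0
  · have hK : q + 1 < K := (hf.supp (q + 1) (by omega)).2
    rw [sum_Ico_first (fun t => zi (f t)) hK, h0, hq, zi_one, zi_zero, nz_zero] at e
    have e3 : 0 ≤ ∑ t ∈ Finset.Ico (q + 1 + 1) K, zi (f t) :=
      Finset.sum_nonneg fun _ _ => zi_nonneg _
    rw [hq, h0]
    nlinarith
  · rw [nz_of_ne h0, hq, zi_one] at e
    rw [hq]
    nlinarith

/-- The line configuration read backwards. -/
theorem LineCfg.neg (hf : LineCfg K f) : LineCfg K (fun t => f (-t)) :=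
  ⟨fun t => hf.spin _, fun t ht => by have := hf.supp _ ht; omega⟩

theorem sum_bc_neg (κ : ℝ) (f : ℤ → ℤ) (a c : ℤ) :
    ∑ t ∈ Finset.Ico a c, bc κ (f (-t)) (f (-(t + 1))) =
      ∑ t ∈ Finset.Ico (-c) (-a), bc κ (f t) (f (t + 1)) :=
  Finset.sum_nbij (fun t => -t - 1) (fun t ht => by simp at ht ⊢; omega)
    (fun a _ b _ h => by simpa using h)
    (fun t ht => ⟨-t - 1, by simp at ht ⊢; omega, by simp⟩)
    (fun t _ => by rw [bc_comm]; ring_nf)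

theorem lineE_neg (κ : ℝ) (K : ℤ) (f : ℤ → ℤ) : lineE κ K (fun t => f (-t)) = lineE κ K f := by
  unfold lineE; rw [sum_bc_neg, neg_neg]

end

section

/-- A spin configuration on the grid which is `-1` outside the window. -/
structure GridCfg (K : ℤ) (f : Pt → ℤ) : Prop where
  spin : ∀ p, IsSpin (f p)
  supp : ∀ p, f p ≠ -1 → (-K < p.1 ∧ p.1 < K) ∧ (-K < p.2 ∧ p.2 < K)

/-- The window. -/
noncomputable def win (K : ℤ) : Finset Pt := Finset.Ioo (-K) K ×ˢ Finset.Ioo (-K) K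

theorem mem_win {K : ℤ} {p : Pt} : p ∈ win K ↔ (-K < p.1 ∧ p.1 < K) ∧ (-K < p.2 ∧ p.2 < K) := by
  simp [win]

/-- Energy in units of `ε`, summed over columns and rows of the window. -/
noncomputable def gridE (κ : ℝ) (K : ℤ) (f : Pt → ℤ) : ℝ :=
  ∑ x ∈ Finset.Ioo (-K) K, lineE κ K (fun y => f (x, y)) +
    ∑ y ∈ Finset.Ioo (-K) K, lineE κ K (fun x => f (x, y))

/-- Number of zeros in the window. -/
noncomputable def gridZ (K : ℤ) (f : Pt → ℤ) : ℝ := ∑ p ∈ win K, zi (f p)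

variable {κ : ℝ} {K : ℤ} {f g : Pt → ℤ}

theorem GridCfg.mem_win (hf : GridCfg K f) {p : Pt} (h : f p ≠ -1) : p ∈ win K :=
  BEG.mem_win.2 (hf.supp p h)

theorem GridCfg.col (hf : GridCfg K f) (x : ℤ) : LineCfg K (fun y => f (x, y)) :=
  ⟨fun _ => hf.spin _, fun _ h => (hf.supp _ h).2⟩

theorem GridCfg.row (hf : GridCfg K f) (y : ℤ) : LineCfg K (fun x => f (x, y)) :=
  ⟨fun _ => hf.spin _, fun _ h => (hf.supp _ h).1⟩

theorem IsSpin.max {a b : ℤ} (ha : IsSpin a) (hb : IsSpin b) : IsSpin (max a b) := by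
  rcases max_choice a b with h | h <;> rw [h] <;> assumption

theorem IsSpin.min {a b : ℤ} (ha : IsSpin a) (hb : IsSpin b) : IsSpin (min a b) := by
  rcases min_choice a b with h | h <;> rw [h] <;> assumption

theorem IsSpin.neg_one_le {a : ℤ} (ha : IsSpin a) : -1 ≤ a := by
  rcases ha with h | h | h <;> omega

theorem GridCfg.max (hf : GridCfg K f) (hg : GridCfg K g) :
    GridCfg K (fun p => Max.max (f p) (g p)) :=
  ⟨fun p => (hf.spin p).max (hg.spin p), fun p h => by
    rcases max_choice (f p) (g p) with h1 | h1
    · exact hf.supp p (by rwa [h1] at h)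
    · exact hg.supp p (by rwa [h1] at h)⟩

theorem GridCfg.min (hf : GridCfg K f) (hg : GridCfg K g) :
    GridCfg K (fun p => Min.min (f p) (g p)) :=
  ⟨fun p => (hf.spin p).min (hg.spin p), fun p h => by
    rcases min_choice (f p) (g p) with h1 | h1
    · exact hf.supp p (by rwa [h1] at h)
    · exact hg.supp p (by rwa [h1] at h)⟩

theorem LineCfg.sum_Ioo {K : ℤ} {f : ℤ → ℤ} (hf : LineCfg K f) :
    ∑ t ∈ Finset.Ioo (-K) K, zi (f t) = lineZ K f := by
  refine Finset.sum_subset (fun t ht => by simp at ht ⊢; omega) fun t ht h => ?_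
  have : f t = -1 := by
    by_contra h1
    have := hf.supp t h1
    simp at ht h; omega
  rw [this, zi_neg_one]

theorem GridCfg.gridZ_col (hf : GridCfg K f) :
    gridZ K f = ∑ x ∈ Finset.Ioo (-K) K, lineZ K (fun y => f (x, y)) := by
  rw [gridZ, win, Finset.sum_product]
  exact Finset.sum_congr rfl fun x _ => (hf.col x).sum_Ioo

theorem GridCfg.gridZ_row (hf : GridCfg K f) :
    gridZ K f = ∑ y ∈ Finset.Ioo (-K) K, lineZ K (fun x => f (x, y)) := by
  rw [gridZ, win, Finset.sum_product_right]
  exact Finset.sum_congr rfl fun x _ => (hf.row x).sum_Ioo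

theorem gridZ_max_add_min (K : ℤ) (f g : Pt → ℤ) :
    gridZ K (fun p => max (f p) (g p)) + gridZ K (fun p => min (f p) (g p)) =
      gridZ K f + gridZ K g := by
  simp only [gridZ, ← Finset.sum_add_distrib, zi_max_add_min]

theorem gridE_submodular (h0 : 0 ≤ κ) (h1 : κ ≤ 2) (hf : GridCfg K f) (hg : GridCfg K g) :
    gridE κ K (fun p => max (f p) (g p)) + gridE κ K (fun p => min (f p) (g p)) ≤
      gridE κ K f + gridE κ K g := by
  have key : ∀ p q : Pt, bc κ (max (f p) (g p)) (max (f q) (g q)) +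
      bc κ (min (f p) (g p)) (min (f q) (g q)) ≤ bc κ (f p) (f q) + bc κ (g p) (g q) :=
    fun p q => bc_submodular h0 h1 (hf.spin p) (hf.spin q) (hg.spin p) (hg.spin q)
  have hc : ∀ x, lineE κ K (fun y => max (f (x, y)) (g (x, y))) +
      lineE κ K (fun y => min (f (x, y)) (g (x, y))) ≤
      lineE κ K (fun y => f (x, y)) + lineE κ K (fun y => g (x, y)) := fun x => by
    simp only [lineE, ← Finset.sum_add_distrib]
    exact Finset.sum_le_sum fun t _ => key _ _
  have hr : ∀ y, lineE κ K (fun x => max (f (x, y)) (g (x, y))) +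
      lineE κ K (fun x => min (f (x, y)) (g (x, y))) ≤
      lineE κ K (fun x => f (x, y)) + lineE κ K (fun x => g (x, y)) := fun y => by
    simp only [lineE, ← Finset.sum_add_distrib]
    exact Finset.sum_le_sum fun t _ => key _ _
  have h2 := Finset.sum_le_sum fun x (_ : x ∈ Finset.Ioo (-K) K) => hc x
  have h3 := Finset.sum_le_sum fun x (_ : x ∈ Finset.Ioo (-K) K) => hr x
  simp only [Finset.sum_add_distrib] at h2 h3
  unfold gridE
  linarith

/-- Comparison of energies through comparison of bonds: the errors `a`, `a'` are attached to the
first and the second end of vertical bonds, `b`, `b'` to those of horizontal bonds. -/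
theorem gridE_le_of_bonds {a a' b b' : Pt → ℝ}
    (ha : ∀ p, p ∉ win K → a p = 0) (ha' : ∀ p, p ∉ win K → a' p = 0)
    (hb : ∀ p, p ∉ win K → b p = 0) (hb' : ∀ p, p ∉ win K → b' p = 0)
    (hv : ∀ x y, bc κ (g (x, y)) (g (x, y + 1)) ≤
      bc κ (f (x, y)) (f (x, y + 1)) + a (x, y) + a' (x, y + 1))
    (hh : ∀ x y, bc κ (g (x, y)) (g (x + 1, y)) ≤
      bc κ (f (x, y)) (f (x + 1, y)) + b (x, y) + b' (x + 1, y)) :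
    gridE κ K g ≤ gridE κ K f + ∑ p ∈ win K, (a p + a' p + b p + b' p) := by
  have s1 : ∀ c : ℤ → ℝ, (∀ t, t ∉ Finset.Ioo (-K) K → c t = 0) →
      ∑ t ∈ Finset.Ico (-K) K, c t = ∑ t ∈ Finset.Ioo (-K) K, c t := fun c hc => by
    symm
    exact Finset.sum_subset (fun t ht => by simp at ht ⊢; omega) fun t _ h => hc t h
  have s2 : ∀ c : ℤ → ℝ, (∀ t, t ∉ Finset.Ioo (-K) K → c t = 0) →
      ∑ t ∈ Finset.Ico (-K) K, c (t + 1) = ∑ t ∈ Finset.Ioo (-K) K, c t := fun c hc => by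
    rw [sum_Ico_shift]
    symm
    exact Finset.sum_subset (fun t ht => by simp at ht ⊢; omega) fun t _ h => hc t h
  have hcol : ∀ x, lineE κ K (fun y => g (x, y)) ≤ lineE κ K (fun y => f (x, y)) +
      ∑ y ∈ Finset.Ioo (-K) K, (a (x, y) + a' (x, y)) := fun x => by
    have := Finset.sum_le_sum fun y (_ : y ∈ Finset.Ico (-K) K) => hv x y
    rw [Finset.sum_add_distrib, Finset.sum_add_distrib,
      s1 (fun y => a (x, y)) (fun t ht => ha _ fun h => ht (by simpa [win] using (mem_win.1 h).2)),
      s2 (fun y => a' (x, y)) (fun t ht => ha' _ fun h => ht (by simpa [win] using (mem_win.1 h).2))]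
      at this
    rw [Finset.sum_add_distrib]
    unfold lineE
    linarith
  have hrow : ∀ y, lineE κ K (fun x => g (x, y)) ≤ lineE κ K (fun x => f (x, y)) +
      ∑ x ∈ Finset.Ioo (-K) K, (b (x, y) + b' (x, y)) := fun y => by
    have := Finset.sum_le_sum fun x (_ : x ∈ Finset.Ico (-K) K) => hh x y
    rw [Finset.sum_add_distrib, Finset.sum_add_distrib,
      s1 (fun x => b (x, y)) (fun t ht => hb _ fun h => ht (by simpa [win] using (mem_win.1 h).1)),
      s2 (fun x => b' (x, y)) (fun t ht => hb' _ fun h => ht (by simpa [win] using (mem_win.1 h).1))]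
      at this
    rw [Finset.sum_add_distrib]
    unfold lineE
    linarith
  have h2 := Finset.sum_le_sum fun x (_ : x ∈ Finset.Ioo (-K) K) => hcol x
  have h3 := Finset.sum_le_sum fun x (_ : x ∈ Finset.Ioo (-K) K) => hrow x
  have e1 : ∑ p ∈ win K, (a p + a' p + b p + b' p) =
      ∑ x ∈ Finset.Ioo (-K) K, ∑ y ∈ Finset.Ioo (-K) K, (a (x, y) + a' (x, y)) +
      ∑ y ∈ Finset.Ioo (-K) K, ∑ x ∈ Finset.Ioo (-K) K, (b (x, y) + b' (x, y)) := by
    rw [← Finset.sum_product (f := fun p => a p + a' p),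
      ← Finset.sum_product_right (f := fun p => b p + b' p), win, ← Finset.sum_add_distrib]
    exact Finset.sum_congr rfl fun p _ => by ring
  simp only [Finset.sum_add_distrib (s := Finset.Ioo (-K) K) (f := fun x => lineE κ K _)] at h2 h3
  unfold gridE
  rw [e1]
  linarith

end

/-- Integer octagons, given by their eight supporting lines. -/
structure LatOct where
  yLo : ℤ
  yHi : ℤ
  xLo : ℤ
  xHi : ℤ
  sLo : ℤ
  sHi : ℤ
  mLo : ℤ
  mHi : ℤ

/-- The lattice points of an integer octagon. -/
def LatOct.set (O : LatOct) : Set Pt :=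
  {p | (O.yLo ≤ p.2 ∧ p.2 ≤ O.yHi) ∧ (O.xLo ≤ p.1 ∧ p.1 ≤ O.xHi) ∧
    (O.sLo ≤ p.1 + p.2 ∧ p.1 + p.2 ≤ O.sHi) ∧ (O.mLo ≤ p.1 - p.2 ∧ p.1 - p.2 ≤ O.mHi)}

theorem LatOct.mem_set {O : LatOct} {x y : ℤ} : (x, y) ∈ O.set ↔
    (O.yLo ≤ y ∧ y ≤ O.yHi) ∧ (O.xLo ≤ x ∧ x ≤ O.xHi) ∧
    (O.sLo ≤ x + y ∧ x + y ≤ O.sHi) ∧ (O.mLo ≤ x - y ∧ x - y ≤ O.mHi) := Iff.rfl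

/-- `O` is the smallest octagon containing `A`. -/
structure IsHull (A : Set Pt) (O : LatOct) : Prop where
  sub : ∀ x y, (x, y) ∈ A → (x, y) ∈ O.set
  yLo : ∃ x y, (x, y) ∈ A ∧ y = O.yLo
  yHi : ∃ x y, (x, y) ∈ A ∧ y = O.yHi
  xLo : ∃ x y, (x, y) ∈ A ∧ x = O.xLo
  xHi : ∃ x y, (x, y) ∈ A ∧ x = O.xHi
  sLo : ∃ x y, (x, y) ∈ A ∧ x + y = O.sLo
  sHi : ∃ x y, (x, y) ∈ A ∧ x + y = O.sHi
  mLo : ∃ x y, (x, y) ∈ A ∧ x - y = O.mLo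
  mHi : ∃ x y, (x, y) ∈ A ∧ x - y = O.mHi

/-- All eight bounds of the octagon are attained. -/
def LatOct.Tight (O : LatOct) : Prop := IsHull O.set O

theorem IsHull.tight {A : Set Pt} {O : LatOct} (h : IsHull A O) : O.Tight := by
  obtain ⟨h0, ⟨a1, b1, h1, e1⟩, ⟨a2, b2, h2, e2⟩, ⟨a3, b3, h3, e3⟩, ⟨a4, b4, h4, e4⟩,
    ⟨a5, b5, h5, e5⟩, ⟨a6, b6, h6, e6⟩, ⟨a7, b7, h7, e7⟩, ⟨a8, b8, h8, e8⟩⟩ := h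
  exact ⟨fun _ _ h => h, ⟨a1, b1, h0 _ _ h1, e1⟩, ⟨a2, b2, h0 _ _ h2, e2⟩,
    ⟨a3, b3, h0 _ _ h3, e3⟩, ⟨a4, b4, h0 _ _ h4, e4⟩, ⟨a5, b5, h0 _ _ h5, e5⟩,
    ⟨a6, b6, h0 _ _ h6, e6⟩, ⟨a7, b7, h0 _ _ h7, e7⟩, ⟨a8, b8, h0 _ _ h8, e8⟩⟩

theorem exists_isHull {A : Set Pt} (hA : A.Finite) (hne : A.Nonempty) : ∃ O, IsHull A O := by
  obtain ⟨⟨a1, b1⟩, h1, l1⟩ := Set.exists_min_image A (fun p => p.2) hA hne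
  obtain ⟨⟨a2, b2⟩, h2, l2⟩ := Set.exists_max_image A (fun p => p.2) hA hne
  obtain ⟨⟨a3, b3⟩, h3, l3⟩ := Set.exists_min_image A (fun p => p.1) hA hne
  obtain ⟨⟨a4, b4⟩, h4, l4⟩ := Set.exists_max_image A (fun p => p.1) hA hne
  obtain ⟨⟨a5, b5⟩, h5, l5⟩ := Set.exists_min_image A (fun p => p.1 + p.2) hA hne
  obtain ⟨⟨a6, b6⟩, h6, l6⟩ := Set.exists_max_image A (fun p => p.1 + p.2) hA hne
  obtain ⟨⟨a7, b7⟩, h7, l7⟩ := Set.exists_min_image A (fun p => p.1 - p.2) hA hne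
  obtain ⟨⟨a8, b8⟩, h8, l8⟩ := Set.exists_max_image A (fun p => p.1 - p.2) hA hne
  exact ⟨⟨b1, b2, a3, a4, a5 + b5, a6 + b6, a7 - b7, a8 - b8⟩,
    fun x y h => ⟨⟨l1 _ h, l2 _ h⟩, ⟨l3 _ h, l4 _ h⟩, ⟨l5 _ h, l6 _ h⟩, ⟨l7 _ h, l8 _ h⟩⟩,
    ⟨a1, b1, h1, rfl⟩, ⟨a2, b2, h2, rfl⟩, ⟨a3, b3, h3, rfl⟩, ⟨a4, b4, h4, rfl⟩,
    ⟨a5, b5, h5, rfl⟩, ⟨a6, b6, h6, rfl⟩, ⟨a7, b7, h7, rfl⟩, ⟨a8, b8, h8, rfl⟩⟩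

/-- The consequences of strong connectedness needed for the lower bound: intermediate values of
the coordinates, and no crossing of the two half-lines which bound a quadrant. -/
structure Conn (A : Set Pt) : Prop where
  x : ∀ a b a' b' t, (a, b) ∈ A → (a', b') ∈ A → a ≤ t → t ≤ a' → ∃ r, (t, r) ∈ A
  y : ∀ a b a' b' t, (a, b) ∈ A → (a', b') ∈ A → b ≤ t → t ≤ b' → ∃ r, (r, t) ∈ A
  quad : ∀ σ τ z w : ℤ, (σ = 1 ∨ σ = -1) → (τ = 1 ∨ τ = -1) →
    (∀ t, 0 ≤ τ * (t - w) → (z, t) ∉ A) → (∀ t, 0 ≤ σ * (t - z) → (t, w) ∉ A) →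
    ∀ a b a' b', (a, b) ∈ A → (a', b') ∈ A → 0 < σ * (a - z) → 0 < τ * (b - w) →
      0 < σ * (a' - z) ∧ 0 < τ * (b' - w)

theorem LatOct.conn (O : LatOct) : Conn O.set := by
  have hx : ∀ a b a' b' t, (a, b) ∈ O.set → (a', b') ∈ O.set → a ≤ t → t ≤ a' →
      ∃ r, (t, r) ∈ O.set := by
    intro a b a' b' t h h' h1 h2
    refine ⟨b + max (-(t - a)) (min (t - a) (b' - b)), ?_⟩
    simp only [LatOct.mem_set] at *
    omega
  have hy : ∀ a b a' b' t, (a, b) ∈ O.set → (a', b') ∈ O.set → b ≤ t → t ≤ b' →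
      ∃ r, (r, t) ∈ O.set := by
    intro a b a' b' t h h' h1 h2
    refine ⟨a + max (-(t - b)) (min (t - b) (a' - a)), ?_⟩
    simp only [LatOct.mem_set] at *
    omega
  have hx2 : ∀ a b a' b' t, (a, b) ∈ O.set → (a', b') ∈ O.set →
      a ≤ t ∧ t ≤ a' ∨ a' ≤ t ∧ t ≤ a → ∃ r, (t, r) ∈ O.set := by
    rintro a b a' b' t h h' (h1 | h1)
    · exact hx _ _ _ _ _ h h' h1.1 h1.2
    · exact hx _ _ _ _ _ h' h h1.1 h1.2
  have hy2 : ∀ a b a' b' t, (a, b) ∈ O.set → (a', b') ∈ O.set →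
      b ≤ t ∧ t ≤ b' ∨ b' ≤ t ∧ t ≤ b → ∃ r, (r, t) ∈ O.set := by
    rintro a b a' b' t h h' (h1 | h1)
    · exact hy _ _ _ _ _ h h' h1.1 h1.2
    · exact hy _ _ _ _ _ h' h h1.1 h1.2
  refine ⟨hx, hy, ?_⟩
  intro σ τ z w hσ hτ hv hh a b a' b' h h' ha hb
  by_contra hn
  have hz : (z, w) ∉ O.set := hv w (by simp)
  have key : ∃ c d, ((z, c) ∈ O.set ∧ (d, w) ∈ O.set) ∧ ¬ 0 ≤ τ * (c - w) ∧
      ¬ 0 ≤ σ * (d - z) := by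
    have fin : ∀ c d, (z, c) ∈ O.set → (d, w) ∈ O.set → _ := fun c d hc hd =>
      (⟨c, d, ⟨hc, hd⟩, fun h => hv c h hc, fun h => hh d h hd⟩ :
        ∃ c d, ((z, c) ∈ O.set ∧ (d, w) ∈ O.set) ∧ ¬ 0 ≤ τ * (c - w) ∧ ¬ 0 ≤ σ * (d - z))
    by_cases h1 : 0 < σ * (a' - z)
    · obtain ⟨d, hd⟩ := hy2 a b a' b' w h h' (by
        rcases hσ with rfl | rfl <;> rcases hτ with rfl | rfl <;> omega)
      have hd' : ¬ 0 ≤ σ * (d - z) := fun h => hh d h hd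
      obtain ⟨c, hc⟩ := hx2 a b d w z h hd (by
        rcases hσ with rfl | rfl <;> rcases hτ with rfl | rfl <;> omega)
      exact fin c d hc hd
    · obtain ⟨c, hc⟩ := hx2 a b a' b' z h h' (by
        rcases hσ with rfl | rfl <;> rcases hτ with rfl | rfl <;> omega)
      have hc' : ¬ 0 ≤ τ * (c - w) := fun h => hv c h hc
      obtain ⟨d, hd⟩ := hy2 a b z c w h hc (by
        rcases hσ with rfl | rfl <;> rcases hτ with rfl | rfl <;> omega)
      exact fin c d hc hd
  obtain ⟨c, d, ⟨hc, hd⟩, h1, h2⟩ := key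
  apply hz
  simp only [LatOct.mem_set] at *
  rcases hσ with rfl | rfl <;> rcases hτ with rfl | rfl <;> omega

/-- Membership of one of the four neighbours. -/
def Adj (S : Set Pt) (x y : ℤ) : Prop :=
  (x + 1, y) ∈ S ∨ (x - 1, y) ∈ S ∨ (x, y + 1) ∈ S ∨ (x, y - 1) ∈ S

theorem Conn.insert_adj {A : Set Pt} (hA : Conn A) {x y : ℤ} (h : Adj A x y) :
    Conn (insert (x, y) A) := by
  obtain ⟨u, v, huv, hn⟩ : ∃ u v, (u, v) ∈ A ∧ ((u = x + 1 ∨ u = x - 1) ∧ v = y ∨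
      u = x ∧ (v = y + 1 ∨ v = y - 1)) := by
    rcases h with h | h | h | h <;> exact ⟨_, _, h, by omega⟩
  refine ⟨?_, ?_, ?_⟩
  · intro a b a' b' t h1 h2 h3 h4
    by_cases ht : t = x
    · exact ⟨y, by simp [ht]⟩
    · have g : ∀ a b, (a, b) ∈ insert (x, y) A → ∃ a₁ b₁, (a₁, b₁) ∈ A ∧
          (a ≤ t → a₁ ≤ t) ∧ (t ≤ a → t ≤ a₁) := by
        intro a b h
        rcases h with h | h
        · obtain ⟨rfl, rfl⟩ := Prod.mk.inj h
          exact ⟨u, v, huv, by omega, by omega⟩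
        · exact ⟨a, b, h, id, id⟩
      obtain ⟨a₁, b₁, g1, g2, -⟩ := g a b h1
      obtain ⟨a₂, b₂, g3, -, g4⟩ := g a' b' h2
      obtain ⟨r, hr⟩ := hA.x a₁ b₁ a₂ b₂ t g1 g3 (g2 h3) (g4 h4)
      exact ⟨r, Or.inr hr⟩
  · intro a b a' b' t h1 h2 h3 h4
    by_cases ht : t = y
    · exact ⟨x, by simp [ht]⟩
    · have g : ∀ a b, (a, b) ∈ insert (x, y) A → ∃ a₁ b₁, (a₁, b₁) ∈ A ∧
          (b ≤ t → b₁ ≤ t) ∧ (t ≤ b → t ≤ b₁) := by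
        intro a b h
        rcases h with h | h
        · obtain ⟨rfl, rfl⟩ := Prod.mk.inj h
          exact ⟨u, v, huv, by omega, by omega⟩
        · exact ⟨a, b, h, id, id⟩
      obtain ⟨a₁, b₁, g1, g2, -⟩ := g a b h1
      obtain ⟨a₂, b₂, g3, -, g4⟩ := g a' b' h2
      obtain ⟨r, hr⟩ := hA.y a₁ b₁ a₂ b₂ t g1 g3 (g2 h3) (g4 h4)
      exact ⟨r, Or.inr hr⟩
  · intro σ τ z w hσ hτ hv hh
    have hxv : ¬ (x = z ∧ 0 ≤ τ * (y - w)) := fun h => hv y h.2 (by simp [h.1])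
    have hxh : ¬ (y = w ∧ 0 ≤ σ * (x - z)) := fun h => hh x h.2 (by simp [h.1])
    have huv1 : ¬ (u = z ∧ 0 ≤ τ * (v - w)) := fun h => hv v h.2 (Or.inr (h.1 ▸ huv))
    have huv2 : ¬ (v = w ∧ 0 ≤ σ * (u - z)) := fun h => hh u h.2 (Or.inr (h.1 ▸ huv))
    have hq := hA.quad σ τ z w hσ hτ (fun t ht h => hv t ht (Or.inr h))
      (fun t ht h => hh t ht (Or.inr h))
    have same : (0 < σ * (x - z) ∧ 0 < τ * (y - w)) ↔ (0 < σ * (u - z) ∧ 0 < τ * (v - w)) := by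
      rcases hσ with rfl | rfl <;> rcases hτ with rfl | rfl <;> constructor <;> intro h <;> omega
    intro a b a' b' h1 h2 ha hb
    rcases h1 with h1 | h1 <;> rcases h2 with h2 | h2
    · obtain ⟨rfl, rfl⟩ := Prod.mk.inj h1
      obtain ⟨rfl, rfl⟩ := Prod.mk.inj h2
      exact ⟨ha, hb⟩
    · obtain ⟨rfl, rfl⟩ := Prod.mk.inj h1
      have := same.1 ⟨ha, hb⟩
      exact hq u v a' b' huv h2 this.1 this.2
    · obtain ⟨rfl, rfl⟩ := Prod.mk.inj h2
      exact same.2 (hq a b u v h1 huv ha hb)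
    · exact hq a b a' b' h1 h2 ha hb

/-- The configuration with `O` surrounded by zeros. -/
noncomputable def LatOct.cfg (O : LatOct) (p : Pt) : ℤ :=
  if p ∈ O.set then 1 else if Adj O.set p.1 p.2 then 0 else -1

/-- The octagon and its exterior boundary lie in the window. -/
def LatOct.In (O : LatOct) (K : ℤ) : Prop :=
  (-K < O.xLo - 1 ∧ O.xHi + 1 < K) ∧ (-K < O.yLo - 1 ∧ O.yHi + 1 < K)

/-- The number of zeros surrounding the octagon. -/
def LatOct.N (O : LatOct) : ℤ := O.sHi - O.sLo + O.mHi - O.mLo + 4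

/-- Reflection in the diagonal. -/
def LatOct.swap (O : LatOct) : LatOct :=
  ⟨O.xLo, O.xHi, O.yLo, O.yHi, O.sLo, O.sHi, -O.mHi, -O.mLo⟩

theorem LatOct.mem_swap {O : LatOct} {x y : ℤ} : (x, y) ∈ O.swap.set ↔ (y, x) ∈ O.set := by
  simp only [LatOct.mem_set, LatOct.swap]; omega

theorem LatOct.Tight.swap {O : LatOct} (h : O.Tight) : O.swap.Tight := by
  obtain ⟨h0, ⟨a1, b1, h1, e1⟩, ⟨a2, b2, h2, e2⟩, ⟨a3, b3, h3, e3⟩, ⟨a4, b4, h4, e4⟩,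
    ⟨a5, b5, h5, e5⟩, ⟨a6, b6, h6, e6⟩, ⟨a7, b7, h7, e7⟩, ⟨a8, b8, h8, e8⟩⟩ := h
  exact ⟨fun _ _ h => h, ⟨b3, a3, mem_swap.2 h3, e3⟩, ⟨b4, a4, mem_swap.2 h4, e4⟩,
    ⟨b1, a1, mem_swap.2 h1, e1⟩, ⟨b2, a2, mem_swap.2 h2, e2⟩,
    ⟨b5, a5, mem_swap.2 h5, by simp only [LatOct.swap]; omega⟩,
    ⟨b6, a6, mem_swap.2 h6, by simp only [LatOct.swap]; omega⟩,
    ⟨b8, a8, mem_swap.2 h8, by simp only [LatOct.swap]; omega⟩,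
    ⟨b7, a7, mem_swap.2 h7, by simp only [LatOct.swap]; omega⟩⟩

theorem LatOct.cfg_swap (O : LatOct) (x y : ℤ) : O.swap.cfg (x, y) = O.cfg (y, x) := by
  have : Adj O.swap.set x y ↔ Adj O.set y x := by
    simp only [Adj, LatOct.mem_swap]; tauto
  simp only [LatOct.cfg, LatOct.mem_swap, this]

theorem LatOct.cfg_eq_one {O : LatOct} {x y : ℤ} : O.cfg (x, y) = 1 ↔ (x, y) ∈ O.set := by
  unfold LatOct.cfg; split_ifs with h1 h2 <;> simp [h1]

theorem LatOct.cfg_eq_zero {O : LatOct} {x y : ℤ} :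
    O.cfg (x, y) = 0 ↔ (x, y) ∉ O.set ∧ Adj O.set x y := by
  unfold LatOct.cfg
  by_cases h1 : (x, y) ∈ O.set
  · simp [h1]
  · by_cases h2 : Adj O.set x y <;> simp [h1, h2]

theorem LatOct.cfg_spin (O : LatOct) (p : Pt) : IsSpin (O.cfg p) := by
  unfold LatOct.cfg IsSpin; split_ifs <;> simp

theorem LatOct.cfg_direct {O : LatOct} {x y x' y' : ℤ}
    (h : (x' = x + 1 ∨ x' = x - 1) ∧ y' = y ∨ x' = x ∧ (y' = y + 1 ∨ y' = y - 1))
    (h0 : O.cfg (x, y) ≠ 0) (h1 : O.cfg (x', y') ≠ 0) : O.cfg (x, y) = O.cfg (x', y') := by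
  have key : ∀ {x y x' y' : ℤ}, ((x' = x + 1 ∨ x' = x - 1) ∧ y' = y ∨
      x' = x ∧ (y' = y + 1 ∨ y' = y - 1)) → O.cfg (x', y') ≠ 0 → O.cfg (x, y) = 1 →
      O.cfg (x', y') = 1 := by
    intro x y x' y' h h1 h2
    rw [LatOct.cfg_eq_one] at *
    by_contra h3
    refine h1 (LatOct.cfg_eq_zero.2 ⟨h3, ?_⟩)
    rcases h with ⟨rfl | rfl, rfl⟩ | ⟨rfl, rfl | rfl⟩
    · exact Or.inr (Or.inl (by simpa using h2))
    · exact Or.inl (by simpa using h2)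
    · exact Or.inr (Or.inr (Or.inr (by simpa using h2)))
    · exact Or.inr (Or.inr (Or.inl (by simpa using h2)))
  have k1 := key h h1
  have k2 := key (x := x') (y := y') (x' := x) (y' := y) (by omega) h0
  have s1 := O.cfg_spin (x, y)
  have s2 := O.cfg_spin (x', y')
  rcases s1 with s1 | s1 | s1 <;> rcases s2 with s2 | s2 | s2 <;> simp_all

theorem LatOct.gridCfg {O : LatOct} {K : ℤ} (h : O.In K) : GridCfg K O.cfg := by
  refine ⟨O.cfg_spin, ?_⟩
  rintro ⟨x, y⟩ hp
  obtain ⟨h1, h2⟩ := h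
  rcases O.cfg_spin (x, y) with h3 | h3 | h3
  · exact absurd h3 hp
  · rw [LatOct.cfg_eq_zero] at h3
    rcases h3.2 with h | h | h | h <;> simp only [LatOct.mem_set] at h <;> dsimp only <;> omega
  · rw [LatOct.cfg_eq_one] at h3
    simp only [LatOct.mem_set] at h3
    dsimp only; omega

theorem LatOct.Tight.col {O : LatOct} (h : O.Tight) {x : ℤ} (h1 : O.xLo ≤ x) (h2 : x ≤ O.xHi) :
    ∃ b t, b ≤ t ∧ (b = max (max O.yLo (O.sLo - x)) (x - O.mHi)) ∧
      (t = min (min O.yHi (O.sHi - x)) (x - O.mLo)) ∧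
      (∀ y, O.cfg (x, y) = 1 ↔ b ≤ y ∧ y ≤ t) ∧
      ∀ y, O.cfg (x, y) = 0 ↔ y = b - 1 ∨ y = t + 1 := by
  obtain ⟨a3, b3, h3, e3⟩ := h.xLo
  obtain ⟨a4, b4, h4, e4⟩ := h.xHi
  obtain ⟨r, hr⟩ := O.conn.x a3 b3 a4 b4 x h3 h4 (by omega) (by omega)
  obtain ⟨b, hb⟩ : ∃ b, b = max (max O.yLo (O.sLo - x)) (x - O.mHi) := ⟨_, rfl⟩
  obtain ⟨t, ht⟩ : ∃ t, t = min (min O.yHi (O.sHi - x)) (x - O.mLo) := ⟨_, rfl⟩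
  have hb' : ∀ y, b ≤ y ↔ (O.yLo ≤ y ∧ O.sLo - x ≤ y) ∧ x - O.mHi ≤ y := fun y => by
    rw [hb, max_le_iff, max_le_iff]
  have ht' : ∀ y, y ≤ t ↔ (y ≤ O.yHi ∧ y ≤ O.sHi - x) ∧ y ≤ x - O.mLo := fun y => by
    rw [ht, le_min_iff, le_min_iff]
  have hO : ∀ y, (x, y) ∈ O.set ↔ b ≤ y ∧ y ≤ t := fun y => by
    rw [hb', ht', LatOct.mem_set]; constructor <;> intro h <;> omega
  have hr' := (hO r).1 hr
  refine ⟨b, t, by omega, hb, ht, fun y => by rw [LatOct.cfg_eq_one, hO], fun y => ?_⟩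
  rw [LatOct.cfg_eq_zero, hO]
  constructor
  · rintro ⟨g, h⟩
    have h1 : b ≤ y + 1 ∧ y - 1 ≤ t := by
      rcases h with h | h | h | h
      · rw [hb', ht']; rw [LatOct.mem_set] at h; omega
      · rw [hb', ht']; rw [LatOct.mem_set] at h; omega
      · rw [hO] at h; omega
      · rw [hO] at h; omega
    omega
  · intro h
    refine ⟨by omega, ?_⟩
    rcases h with h | h
    · exact Or.inr (Or.inr (Or.inl ((hO _).2 (by omega))))
    · exact Or.inr (Or.inr (Or.inr ((hO _).2 (by omega))))

theorem LatOct.Tight.col_right {O : LatOct} (h : O.Tight) (y : ℤ) : O.cfg (O.xHi + 1, y) ≠ 1 ∧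
    (O.cfg (O.xHi + 1, y) = 0 ↔ O.xHi - O.mHi ≤ y ∧ y ≤ O.sHi - O.xHi) := by
  obtain ⟨a1, b1, h1, e1⟩ := h.sHi
  obtain ⟨a2, b2, h2, e2⟩ := h.mHi
  rw [Ne, LatOct.cfg_eq_one, LatOct.cfg_eq_zero]
  simp only [Adj, LatOct.mem_set] at *
  refine ⟨by omega, ?_, ?_⟩
  · rintro ⟨g, h | h | h | h⟩ <;> omega
  · intro h
    exact ⟨by omega, by omega⟩

theorem LatOct.Tight.col_left {O : LatOct} (h : O.Tight) (y : ℤ) : O.cfg (O.xLo - 1, y) ≠ 1 ∧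
    (O.cfg (O.xLo - 1, y) = 0 ↔ O.sLo - O.xLo ≤ y ∧ y ≤ O.xLo - O.mLo) := by
  obtain ⟨a1, b1, h1, e1⟩ := h.sLo
  obtain ⟨a2, b2, h2, e2⟩ := h.mLo
  rw [Ne, LatOct.cfg_eq_one, LatOct.cfg_eq_zero]
  simp only [Adj, LatOct.mem_set] at *
  refine ⟨by omega, ?_, ?_⟩
  · rintro ⟨g, h | h | h | h⟩ <;> omega
  · intro h
    exact ⟨by omega, by omega⟩

theorem LatOct.col_out (O : LatOct) {x : ℤ} (hx : x < O.xLo - 1 ∨ O.xHi + 1 < x) (y : ℤ) :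
    O.cfg (x, y) = -1 := by
  rcases O.cfg_spin (x, y) with h | h | h
  · exact h
  · rw [LatOct.cfg_eq_zero] at h
    rcases h.2 with h | h | h | h <;> simp only [LatOct.mem_set] at h <;> omega
  · rw [LatOct.cfg_eq_one] at h
    simp only [LatOct.mem_set] at h; omega

theorem lineE_le_of_bonds {κ : ℝ} (hκ : 0 ≤ κ) {K : ℤ} {f : ℤ → ℤ} {S : Finset ℤ}
    (hd : ∀ t, f t ≠ 0 → f (t + 1) ≠ 0 → f t = f (t + 1))
    (hS : ∀ t, f t = 0 ∨ f (t + 1) = 0 → t ∈ S) : lineE κ K f ≤ κ * S.card := by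
  have h1 : ∀ t, bc κ (f t) (f (t + 1)) = if f t = 0 ∨ f (t + 1) = 0 then κ else 0 := fun t => by
    unfold bc
    by_cases h : f t = 0 ∨ f (t + 1) = 0
    · simp [h]
    · rw [if_neg h, if_neg h, if_pos]
      push Not at h
      exact hd t h.1 h.2
  unfold lineE
  rw [Finset.sum_congr rfl fun t _ => h1 t, ← Finset.sum_filter, Finset.sum_const, nsmul_eq_mul,
    mul_comm]
  refine mul_le_mul_of_nonneg_left ?_ hκ
  exact_mod_cast Finset.card_le_card fun t ht => hS t (Finset.mem_filter.1 ht).2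

theorem sum_box {K a b : ℤ} (ha : -K < a - 1) (hb : b + 1 < K) (α : ℤ → ℝ) (β γ : ℝ)
    (hab : a ≤ b) :
    ∑ x ∈ Finset.Ioo (-K) K, (if a ≤ x ∧ x ≤ b then α x else if x = b + 1 then β else
      if x = a - 1 then γ else 0) = ∑ x ∈ Finset.Icc a b, α x + β + γ := by
  have h : ∀ x, (if a ≤ x ∧ x ≤ b then α x else if x = b + 1 then β else
      if x = a - 1 then γ else 0) = (if a ≤ x ∧ x ≤ b then α x else 0) +
      (if x = b + 1 then β else 0) + (if x = a - 1 then γ else 0) := fun x => by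
    split_ifs <;> first | omega | simp
  rw [Finset.sum_congr rfl fun x _ => h x, Finset.sum_add_distrib, Finset.sum_add_distrib,
    Finset.sum_ite_eq', Finset.sum_ite_eq', if_pos (by simp; omega), if_pos (by simp; omega),
    ← Finset.sum_filter]
  congr 3
  ext x; simp; omega

theorem gridE_swap (κ : ℝ) (K : ℤ) (f : Pt → ℤ) :
    gridE κ K (fun p => f (p.2, p.1)) = gridE κ K f := by
  unfold gridE; rw [add_comm]

theorem gridZ_swap (K : ℤ) (f : Pt → ℤ) : gridZ K (fun p => f (p.2, p.1)) = gridZ K f := by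
  unfold gridZ win
  rw [Finset.sum_product, Finset.sum_product_right]

theorem LatOct.Tight.le {O : LatOct} (h : O.Tight) : O.xLo ≤ O.xHi ∧ O.yLo ≤ O.yHi ∧
    O.sLo ≤ O.sHi ∧ O.mLo ≤ O.mHi := by
  obtain ⟨a3, b3, h3, e3⟩ := h.xLo
  rw [LatOct.mem_set] at h3; omega

theorem LatOct.Tight.colE_le {O : LatOct} (h : O.Tight) {κ : ℝ} (hκ : 0 ≤ κ) (K x : ℤ) :
    lineE κ K (fun y => O.cfg (x, y)) ≤ if O.xLo ≤ x ∧ x ≤ O.xHi then κ * 4 else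
      if x = O.xHi + 1 then κ * ((O.sHi - O.xHi - (O.xHi - O.mHi) + 2 : ℤ) : ℝ) else
      if x = O.xLo - 1 then κ * ((O.xLo - O.mLo - (O.sLo - O.xLo) + 2 : ℤ) : ℝ) else 0 := by
  have hd : ∀ t, O.cfg (x, t) ≠ 0 → O.cfg (x, t + 1) ≠ 0 → O.cfg (x, t) = O.cfg (x, t + 1) :=
    fun t => LatOct.cfg_direct (by omega)
  split_ifs with h1 h2 h3
  · obtain ⟨b, t, -, -, -, -, hz⟩ := h.col h1.1 h1.2
    have := lineE_le_of_bonds hκ (K := K) (f := fun y => O.cfg (x, y))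
      (S := {b - 2, b - 1, t, t + 1}) hd (fun y hy => by
        simp only [hz] at hy; simp; omega)
    refine this.trans (mul_le_mul_of_nonneg_left ?_ hκ)
    exact_mod_cast Finset.card_le_four
  · subst h2
    have := lineE_le_of_bonds hκ (K := K) (f := fun y => O.cfg (O.xHi + 1, y))
      (S := Finset.Icc (O.xHi - O.mHi - 1) (O.sHi - O.xHi)) hd (fun y hy => by
        simp only [(h.col_right _).2] at hy; simp; omega)
    refine this.trans (mul_le_mul_of_nonneg_left ?_ hκ)
    have ⟨a, b, h4, e⟩ := h.xHi
    rw [LatOct.mem_set] at h4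
    rw [Int.card_Icc]
    have : (((O.sHi - O.xHi + 1 - (O.xHi - O.mHi - 1)).toNat : ℤ) : ℝ) ≤
      ((O.sHi - O.xHi - (O.xHi - O.mHi) + 2 : ℤ) : ℝ) := by
      exact_mod_cast (by omega)
    exact_mod_cast this
  · subst h3
    have := lineE_le_of_bonds hκ (K := K) (f := fun y => O.cfg (O.xLo - 1, y))
      (S := Finset.Icc (O.sLo - O.xLo - 1) (O.xLo - O.mLo)) hd (fun y hy => by
        simp only [(h.col_left _).2] at hy; simp; omega)
    refine this.trans (mul_le_mul_of_nonneg_left ?_ hκ)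
    have ⟨a, b, h4, e⟩ := h.xLo
    rw [LatOct.mem_set] at h4
    rw [Int.card_Icc]
    have : (((O.xLo - O.mLo + 1 - (O.sLo - O.xLo - 1)).toNat : ℤ) : ℝ) ≤
      ((O.xLo - O.mLo - (O.sLo - O.xLo) + 2 : ℤ) : ℝ) := by
      exact_mod_cast (by omega)
    exact_mod_cast this
  · have := lineE_le_of_bonds hκ (K := K) (f := fun y => O.cfg (x, y))
      (S := ∅) hd (fun y hy => by
        simp only [O.col_out (x := x) (by omega)] at hy; simp at hy)
    simpa using this

theorem card_Icc_cast {a b : ℤ} (h : a ≤ b + 1) : ((Finset.Icc a b).card : ℝ) = b - a + 1 := by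
  rw [Int.card_Icc]
  have : (((b + 1 - a).toNat : ℤ) : ℝ) = ((b + 1 - a : ℤ) : ℝ) := by
    rw [Int.toNat_of_nonneg (by omega)]
  push_cast at this ⊢
  rw [this]; ring

theorem LatOct.Tight.colsE_le {O : LatOct} (h : O.Tight) {κ : ℝ} (hκ : 0 ≤ κ) {K : ℤ} (hK : O.In K) :
    ∑ x ∈ Finset.Ioo (-K) K, lineE κ K (fun y => O.cfg (x, y)) ≤
      κ * (O.N + 2 * (O.xHi - O.xLo + 1) + 2) := by
  refine (Finset.sum_le_sum fun x _ => h.colE_le hκ K x).trans ?_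
  rw [sum_box hK.1.1 hK.1.2 _ _ _ h.le.1, Finset.sum_const, nsmul_eq_mul,
    card_Icc_cast (by have := h.le.1; omega), LatOct.N]
  push_cast
  apply le_of_eq
  ring

theorem LatOct.In.swap {O : LatOct} {K : ℤ} (h : O.In K) : O.swap.In K := ⟨h.2, h.1⟩

theorem LatOct.N_swap (O : LatOct) : O.swap.N = O.N := by
  simp only [LatOct.N, LatOct.swap]; ring

/-- The energy of an octagon surrounded by zeros, in units of `κ ε`. -/
def LatOct.en (O : LatOct) : ℤ :=
  2 * O.N + 2 * ((O.xHi - O.xLo + 1) + (O.yHi - O.yLo + 1)) + 4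

theorem LatOct.Tight.gridE_le {O : LatOct} (h : O.Tight) {κ : ℝ} (hκ : 0 ≤ κ) {K : ℤ} (hK : O.In K) :
    gridE κ K O.cfg ≤ κ * O.en := by
  have h1 := h.colsE_le hκ hK
  have h2 := h.swap.colsE_le hκ hK.swap
  simp only [LatOct.cfg_swap, LatOct.N_swap] at h2
  unfold gridE
  refine (add_le_add h1 h2).trans (le_of_eq ?_)
  simp only [LatOct.en, LatOct.swap]
  push_cast
  ring

section

theorem Conn.corner {A : Set Pt} (hA : Conn A) {σ τ x y a b r : ℤ} (hσ : σ = 1 ∨ σ = -1)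
    (hτ : τ = 1 ∨ τ = -1) (hv : ∀ t, 0 ≤ τ * (t - y) → (x, t) ∉ A)
    (hh : ∀ t, 0 ≤ σ * (t - x) → (t, y) ∉ A) (hab : (a, b) ∈ A) (ha : 0 ≤ σ * (a - x))
    (hb : 0 ≤ τ * (b - y)) (hr : (x, r) ∈ A) : False := by
  have h1 : a ≠ x := fun h => hv b hb (h ▸ hab)
  have h2 : b ≠ y := fun h => hh a ha (h ▸ hab)
  have := (hA.quad σ τ x y hσ hτ hv hh a b x r hab hr (by
    rcases hσ with rfl | rfl <;> omega) (by rcases hτ with rfl | rfl <;> omega)).1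
  simp at this

theorem arc_count (g : ℤ → ℤ) {a b c d : ℤ} (hac : c ≤ a) (hbd : b ≤ d) :
    ((b - a + 1 : ℤ) : ℝ) ≤
      ((Finset.Icc a b).filter fun x => g x = 0).card + ∑ x ∈ Finset.Icc c d, nz (g x) := by
  have h1 : ∑ x ∈ Finset.Icc a b, nz (g x) ≤ ∑ x ∈ Finset.Icc c d, nz (g x) :=
    Finset.sum_le_sum_of_subset_of_nonneg (Finset.Icc_subset_Icc hac hbd)
      fun _ _ _ => nz_nonneg _
  have h2 : (((Finset.Icc a b).filter fun x => g x = 0).card : ℝ) + ∑ x ∈ Finset.Icc a b, nz (g x) =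
      (Finset.Icc a b).card := by
    rw [Finset.card_filter, Finset.card_eq_sum_ones]
    push_cast
    rw [← Finset.sum_add_distrib]
    refine Finset.sum_congr rfl fun x _ => ?_
    unfold nz; split_ifs <;> simp
  have h3 : ((b - a + 1 : ℤ) : ℝ) ≤ (Finset.Icc a b).card := by
    rw [Int.card_Icc]
    have : b - a + 1 ≤ ((b + 1 - a).toNat : ℤ) := by omega
    exact_mod_cast this
  linarith

variable {κ : ℝ} {K : ℤ} {c : Pt → ℤ}

theorem GridCfg.swap (hc : GridCfg K c) : GridCfg K (fun p => c (p.2, p.1)) :=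
  ⟨fun _ => hc.spin _, fun _ h => (hc.supp _ h).symm⟩

theorem cols_ge (h0 : 0 ≤ κ) (h2 : κ ≤ 2) (hc : GridCfg K c) {a b : ℤ} (hab : a ≤ b)
    {top bot : ℤ → ℤ}
    (htop : ∀ x, a ≤ x → x ≤ b → c (x, top x) = 1 ∧ ∀ t, top x < t → c (x, t) ≠ 1)
    (hbot : ∀ x, a ≤ x → x ≤ b → c (x, bot x) = 1 ∧ ∀ t, t < bot x → c (x, t) ≠ 1)
    (hr : ∃ y, c (b + 1, y) ≠ -1) (hl : ∃ y, c (a - 1, y) ≠ -1) :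
    κ * (gridZ K c + 2 * (b - a + 1) + 2) + (2 - κ) *
      (∑ x ∈ Finset.Icc a b, nz (c (x, bot x - 1)) + ∑ x ∈ Finset.Icc a b, nz (c (x, top x + 1)))
      ≤ ∑ x ∈ Finset.Ioo (-K) K, lineE κ K (fun y => c (x, y)) := by
  have hb := (hc.supp _ hr.choose_spec).1
  have ha := (hc.supp _ hl.choose_spec).1
  dsimp only at ha hb
  have key : ∀ x, κ * lineZ K (fun y => c (x, y)) + (if a ≤ x ∧ x ≤ b then κ * 2 + (2 - κ) *
      (nz (c (x, bot x - 1)) + nz (c (x, top x + 1))) else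
      if x = b + 1 then κ else if x = a - 1 then κ else 0) ≤ lineE κ K (fun y => c (x, y)) := by
    intro x
    split_ifs with h1 h2 h3
    · have ht := htop x h1.1 h1.2
      have hb := hbot x h1.1 h1.2
      have := lineE_ge_of_ends h0 (hc.col x) hb.1 hb.2 ht.1 ht.2
      linarith
    · subst h2
      have := lineE_ge_of_nonempty h0 ‹κ ≤ 2› (hc.col (b + 1)) hr
      linarith
    · subst h3
      have := lineE_ge_of_nonempty h0 ‹κ ≤ 2› (hc.col (a - 1)) hl
      linarith
    · have := lineE_ge_zeros (K := K) (f := fun y => c (x, y)) h0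
      linarith
  refine le_trans (le_of_eq ?_) (Finset.sum_le_sum fun x _ => key x)
  rw [Finset.sum_add_distrib, sum_box ha.1 hb.2 _ _ _ hab, ← Finset.mul_sum, ← hc.gridZ_col,
    Finset.sum_add_distrib, Finset.sum_const, nsmul_eq_mul, card_Icc_cast (by omega),
    ← Finset.mul_sum, Finset.sum_add_distrib]
  ring

theorem gridZ_eq_card (K : ℤ) (c : Pt → ℤ) :
    gridZ K c = (((win K).filter fun p => c p = 0).card : ℝ) := by
  unfold gridZ zi
  rw [← Finset.sum_filter, Finset.sum_const, nsmul_eq_mul, mul_one]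

/-- The outermost ends of the columns of a box are zeros. -/
def ColEnds (c : Pt → ℤ) (a b : ℤ) : Prop :=
  ∀ x, a ≤ x → x ≤ b → (∀ q, c (x, q) = 1 → (∀ t, q < t → c (x, t) ≠ 1) → c (x, q + 1) = 0) ∧
    ∀ q, c (x, q) = 1 → (∀ t, t < q → c (x, t) ≠ 1) → c (x, q - 1) = 0

theorem colEnds_of_sum {a b : ℤ} {top bot : ℤ → ℤ}
    (htop : ∀ x, a ≤ x → x ≤ b → c (x, top x) = 1 ∧ ∀ t, top x < t → c (x, t) ≠ 1)
    (hbot : ∀ x, a ≤ x → x ≤ b → c (x, bot x) = 1 ∧ ∀ t, t < bot x → c (x, t) ≠ 1)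
    (h1 : ∑ x ∈ Finset.Icc a b, nz (c (x, bot x - 1)) = 0)
    (h2 : ∑ x ∈ Finset.Icc a b, nz (c (x, top x + 1)) = 0) : ColEnds c a b := by
  rw [Finset.sum_eq_zero_iff_of_nonneg fun _ _ => nz_nonneg _] at h1 h2
  have hz : ∀ a, nz a = 0 → a = 0 := fun a h => by
    by_contra h'
    rw [nz_of_ne h'] at h
    exact one_ne_zero h
  intro x ha hb
  have hx : x ∈ Finset.Icc a b := Finset.mem_Icc.2 ⟨ha, hb⟩
  obtain ⟨t1, t2⟩ := htop x ha hb
  obtain ⟨b1, b2⟩ := hbot x ha hb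
  constructor
  · intro q hq hq'
    have : q = top x := by
      rcases lt_trichotomy q (top x) with h | h | h
      · exact absurd t1 (hq' _ h)
      · exact h
      · exact absurd hq (t2 _ h)
    rw [this]; exact hz _ (h2 x hx)
  · intro q hq hq'
    have : q = bot x := by
      rcases lt_trichotomy q (bot x) with h | h | h
      · exact absurd hq (b2 _ h)
      · exact h
      · exact absurd b1 (hq' _ h)
    rw [this]; exact hz _ (h1 x hx)

/-- Outermost positions. -/
theorem exists_outermost (hc : GridCfg K c) {a b : ℤ}
    (h : ∀ x, a ≤ x → x ≤ b → ∃ y, c (x, y) = 1) : ∃ top bot : ℤ → ℤ,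
    (∀ x, a ≤ x → x ≤ b → c (x, top x) = 1 ∧ ∀ t, top x < t → c (x, t) ≠ 1) ∧
    ∀ x, a ≤ x → x ≤ b → c (x, bot x) = 1 ∧ ∀ t, t < bot x → c (x, t) ≠ 1 := by
  have h1 : ∀ x, ∃ q, a ≤ x → x ≤ b → c (x, q) = 1 ∧ ∀ t, q < t → c (x, t) ≠ 1 := fun x => by
    by_cases hx : a ≤ x ∧ x ≤ b
    · obtain ⟨q, hq⟩ := (hc.col x).exists_max (h x hx.1 hx.2)
      exact ⟨q, fun _ _ => hq⟩
    · exact ⟨0, fun h1 h2 => absurd ⟨h1, h2⟩ hx⟩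
  have h2 : ∀ x, ∃ q, a ≤ x → x ≤ b → c (x, q) = 1 ∧ ∀ t, t < q → c (x, t) ≠ 1 := fun x => by
    by_cases hx : a ≤ x ∧ x ≤ b
    · obtain ⟨q, hq⟩ := (hc.col x).exists_min (h x hx.1 hx.2)
      exact ⟨q, fun _ _ => hq⟩
    · exact ⟨0, fun h1 h2 => absurd ⟨h1, h2⟩ hx⟩
  choose top htop using h1
  choose bot hbot using h2
  exact ⟨top, bot, htop, hbot⟩

theorem disjoint_image {S T : Finset ℤ} {f g : ℤ → Pt} (h : ∀ s ∈ S, ∀ t ∈ T, f s ≠ g t) :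
    Disjoint (S.image f) (T.image g) := by
  rw [Finset.disjoint_left]
  intro p hp hq
  obtain ⟨s, hs, rfl⟩ := Finset.mem_image.1 hp
  obtain ⟨t, ht, h'⟩ := Finset.mem_image.1 hq
  exact h s hs t ht h'.symm

/-- The sharp lower bound for configurations whose `1`-phase contains a connected set with octagonal
hull `O`: at least `N(O)` of the ends of the lines through the box of `O` are zeros or direct
interfaces. -/
theorem lower_bound (h0 : 0 ≤ κ) (h2 : κ ≤ 2) (hc : GridCfg K c) {A : Set Pt}
    (hA : ∀ x y, (x, y) ∈ A → c (x, y) = 1) (hconn : Conn A) {O : LatOct} (hO : IsHull A O)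
    (hr : ∃ y, c (O.xHi + 1, y) ≠ -1) (hl : ∃ y, c (O.xLo - 1, y) ≠ -1)
    (ht : ∃ x, c (x, O.yHi + 1) ≠ -1) (hb : ∃ x, c (x, O.yLo - 1) ≠ -1) :
    ∃ d : ℝ, 0 ≤ d ∧
      κ * (O.en + 2 * (gridZ K c - O.N)) + (2 - κ) * d ≤ gridE κ K c ∧
      O.N ≤ gridZ K c + d ∧ (d = 0 → ColEnds c O.xLo O.xHi ∧
        ColEnds (fun p => c (p.2, p.1)) O.yLo O.yHi) := by
  obtain ⟨hO0, ⟨b1, b2, hB, hB'⟩, ⟨t1, t2, hT, hT'⟩, ⟨l1, l2, hL, hL'⟩, ⟨r1, r2, hR, hR'⟩,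
    ⟨ll1, ll2, hLL, hLL'⟩, ⟨ur1, ur2, hUR, hUR'⟩, ⟨ul1, ul2, hUL, hUL'⟩,
    ⟨lr1, lr2, hLR, hLR'⟩⟩ := hO
  have mLL := LatOct.mem_set.1 (hO0 _ _ hLL)
  have mUR := LatOct.mem_set.1 (hO0 _ _ hUR)
  have mUL := LatOct.mem_set.1 (hO0 _ _ hUL)
  have mLR := LatOct.mem_set.1 (hO0 _ _ hLR)
  obtain ⟨top, bot, htop, hbot⟩ := exists_outermost hc (a := O.xLo) (b := O.xHi) fun x h1 h2 => by
    obtain ⟨r, h⟩ := hconn.x l1 l2 r1 r2 x hL hR (by omega) (by omega)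
    exact ⟨r, hA _ _ h⟩
  obtain ⟨rt, lt, hrt, hlt⟩ := exists_outermost hc.swap (a := O.yLo) (b := O.yHi)
    fun x h1 h2 => by
      obtain ⟨r, h⟩ := hconn.y b1 b2 t1 t2 x hB hT (by omega) (by omega)
      exact ⟨r, hA _ _ h⟩
  have E1 := cols_ge h0 h2 hc (by omega) htop hbot hr hl
  have E2 := cols_ge h0 h2 hc.swap (by omega) hrt hlt ht hb
  dsimp only at hrt hlt E2
  rw [gridZ_swap] at E2
  set S1 := ∑ x ∈ Finset.Icc O.xLo O.xHi, nz (c (x, bot x - 1)) with hS1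
  set S2 := ∑ x ∈ Finset.Icc O.xLo O.xHi, nz (c (x, top x + 1)) with hS2
  set S3 := ∑ x ∈ Finset.Icc O.yLo O.yHi, nz (c (lt x - 1, x)) with hS3
  set S4 := ∑ x ∈ Finset.Icc O.yLo O.yHi, nz (c (rt x + 1, x)) with hS4
  have p1 : 0 ≤ S1 := Finset.sum_nonneg fun _ _ => nz_nonneg _
  have p2 : 0 ≤ S2 := Finset.sum_nonneg fun _ _ => nz_nonneg _
  have p3 : 0 ≤ S3 := Finset.sum_nonneg fun _ _ => nz_nonneg _
  have p4 : 0 ≤ S4 := Finset.sum_nonneg fun _ _ => nz_nonneg _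
  refine ⟨(S1 + S2) + (S3 + S4), by positivity, ?_, ?_, ?_⟩
  · unfold gridE
    refine le_trans (le_of_eq ?_) (add_le_add E1 E2)
    simp only [LatOct.en]
    push_cast
    ring
  · have c1 := arc_count (fun x => c (x, bot x - 1)) (a := ll1) (b := lr1) mLL.2.1.1 mLR.2.1.2
    have c2 := arc_count (fun x => c (x, top x + 1)) (a := ul1) (b := ur1) mUL.2.1.1 mUR.2.1.2
    have c3 := arc_count (fun x => c (lt x - 1, x)) (a := ll2) (b := ul2) mLL.1.1 mUL.1.2
    have c4 := arc_count (fun x => c (rt x + 1, x)) (a := lr2) (b := ur2) mLR.1.1 mUR.1.2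
    set F1 := (Finset.Icc ll1 lr1).filter fun x => c (x, bot x - 1) = 0 with hF1
    set F2 := (Finset.Icc ul1 ur1).filter fun x => c (x, top x + 1) = 0 with hF2
    set F3 := (Finset.Icc ll2 ul2).filter fun x => c (lt x - 1, x) = 0 with hF3
    set F4 := (Finset.Icc lr2 ur2).filter fun x => c (rt x + 1, x) = 0 with hF4
    set T1 := F1.image fun x => (x, bot x - 1) with hT1
    set T2 := F2.image fun x => (x, top x + 1) with hT2
    set T3 := F3.image fun x => (lt x - 1, x) with hT3
    set T4 := F4.image fun x => (rt x + 1, x) with hT4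
    have q1 : T1.card = F1.card :=
      Finset.card_image_of_injective _ fun a b h => (Prod.mk.inj h).1
    have q2 : T2.card = F2.card :=
      Finset.card_image_of_injective _ fun a b h => (Prod.mk.inj h).1
    have q3 : T3.card = F3.card :=
      Finset.card_image_of_injective _ fun a b h => (Prod.mk.inj h).2
    have q4 : T4.card = F4.card :=
      Finset.card_image_of_injective _ fun a b h => (Prod.mk.inj h).2
    have ne : ∀ x y, c (x, y) ≠ 1 → (x, y) ∉ A := fun x y h h' => h (hA x y h')
    have m1 : ∀ x ∈ F1, (∀ t, 0 ≤ -1 * (t - (bot x - 1)) → (x, t) ∉ A) ∧ (ll1 ≤ x ∧ x ≤ lr1) ∧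
        c (x, bot x) = 1 ∧ (∀ t, t < bot x → c (x, t) ≠ 1) ∧ ∃ r, (x, r) ∈ A := fun x hx => by
      simp only [hF1, Finset.mem_filter, Finset.mem_Icc] at hx
      have h := hbot x (by omega) (by omega)
      exact ⟨fun t ht => ne _ _ (h.2 t (by omega)), hx.1, h.1, h.2,
        hconn.x ll1 ll2 lr1 lr2 x hLL hLR hx.1.1 hx.1.2⟩
    have m2 : ∀ x ∈ F2, (∀ t, 0 ≤ 1 * (t - (top x + 1)) → (x, t) ∉ A) ∧ (ul1 ≤ x ∧ x ≤ ur1) ∧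
        c (x, top x) = 1 ∧ (∀ t, top x < t → c (x, t) ≠ 1) ∧ ∃ r, (x, r) ∈ A := fun x hx => by
      simp only [hF2, Finset.mem_filter, Finset.mem_Icc] at hx
      have h := htop x (by omega) (by omega)
      exact ⟨fun t ht => ne _ _ (h.2 t (by omega)), hx.1, h.1, h.2,
        hconn.x ul1 ul2 ur1 ur2 x hUL hUR hx.1.1 hx.1.2⟩
    have m3 : ∀ x ∈ F3, (∀ t, 0 ≤ -1 * (t - (lt x - 1)) → (t, x) ∉ A) ∧ (ll2 ≤ x ∧ x ≤ ul2) ∧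
        c (lt x, x) = 1 ∧ ∀ t, t < lt x → c (t, x) ≠ 1 := fun x hx => by
      simp only [hF3, Finset.mem_filter, Finset.mem_Icc] at hx
      have h := hlt x (by omega) (by omega)
      exact ⟨fun t ht => ne _ _ (h.2 t (by omega)), hx.1, h.1, h.2⟩
    have m4 : ∀ x ∈ F4, (∀ t, 0 ≤ 1 * (t - (rt x + 1)) → (t, x) ∉ A) ∧ (lr2 ≤ x ∧ x ≤ ur2) ∧
        c (rt x, x) = 1 ∧ ∀ t, rt x < t → c (t, x) ≠ 1 := fun x hx => by
      simp only [hF4, Finset.mem_filter, Finset.mem_Icc] at hx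
      have h := hrt x (by omega) (by omega)
      exact ⟨fun t ht => ne _ _ (h.2 t (by omega)), hx.1, h.1, h.2⟩
    have d12 : Disjoint T1 T2 := disjoint_image fun s hs t ht h => by
      obtain ⟨rfl, e⟩ := Prod.mk.inj h
      have h3 := (m1 _ hs).2.2.2.1 (top s)
      have h4 := (m2 _ ht).2.2.1
      exact h3 (by omega) h4
    have d34 : Disjoint T3 T4 := disjoint_image fun s hs t ht h => by
      obtain ⟨e, rfl⟩ := Prod.mk.inj h
      have h3 := (m3 _ hs).2.2.2 (rt s)
      have h4 := (m4 _ ht).2.2.1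
      exact h3 (by omega) h4
    have d13 : Disjoint T1 T3 := disjoint_image fun s hs t ht h => by
      obtain ⟨e1, e2⟩ := Prod.mk.inj h
      obtain ⟨g1, g2, -, -, r, hr⟩ := m1 _ hs
      obtain ⟨g3, g4, -⟩ := m3 _ ht
      rw [← e1] at g3
      subst e2
      exact hconn.corner (Or.inr rfl) (Or.inr rfl) g1 g3 hLL (by omega) (by omega) hr
    have d14 : Disjoint T1 T4 := disjoint_image fun s hs t ht h => by
      obtain ⟨e1, e2⟩ := Prod.mk.inj h
      obtain ⟨g1, g2, -, -, r, hr⟩ := m1 _ hs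
      obtain ⟨g3, g4, -⟩ := m4 _ ht
      rw [← e1] at g3
      subst e2
      exact hconn.corner (Or.inl rfl) (Or.inr rfl) g1 g3 hLR (by omega) (by omega) hr
    have d23 : Disjoint T2 T3 := disjoint_image fun s hs t ht h => by
      obtain ⟨e1, e2⟩ := Prod.mk.inj h
      obtain ⟨g1, g2, -, -, r, hr⟩ := m2 _ hs
      obtain ⟨g3, g4, -⟩ := m3 _ ht
      rw [← e1] at g3
      subst e2
      exact hconn.corner (Or.inr rfl) (Or.inl rfl) g1 g3 hUL (by omega) (by omega) hr
    have d24 : Disjoint T2 T4 := disjoint_image fun s hs t ht h => by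
      obtain ⟨e1, e2⟩ := Prod.mk.inj h
      obtain ⟨g1, g2, -, -, r, hr⟩ := m2 _ hs
      obtain ⟨g3, g4, -⟩ := m4 _ ht
      rw [← e1] at g3
      subst e2
      exact hconn.corner (Or.inl rfl) (Or.inl rfl) g1 g3 hUR (by omega) (by omega) hr
    have sub : (T1 ∪ T2) ∪ (T3 ∪ T4) ⊆ (win K).filter fun p => c p = 0 := by
      have z : ∀ p, c p = 0 → p ∈ (win K).filter fun p => c p = 0 := fun p hp =>
        Finset.mem_filter.2 ⟨hc.mem_win (by omega), hp⟩
      refine Finset.union_subset (Finset.union_subset ?_ ?_) (Finset.union_subset ?_ ?_) <;>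
        · intro p hp
          obtain ⟨x, hx, rfl⟩ := Finset.mem_image.1 hp
          exact z _ (Finset.mem_filter.1 hx).2
    have hcard := Finset.card_le_card sub
    rw [Finset.card_union_of_disjoint, Finset.card_union_of_disjoint d12,
      Finset.card_union_of_disjoint d34, q1, q2, q3, q4] at hcard
    · have hcard' : ((F1.card : ℝ) + F2.card + (F3.card + F4.card)) ≤ gridZ K c := by
        rw [gridZ_eq_card]; exact_mod_cast hcard
      have hN : (O.N : ℝ) = ((lr1 - ll1 + 1 : ℤ) : ℝ) + ((ur1 - ul1 + 1 : ℤ) : ℝ) +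
          ((ul2 - ll2 + 1 : ℤ) : ℝ) + ((ur2 - lr2 + 1 : ℤ) : ℝ) := by
        have : O.N = (lr1 - ll1 + 1) + (ur1 - ul1 + 1) + (ul2 - ll2 + 1) + (ur2 - lr2 + 1) := by
          rw [LatOct.N]; omega
        rw [this]; push_cast; ring
      linarith
    · rw [Finset.disjoint_union_left, Finset.disjoint_union_right, Finset.disjoint_union_right]
      exact ⟨⟨d13, d14⟩, d23, d24⟩
  · intro hd
    exact ⟨colEnds_of_sum htop hbot (by linarith) (by linarith),
      colEnds_of_sum hrt hlt (by dsimp only; linarith) (by dsimp only; linarith)⟩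

end

section

/-- The smallest lattice distance to the complement of the eight half-planes defining the octagon. -/
def LatOct.F (J : LatOct) (p : Pt) : ℤ :=
  min (min (min (p.2 - J.yLo + 1) (J.yHi - p.2 + 1)) (min (p.1 - J.xLo + 1) (J.xHi - p.1 + 1)))
    (min (min (p.1 + p.2 - J.sLo + 1) (J.sHi - (p.1 + p.2) + 1))
      (min (p.1 - p.2 - J.mLo + 1) (J.mHi - (p.1 - p.2) + 1)))

/-- The octagon obtained by shrinking all eight bounds by `m - 1`. -/
def LatOct.shrink (J : LatOct) (m : ℤ) : LatOct :=
  ⟨J.yLo + m - 1, J.yHi - m + 1, J.xLo + m - 1, J.xHi - m + 1, J.sLo + m - 1, J.sHi - m + 1,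
    J.mLo + m - 1, J.mHi - m + 1⟩

theorem LatOct.le_F {J : LatOct} {t x y : ℤ} : t ≤ J.F (x, y) ↔
    (t ≤ y - J.yLo + 1 ∧ t ≤ J.yHi - y + 1) ∧ (t ≤ x - J.xLo + 1 ∧ t ≤ J.xHi - x + 1) ∧
    (t ≤ x + y - J.sLo + 1 ∧ t ≤ J.sHi - (x + y) + 1) ∧
    (t ≤ x - y - J.mLo + 1 ∧ t ≤ J.mHi - (x - y) + 1) := by
  simp only [LatOct.F, le_min_iff]; tauto

theorem LatOct.mem_shrink {J : LatOct} {m : ℤ} {p : Pt} : p ∈ (J.shrink m).set ↔ m ≤ J.F p := by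
  obtain ⟨x, y⟩ := p
  simp only [LatOct.mem_set, LatOct.shrink, LatOct.le_F]; omega

theorem LatOct.mem_iff_F {J : LatOct} {p : Pt} : p ∈ J.set ↔ 1 ≤ J.F p := by
  obtain ⟨x, y⟩ := p
  simp only [LatOct.mem_set, LatOct.le_F]; omega

theorem LatOct.F_lip (J : LatOct) {x y x' y' : ℤ}
    (h : (x' = x + 1 ∨ x' = x - 1) ∧ y' = y ∨ x' = x ∧ (y' = y + 1 ∨ y' = y - 1)) :
    J.F (x, y) ≤ J.F (x', y') + 1 := by
  have h1 := LatOct.le_F.1 (le_refl (J.F (x, y)))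
  rw [← sub_le_iff_le_add, LatOct.le_F]
  omega

theorem LatOct.F_adj (J : LatOct) (x y : ℤ) :
    (J.F (x, y) ≤ J.F (x, y + 1) + 1 ∧ J.F (x, y + 1) ≤ J.F (x, y) + 1) ∧
    J.F (x, y) ≤ J.F (x + 1, y) + 1 ∧ J.F (x + 1, y) ≤ J.F (x, y) + 1 :=
  ⟨⟨J.F_lip (by omega), J.F_lip (by omega)⟩, J.F_lip (by omega), J.F_lip (by omega)⟩

theorem LatOct.cfg_eq_one' {O : LatOct} {p : Pt} : O.cfg p = 1 ↔ p ∈ O.set := LatOct.cfg_eq_one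

/-- An octagon has a boundary zero beyond each of the four axis-parallel sides. -/
theorem LatOct.cfg_ne_neg_of_adj {O : LatOct} {x y : ℤ} (h : Adj O.set x y) : O.cfg (x, y) ≠ -1 := by
  unfold LatOct.cfg
  split_ifs <;> decide

variable {κ η δ : ℝ} {K : ℤ} {J : LatOct} {W : Pt → ℝ} {n0 : ℝ} {u : Pt → ℤ}

/-- The weight of `p` in the symmetric difference of `{u = 1}` and `S`. -/
noncomputable def dw (W : Pt → ℝ) (S : Set Pt) (u : Pt → ℤ) (p : Pt) : ℝ :=
  if (u p = 1 ↔ p ∈ S) then 0 else W p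

/-- `u` minimizes the functional, in lattice units, among configurations in the window. -/
structure MinPb (κ η δ : ℝ) (K : ℤ) (J : LatOct) (W : Pt → ℝ) (n0 : ℝ) (u : Pt → ℤ) : Prop where
  κ0 : 0 < κ
  κ1 : 3 * κ < 2
  η0 : 0 < η
  δ0 : 0 ≤ δ
  δκ : δ ≤ κ / 4
  δq : δ < 2 - 3 * κ
  δ1 : δ ≤ 1
  cfg : GridCfg K u
  tight : J.Tight
  inWin : J.In K
  W1 : ∀ p, 1 ≤ W p
  WF : ∀ p ∈ J.set, W p = J.F p
  min : ∀ v, GridCfg K v →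
    gridE κ K u + η * ∑ p ∈ win K, dw W J.set u p + δ * |gridZ K u - n0| ≤
      gridE κ K v + η * ∑ p ∈ win K, dw W J.set v p + δ * |gridZ K v - n0|

theorem MinPb.compare (h : MinPb κ η δ K J W n0 u) {v : Pt → ℤ} (hv : GridCfg K v) {e z : ℝ}
    (hE : gridE κ K v ≤ gridE κ K u + e) (hZ : |gridZ K v - gridZ K u| ≤ z) :
    η * ∑ p ∈ win K, (dw W J.set u p - dw W J.set v p) ≤ e + δ * z := by
  have h1 := h.min v hv
  have h2 : |gridZ K v - n0| ≤ z + |gridZ K u - n0| := by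
    have := abs_add_le (gridZ K v - gridZ K u) (gridZ K u - n0)
    rw [sub_add_sub_cancel] at this
    linarith
  have h3 := mul_le_mul_of_nonneg_left h2 h.δ0
  rw [Finset.sum_sub_distrib, mul_sub]
  linarith

/-- `lower_bound` in a form adapted to comparison. -/
theorem lower_bound' (h0 : 0 ≤ κ) (h2 : κ ≤ 2) {c : Pt → ℤ} (hc : GridCfg K c) {A : Set Pt}
    (hA : ∀ x y, (x, y) ∈ A → c (x, y) = 1) (hconn : Conn A) {O : LatOct} (hO : IsHull A O)
    (hr : ∃ y, c (O.xHi + 1, y) ≠ -1) (hl : ∃ y, c (O.xLo - 1, y) ≠ -1)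
    (ht : ∃ x, c (x, O.yHi + 1) ≠ -1) (hb : ∃ x, c (x, O.yLo - 1) ≠ -1) :
    ∃ d e : ℝ, 0 ≤ d ∧ 0 ≤ e ∧ κ * O.en + 2 * κ * e + (2 - 3 * κ) * d ≤ gridE κ K c ∧
      gridZ K c - O.N = e - d ∧ (d = 0 → ColEnds c O.xLo O.xHi ∧
        ColEnds (fun p => c (p.2, p.1)) O.yLo O.yHi) := by
  obtain ⟨d, hd, h1, h3, h4⟩ := lower_bound h0 h2 hc hA hconn hO hr hl ht hb
  exact ⟨d, gridZ K c - O.N + d, hd, by linarith, by linarith, by ring, h4⟩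

theorem LatOct.frame {A : Set Pt} {O : LatOct} (h : IsHull A O) {c : Pt → ℤ}
    (hc : ∀ x y, (x, y) ∉ O.set → Adj O.set x y → c (x, y) ≠ -1) :
    (∃ y, c (O.xHi + 1, y) ≠ -1) ∧ (∃ y, c (O.xLo - 1, y) ≠ -1) ∧
    (∃ x, c (x, O.yHi + 1) ≠ -1) ∧ ∃ x, c (x, O.yLo - 1) ≠ -1 := by
  obtain ⟨h0, ⟨a1, b1, h1, e1⟩, ⟨a2, b2, h2, e2⟩, ⟨a3, b3, h3, e3⟩, ⟨a4, b4, h4, e4⟩, -⟩ := h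
  have h1 := h0 _ _ h1
  have h2 := h0 _ _ h2
  have h3 := h0 _ _ h3
  have h4 := h0 _ _ h4
  refine ⟨⟨b4, hc _ _ ?_ (Or.inr (Or.inl ?_))⟩, ⟨b3, hc _ _ ?_ (Or.inl ?_)⟩,
    ⟨a2, hc _ _ ?_ (Or.inr (Or.inr (Or.inr ?_)))⟩, ⟨a1, hc _ _ ?_ (Or.inr (Or.inr (Or.inl ?_)))⟩⟩ <;>
  simp only [LatOct.mem_set] at * <;> omega

theorem LatOct.Tight.gridZ_eq {O : LatOct} (h : O.Tight) (h0 : 0 < κ) (h2 : 3 * κ < 2) (hK : O.In K) :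
    gridZ K O.cfg = O.N := by
  have hf := LatOct.frame h (c := O.cfg) fun x y _ h => LatOct.cfg_ne_neg_of_adj h
  obtain ⟨d, e, hd, he, h1, h3, -⟩ := lower_bound' h0.le (by linarith) (LatOct.gridCfg hK)
    (fun x y hxy => LatOct.cfg_eq_one.2 hxy) O.conn h hf.1 hf.2.1 hf.2.2.1 hf.2.2.2
  have h4 := h.gridE_le h0.le hK
  have h5 : 0 ≤ 2 * κ * e := by positivity
  have h6 : 0 ≤ (2 - 3 * κ) * d := mul_nonneg (by linarith) hd
  have h7 : e = 0 := by
    have : 2 * κ * e = 0 := by linarith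
    simpa [h0.ne'] using this
  have h8 : d = 0 := by
    have : (2 - 3 * κ) * d = 0 := by linarith
    exact (mul_eq_zero.1 this).resolve_left (by linarith)
  rw [h7, h8] at h3; linarith

/-- Comparison of `u ∨ w` and `u ∧ w` with `u` for an octagon configuration `w`. -/
theorem LatOct.Tight.lattice {O : LatOct} (h : O.Tight) (h0 : 0 < κ) (h2 : 3 * κ < 2) (hK : O.In K)
    (hu : GridCfg K u) : gridE κ K (fun p => max (u p) (O.cfg p)) +
      gridE κ K (fun p => min (u p) (O.cfg p)) ≤ gridE κ K u + κ * O.en ∧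
    gridZ K (fun p => max (u p) (O.cfg p)) + gridZ K (fun p => min (u p) (O.cfg p)) =
      gridZ K u + O.N := by
  have h1 := gridE_submodular h0.le (by linarith) hu (LatOct.gridCfg hK)
  have h3 := h.gridE_le h0.le hK
  rw [gridZ_max_add_min, h.gridZ_eq h0 h2 hK]
  exact ⟨by linarith, rfl⟩

theorem max_eq_one {a b : ℤ} (ha : IsSpin a) (hb : IsSpin b) : max a b = 1 ↔ a = 1 ∨ b = 1 := by
  unfold IsSpin at *; omega

theorem min_eq_one {a b : ℤ} (ha : IsSpin a) (hb : IsSpin b) : min a b = 1 ↔ a = 1 ∧ b = 1 := by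
  unfold IsSpin at *; omega

theorem LatOct.In.mem_win {O : LatOct} (h : O.In K) {p : Pt} (hp : p ∈ O.set) : p ∈ win K := by
  obtain ⟨x, y⟩ := p
  rw [BEG.mem_win]
  obtain ⟨h1, h2⟩ := h
  simp only [LatOct.mem_set] at hp
  dsimp only; omega

theorem MinPb.sub (h : MinPb κ η δ K J W n0 u) : ∀ p, u p = 1 → p ∈ J.set := by
  set v : Pt → ℤ := fun p => Min.min (u p) (J.cfg p) with hv
  set c : Pt → ℤ := fun p => Max.max (u p) (J.cfg p) with hc
  have hw := LatOct.gridCfg h.inWin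
  have hvc : GridCfg K v := h.cfg.min hw
  have hcc : GridCfg K c := h.cfg.max hw
  have hf := LatOct.frame h.tight (c := c) fun x y _ h' => by
    have h1 := LatOct.cfg_ne_neg_of_adj h'
    have h2 := (hw.spin (x, y)).neg_one_le
    have := le_max_right (u (x, y)) (J.cfg (x, y))
    simp only [hc]; omega
  obtain ⟨d, e, hd, he, h1, h3, -⟩ := lower_bound' h.κ0.le (by linarith [h.κ1]) hcc
    (fun x y hxy => (max_eq_one (h.cfg.spin _) (hw.spin _)).2 (Or.inr (LatOct.cfg_eq_one.2 hxy)))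
    J.conn h.tight hf.1 hf.2.1 hf.2.2.1 hf.2.2.2
  obtain ⟨h4, h5⟩ := h.tight.lattice h.κ0 h.κ1 h.inWin h.cfg
  have h6 : |gridZ K v - gridZ K u| ≤ d + e := by
    rw [abs_le]; constructor <;> linarith
  have h7 := h.compare hvc (e := - (2 * κ * e + (2 - 3 * κ) * d)) (by linarith) h6
  have h8 : ∀ p, dw W J.set v p ≤ dw W J.set u p := fun p => by
    have := min_eq_one (h.cfg.spin p) (hw.spin p)
    rw [LatOct.cfg_eq_one'] at this
    have hW := h.W1 p
    unfold dw
    simp only [hv, this]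
    split_ifs with h1 h2 h2 <;> first | linarith | (exfalso; tauto)
  have h9 : ∑ p ∈ win K, (dw W J.set u p - dw W J.set v p) ≤ 0 := by
    have h10 : δ * (d + e) ≤ 2 * κ * e + (2 - 3 * κ) * d := by
      have a1 := mul_le_mul_of_nonneg_right h.δq.le hd
      have a2 := mul_le_mul_of_nonneg_right (show δ ≤ 2 * κ by linarith [h.δκ, h.κ0]) he
      linarith
    have : η * ∑ p ∈ win K, (dw W J.set u p - dw W J.set v p) ≤ 0 := by linarith
    by_contra hcon
    push Not at hcon
    have := mul_pos h.η0 hcon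
    linarith
  intro p hp
  by_contra hpJ
  have hpw : p ∈ win K := h.cfg.mem_win (by omega)
  have h11 : dw W J.set u p - dw W J.set v p ≤ 0 :=
    (Finset.single_le_sum (fun q _ => sub_nonneg.2 (h8 q)) hpw).trans h9
  have := min_eq_one (h.cfg.spin p) (hw.spin p)
  rw [LatOct.cfg_eq_one'] at this
  have hW := h.W1 p
  unfold dw at h11
  rw [if_neg (by tauto), if_pos (by simp only [hv]; tauto)] at h11
  linarith

end

section

variable {κ η δ : ℝ} {K : ℤ} {J : LatOct} {W : Pt → ℝ} {n0 : ℝ} {u : Pt → ℤ}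

/-- Number of points at depth at least `s` outside the `1`-phase. -/
noncomputable def deepHoles (J : LatOct) (K : ℤ) (u : Pt → ℤ) (s : ℤ) : ℝ :=
  ∑ p ∈ win K, if s ≤ J.F p ∧ u p ≠ 1 then 1 else 0

theorem deepHoles_nonneg (s : ℤ) : 0 ≤ deepHoles J K u s :=
  Finset.sum_nonneg fun _ _ => by split_ifs <;> norm_num

theorem MinPb.deepHoles_step (h : MinPb κ η δ K J W n0 u) {s : ℤ} (hs : 1 ≤ s) :
    η * s * deepHoles J K u s ≤ 9 * (deepHoles J K u s - deepHoles J K u (s + 1)) := by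
  set v : Pt → ℤ := fun p => if s ≤ J.F p then 1 else u p with hv
  have hwin : ∀ p, s ≤ J.F p → p ∈ win K := fun p hp =>
    h.inWin.mem_win (LatOct.mem_iff_F.2 (by omega))
  have hvc : GridCfg K v := by
    refine ⟨fun p => ?_, fun p hp => ?_⟩
    · simp only [hv]; split_ifs
      · exact Or.inr (Or.inr rfl)
      · exact h.cfg.spin p
    · by_cases hF : s ≤ J.F p
      · exact BEG.mem_win.1 (hwin p hF)
      · rw [hv] at hp; simp only [hF, if_false] at hp
        exact h.cfg.supp p hp
  have κ0 := h.κ0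
  have κ1 := h.κ1
  set a : Pt → ℝ := fun p => 2 * (if J.F p = s ∧ u p ≠ 1 then 1 else 0) -
    κ * (if s + 1 ≤ J.F p ∧ u p = 0 then 1 else 0) with ha
  set a' : Pt → ℝ := fun p => 2 * (if J.F p = s ∧ u p ≠ 1 then 1 else 0) with ha'
  have ha0 : ∀ p, p ∉ win K → a p = 0 := fun p hp => by
    have : ¬ s ≤ J.F p := fun h => hp (hwin p h)
    simp only [ha]
    rw [if_neg (by omega), if_neg (by omega)]; simp
  have ha0' : ∀ p, p ∉ win K → a' p = 0 := fun p hp => by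
    have : ¬ s ≤ J.F p := fun h => hp (hwin p h)
    simp only [ha']
    rw [if_neg (by omega)]; simp
  have hbond : ∀ p p' : Pt, J.F p ≤ J.F p' + 1 → J.F p' ≤ J.F p + 1 →
      bc κ (v p) (v p') ≤ bc κ (u p) (u p') + a p + a' p' := by
    intro p p' h1 h2
    have hn := bc_nonneg κ0.le (u p) (u p')
    have hz := zi_le_bc_left κ0.le (u p) (u p')
    have ht := bc_le_two (show κ ≤ 2 by linarith) 1 (u p')
    have ht' := bc_le_two (show κ ≤ 2 by linarith) (u p) 1
    have hoo := bc_one_one κ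
    simp only [hv, ha, ha']
    by_cases c1 : s ≤ J.F p
    · by_cases c2 : s ≤ J.F p'
      · rw [if_pos c1, if_pos c2, hoo]
        unfold zi at hz
        split_ifs at hz ⊢ <;> first | linarith | (exfalso; omega)
      · have c3 : J.F p = s := by omega
        rw [if_pos c1, if_neg c2]
        by_cases hu : u p = 1
        · rw [hu] at hn ⊢
          rw [if_neg (by simp), if_neg (by omega), if_neg (by omega)]; linarith
        · rw [if_pos ⟨c3, hu⟩, if_neg (by omega), if_neg (by omega)]; linarith
    · by_cases c2 : s ≤ J.F p'
      · have c3 : J.F p' = s := by omega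
        rw [if_neg c1, if_pos c2]
        by_cases hu : u p' = 1
        · rw [hu] at hn ⊢
          rw [if_neg (by omega), if_neg (by omega), if_neg (by simp)]; linarith
        · rw [if_neg (by omega), if_neg (by omega), if_pos ⟨c3, hu⟩]; linarith
      · rw [if_neg c1, if_neg c2, if_neg (by omega), if_neg (by omega), if_neg (by omega)]
        linarith
  have hE := gridE_le_of_bonds (g := v) (f := u) ha0 ha0' ha0 ha0'
    (fun x y => hbond _ _ (J.F_adj x y).1.1 (J.F_adj x y).1.2)
    (fun x y => hbond _ _ (J.F_adj x y).2.1 (J.F_adj x y).2.2)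
  have hZ : |gridZ K v - gridZ K u| ≤ ∑ p ∈ win K, if s ≤ J.F p ∧ u p = 0 then (1 : ℝ) else 0 := by
    rw [gridZ, gridZ, ← Finset.sum_sub_distrib]
    refine (Finset.abs_sum_le_sum_abs _ _).trans (Finset.sum_le_sum fun p _ => ?_)
    simp only [hv]
    by_cases c1 : s ≤ J.F p
    · by_cases c2 : u p = 0
      · rw [if_pos c1, if_pos ⟨c1, c2⟩, c2, zi_one, zi_zero]; simp
      · rw [if_pos c1, if_neg (by tauto), zi_one, zi_of_ne c2]; simp
    · rw [if_neg c1, if_neg (by tauto)]; simp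
  have hc := h.compare hvc hE hZ
  have hkey : ∑ p ∈ win K, (η * (s * (if s ≤ J.F p ∧ u p ≠ 1 then 1 else 0))) ≤
      ∑ p ∈ win K, (9 * ((if s ≤ J.F p ∧ u p ≠ 1 then 1 else 0) -
        (if s + 1 ≤ J.F p ∧ u p ≠ 1 then 1 else 0))) := by
    have h1 : ∑ p ∈ win K, (η * (s * (if s ≤ J.F p ∧ u p ≠ 1 then 1 else 0))) ≤
        η * ∑ p ∈ win K, (dw W J.set u p - dw W J.set v p) := by
      rw [Finset.mul_sum]
      refine Finset.sum_le_sum fun p _ => mul_le_mul_of_nonneg_left ?_ h.η0.le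
      by_cases c : s ≤ J.F p
      · have hJ : p ∈ J.set := LatOct.mem_iff_F.2 (by omega)
        have hW := h.WF p hJ
        have hs' : (s : ℝ) ≤ W p := by rw [hW]; exact_mod_cast c
        have hW1 := h.W1 p
        simp only [dw, hv, hJ, c, iff_true, if_true, true_and]
        split_ifs <;> linarith
      · simp only [dw, hv, c, if_false, false_and]; simp
    refine h1.trans (hc.trans ?_)
    rw [Finset.mul_sum, ← Finset.sum_add_distrib]
    refine Finset.sum_le_sum fun p _ => ?_
    have := h.δ1
    have := h.δκ
    have := h.δ0
    simp only [ha, ha']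
    by_cases c1 : J.F p = s
    · by_cases hu : u p = 1
      · simp [c1, hu]
      · by_cases hu0 : u p = 0
        · simp only [c1, hu0]; norm_num; linarith
        · simp [c1, hu, hu0]; norm_num
    · by_cases c2 : s + 1 ≤ J.F p
      · have c3 : s ≤ J.F p := by omega
        by_cases hu0 : u p = 0
        · simp only [c1, c2, c3, hu0]; norm_num; linarith
        · simp [c1, c2, c3, hu0]
      · have c3 : ¬ s ≤ J.F p := by omega
        simp [c1, c2, c3]
  rw [← Finset.mul_sum, ← Finset.mul_sum, ← Finset.mul_sum, Finset.sum_sub_distrib] at hkey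
  unfold deepHoles
  linarith

/-- If `m` is large compared with the logarithm of the size of `J`, points at depth `2 m` belong to
the `1`-phase. -/
theorem MinPb.bulk (h : MinPb κ η δ K J W n0 u) {m : ℕ} (hm : 1 ≤ m) (hη : η * m ≤ 9)
    (hdecay : (1 - η * m / 9) ^ m * ((J.xHi - J.xLo + 1) * (J.yHi - J.yLo + 1) : ℝ) < 1) :
    ∀ p, 2 * m ≤ J.F p → u p = 1 := by
  have hstep : ∀ s : ℤ, (m : ℤ) ≤ s →
      deepHoles J K u (s + 1) ≤ (1 - η * m / 9) * deepHoles J K u s := fun s hs => by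
    have h1 := h.deepHoles_step (s := s) (by omega)
    have h2 : η * m * deepHoles J K u s ≤ η * s * deepHoles J K u s := by
      refine mul_le_mul_of_nonneg_right (mul_le_mul_of_nonneg_left ?_ h.η0.le) (deepHoles_nonneg _)
      exact_mod_cast hs
    linarith
  have hr : 0 ≤ 1 - η * m / 9 := by linarith
  have hind : ∀ j : ℕ, deepHoles J K u (m + j) ≤ (1 - η * m / 9) ^ j * deepHoles J K u m := by
    intro j
    induction j with
    | zero => simp
    | succ j ih =>
      have := hstep (m + j) (by omega)
      push_cast
      rw [← add_assoc, pow_succ']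
      refine this.trans ?_
      rw [mul_assoc]
      exact mul_le_mul_of_nonneg_left ih hr
  have hbox : deepHoles J K u m ≤ ((J.xHi - J.xLo + 1) * (J.yHi - J.yLo + 1) : ℝ) := by
    have hle := h.tight.le
    unfold deepHoles
    rw [← Finset.sum_filter, Finset.sum_const, nsmul_eq_mul, mul_one,
      ← card_Icc_cast (by omega), ← card_Icc_cast (by omega), ← Nat.cast_mul, ← Finset.card_product]
    refine Nat.cast_le.2 (Finset.card_le_card fun p hp => ?_)
    have h1 : p ∈ J.set := LatOct.mem_iff_F.2 (by have := (Finset.mem_filter.1 hp).2.1; omega)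
    obtain ⟨x, y⟩ := p
    rw [LatOct.mem_set] at h1
    simp; omega
  intro p hp
  by_contra hu
  have hpw : p ∈ win K := h.inWin.mem_win (LatOct.mem_iff_F.2 (by omega))
  have h1 : (1 : ℝ) ≤ deepHoles J K u (m + m) := by
    have := Finset.single_le_sum (f := fun p => if (m + m : ℤ) ≤ J.F p ∧ u p ≠ 1 then (1 : ℝ) else 0)
      (fun q _ => by split_ifs <;> norm_num) hpw
    rwa [if_pos ⟨by omega, hu⟩] at this
  have h2 := hind m
  have h3 := mul_le_mul_of_nonneg_left hbox (pow_nonneg hr m)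
  linarith

end

section

variable {κ η δ : ℝ} {K : ℤ} {J : LatOct} {W : Pt → ℝ} {n0 : ℝ} {u : Pt → ℤ}

/-- Replacing a shallow set `T` of the `1`-phase by zeros cannot decrease every bond energy. -/
theorem MinPb.peel (h : MinPb κ η δ K J W n0 u) {m : ℝ} (hm : η * m + δ < 2 - 3 * κ)
    {T : Set Pt} (hT : ∀ p ∈ T, u p = 1 ∧ (J.F p : ℝ) ≤ m) (hne : T.Nonempty)
    {a a' b b' : ℝ} (hab : a + a' + b + b' = -(2 - 3 * κ))
    (hv : ∀ x y, bc κ (if (x, y) ∈ T then 0 else u (x, y))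
        (if (x, y + 1) ∈ T then 0 else u (x, y + 1)) ≤ bc κ (u (x, y)) (u (x, y + 1)) +
        (if (x, y) ∈ T then a else 0) + (if (x, y + 1) ∈ T then a' else 0))
    (hh : ∀ x y, bc κ (if (x, y) ∈ T then 0 else u (x, y))
        (if (x + 1, y) ∈ T then 0 else u (x + 1, y)) ≤ bc κ (u (x, y)) (u (x + 1, y)) +
        (if (x, y) ∈ T then b else 0) + (if (x + 1, y) ∈ T then b' else 0)) : False := by
  set v : Pt → ℤ := fun p => if p ∈ T then 0 else u p with hvd
  have hTw : ∀ p ∈ T, p ∈ win K := fun p hp => h.cfg.mem_win (by rw [(hT p hp).1]; decide)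
  have hvc : GridCfg K v := by
    refine ⟨fun p => ?_, fun p hp => ?_⟩
    · simp only [hvd]; split_ifs
      · exact Or.inr (Or.inl rfl)
      · exact h.cfg.spin p
    · by_cases hF : p ∈ T
      · exact BEG.mem_win.1 (hTw p hF)
      · rw [hvd] at hp; simp only [hF, if_false] at hp
        exact h.cfg.supp p hp
  have hout : ∀ (r : ℝ) (p : Pt), p ∉ win K → (if p ∈ T then r else 0) = 0 := fun r p hp =>
    if_neg fun h => hp (hTw p h)
  have hE := gridE_le_of_bonds (g := v) (f := u) (hout a) (hout a') (hout b) (hout b') hv hh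
  have hZ : |gridZ K v - gridZ K u| ≤ ∑ p ∈ win K, if p ∈ T then (1 : ℝ) else 0 := by
    rw [gridZ, gridZ, ← Finset.sum_sub_distrib]
    refine (Finset.abs_sum_le_sum_abs _ _).trans (Finset.sum_le_sum fun p _ => ?_)
    simp only [hvd]
    by_cases c : p ∈ T
    · rw [if_pos c, if_pos c, (hT p c).1, zi_zero, zi_one]; simp
    · rw [if_neg c, if_neg c]; simp
  have hc := h.compare hvc hE hZ
  rw [Finset.mul_sum, Finset.mul_sum, ← Finset.sum_add_distrib] at hc
  have hlt : ∑ p ∈ win K, ((if p ∈ T then a else 0) + (if p ∈ T then a' else 0) +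
      (if p ∈ T then b else 0) + (if p ∈ T then b' else 0) + δ * (if p ∈ T then (1 : ℝ) else 0)) <
      ∑ p ∈ win K, η * (dw W J.set u p - dw W J.set v p) := by
    have hW : ∀ p ∈ T, dw W J.set u p - dw W J.set v p ≥ -m := fun p hp => by
      have hJ := h.sub p (hT p hp).1
      have := h.WF p hJ
      have := (hT p hp).2
      simp only [dw, hvd, hp, if_true, (hT p hp).1, hJ]
      norm_num; linarith
    refine Finset.sum_lt_sum (fun p _ => ?_) ?_
    · by_cases c : p ∈ T
      · have := mul_le_mul_of_nonneg_left (hW p c) h.η0.le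
        simp only [c, if_true]; linarith
      · simp [dw, hvd, c]
    · obtain ⟨p, hp⟩ := hne
      refine ⟨p, hTw p hp, ?_⟩
      have := mul_le_mul_of_nonneg_left (hW p hp) h.η0.le
      simp only [hp, if_true]; linarith
  linarith

/-- A maximal connected part of the `1`-phase. -/
structure Core (u : Pt → ℤ) (A : Set Pt) (O : LatOct) : Prop where
  conn : Conn A
  sub : ∀ p ∈ A, u p = 1
  hull : IsHull A O
  maximal : ∀ x y, Adj A x y → u (x, y) = 1 → (x, y) ∈ A

theorem MinPb.exists_core (h : MinPb κ η δ K J W n0 u) {B : Set Pt} (hB : Conn B) (hne : B.Nonempty)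
    (hBu : ∀ p ∈ B, u p = 1) : ∃ A O, B ⊆ A ∧ Core u A O := by
  have hfin : {p | u p = 1}.Finite := (win K).finite_toSet.subset fun p (hp : u p = 1) =>
    h.cfg.mem_win (by rw [hp]; decide)
  have hfin2 : {A : Set Pt | A ⊆ {p | u p = 1} ∧ B ⊆ A ∧ Conn A}.Finite :=
    hfin.finite_subsets.subset fun A hA => hA.1
  obtain ⟨A, ⟨hA1, hA2, hA3⟩, hmax⟩ := hfin2.exists_maximal ⟨B, hBu, subset_rfl, hB⟩
  obtain ⟨O, hO⟩ := exists_isHull (hfin.subset hA1) (hne.mono hA2)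
  refine ⟨A, O, hA2, hA3, hA1, hO, fun x y hxy hu => ?_⟩
  exact hmax ⟨Set.insert_subset hu hA1, hA2.trans (Set.subset_insert _ _), hA3.insert_adj hxy⟩
    (Set.subset_insert _ _) (Set.mem_insert _ _)

theorem Core.ne_one {A : Set Pt} {O : LatOct} (hA : Core u A O) {x y : ℤ} (h : Adj A x y)
    (hn : (x, y) ∉ O.set) : u (x, y) ≠ 1 := fun h1 => hn (hA.hull.sub _ _ (hA.maximal x y h h1))

/-- Beyond each extreme slice of the core there is a zero. -/
theorem MinPb.core_ends (h : MinPb κ η δ K J W n0 u) {m : ℤ} (hm : η * m + δ < 2 - 3 * κ)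
    {A : Set Pt} {O : LatOct} (hA : Core u A O) (hB : ∀ x y, m ≤ J.F (x, y) → (x, y) ∈ A) :
    ((∃ y, (O.xHi, y) ∈ A ∧ u (O.xHi + 1, y) = 0) ∧ ∃ y, (O.xLo, y) ∈ A ∧ u (O.xLo - 1, y) = 0) ∧
    (∃ x, (x, O.yHi) ∈ A ∧ u (x, O.yHi + 1) = 0) ∧ ∃ x, (x, O.yLo) ∈ A ∧ u (x, O.yLo - 1) = 0 := by
  have key : ∀ x y x' y', ((x' = x + 1 ∨ x' = x - 1) ∧ y' = y ∨
      x' = x ∧ (y' = y + 1 ∨ y' = y - 1)) → (x', y') ∉ O.set → (J.F (x, y) : ℝ) ≤ m := by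
    intro x y x' y' h1 h2
    have h3 : ¬ m ≤ J.F (x', y') := fun h => h2 (hA.hull.sub _ _ (hB _ _ h))
    have := J.F_lip h1
    exact_mod_cast (by omega : J.F (x, y) ≤ m)
  have hneg : ∀ x y, u (x, y) ≠ 0 → u (x, y) ≠ 1 → u (x, y) = -1 := fun x y h1 h2 => by
    have := h.cfg.spin (x, y)
    unfold IsSpin at this; omega
  have h00 := bc_zero_left κ
  have h01 := bc_zero_right κ
  have hn := bc_nonneg h.κ0.le
  have hon := bc_one_neg κ
  have hno := bc_neg_one κ
  have hcases : ∀ p, u p = 1 ∨ u p = 0 ∨ u p = -1 := fun p => by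
    have := h.cfg.spin p
    unfold IsSpin at this; tauto
  have κ0 := h.κ0
  have κ1 := h.κ1
  obtain ⟨⟨x1, y1, e1, f1⟩, ⟨x2, y2, e2, f2⟩, ⟨x3, y3, e3, f3⟩, ⟨x4, y4, e4, f4⟩⟩ :=
    And.intro hA.hull.yLo (And.intro hA.hull.yHi (And.intro hA.hull.xLo hA.hull.xHi))
  refine ⟨⟨?_, ?_⟩, ?_, ?_⟩
  · by_contra! hcon
    have hbd : ∀ y, (O.xHi, y) ∈ A → u (O.xHi + 1, y) = -1 := fun y hx =>
      hneg _ _ (hcon y hx) (hA.ne_one (Or.inr (Or.inl (by simpa using hx)))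
        (by simp [LatOct.mem_set]))
    refine h.peel hm (T := {p | p ∈ A ∧ p.1 = O.xHi}) (a := κ) (a' := 0) (b := -(2 - κ)) (b' := κ)
      ?_ ⟨_, e4, f4⟩ (by ring) ?_ ?_
    · rintro ⟨x, y⟩ ⟨hp, hy⟩
      dsimp only at hy
      exact ⟨hA.sub _ hp, key x y (x + 1) y (by omega) (by rw [LatOct.mem_set]; omega)⟩
    · intro x y
      simp only [Set.mem_ofPred_eq]
      by_cases c1 : (x, y) ∈ A ∧ x = O.xHi
      · have := hn (u (x, y)) (u (x, y + 1))
        rw [if_pos c1, if_pos c1, h00]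
        split_ifs <;> linarith
      · rw [if_neg c1, if_neg c1]
        split_ifs with c2
        · rw [h01, hA.sub _ c2.1]
          rcases hcases (x, y) with g | g | g
          · exact absurd ⟨hA.maximal _ _ (Or.inr (Or.inr (Or.inl c2.1))) g, c2.2⟩ c1
          · rw [g, h00]; linarith
          · rw [g, hno]; linarith
        · linarith
    · intro x y
      simp only [Set.mem_ofPred_eq]
      by_cases c1 : (x, y) ∈ A ∧ x = O.xHi
      · have := hbd y (c1.2 ▸ c1.1)
        rw [if_pos c1, if_pos c1, if_neg (by omega), if_neg (by omega), h00, hA.sub _ c1.1,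
          c1.2, this, hon]; linarith
      · rw [if_neg c1, if_neg c1]
        have := hn (u (x, y)) (u (x + 1, y))
        split_ifs with c2
        · rw [h01]; linarith
        · linarith
  · by_contra! hcon
    have hbd : ∀ y, (O.xLo, y) ∈ A → u (O.xLo - 1, y) = -1 := fun y hx =>
      hneg _ _ (hcon y hx) (hA.ne_one (Or.inl (by simpa using hx))
        (by simp [LatOct.mem_set]))
    refine h.peel hm (T := {p | p ∈ A ∧ p.1 = O.xLo}) (a := κ) (a' := 0) (b := κ) (b' := -(2 - κ))
      ?_ ⟨_, e3, f3⟩ (by ring) ?_ ?_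
    · rintro ⟨x, y⟩ ⟨hp, hy⟩
      dsimp only at hy
      exact ⟨hA.sub _ hp, key x y (x - 1) y (by omega) (by rw [LatOct.mem_set]; omega)⟩
    · intro x y
      simp only [Set.mem_ofPred_eq]
      by_cases c1 : (x, y) ∈ A ∧ x = O.xLo
      · have := hn (u (x, y)) (u (x, y + 1))
        rw [if_pos c1, if_pos c1, h00]
        split_ifs <;> linarith
      · rw [if_neg c1, if_neg c1]
        split_ifs with c2
        · rw [h01, hA.sub _ c2.1]
          rcases hcases (x, y) with g | g | g
          · exact absurd ⟨hA.maximal _ _ (Or.inr (Or.inr (Or.inl c2.1))) g, c2.2⟩ c1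
          · rw [g, h00]; linarith
          · rw [g, hno]; linarith
        · linarith
    · intro x y
      simp only [Set.mem_ofPred_eq]
      by_cases c2 : (x + 1, y) ∈ A ∧ x + 1 = O.xLo
      · have := hbd y (by rw [← c2.2]; exact c2.1)
        rw [if_pos c2, if_pos c2, if_neg (by omega), if_neg (by omega), h01, hA.sub _ c2.1,
          show x = O.xLo - 1 by omega, this, hno]; linarith
      · rw [if_neg c2, if_neg c2]
        have := hn (u (x, y)) (u (x + 1, y))
        split_ifs with c1
        · rw [h00]; linarith
        · linarith
  · by_contra! hcon
    have hbd : ∀ x, (x, O.yHi) ∈ A → u (x, O.yHi + 1) = -1 := fun x hx =>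
      hneg _ _ (hcon x hx) (hA.ne_one (Or.inr (Or.inr (Or.inr (by simpa using hx))))
        (by simp [LatOct.mem_set]))
    refine h.peel hm (T := {p | p ∈ A ∧ p.2 = O.yHi}) (a := -(2 - κ)) (a' := κ) (b := κ) (b' := 0)
      ?_ ⟨_, e2, f2⟩ (by ring) ?_ ?_
    · rintro ⟨x, y⟩ ⟨hp, hy⟩
      dsimp only at hy
      exact ⟨hA.sub _ hp, key x y x (y + 1) (by omega) (by rw [LatOct.mem_set]; omega)⟩
    · intro x y
      simp only [Set.mem_ofPred_eq]
      by_cases c1 : (x, y) ∈ A ∧ y = O.yHi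
      · have := hbd x (c1.2 ▸ c1.1)
        rw [if_pos c1, if_pos c1, if_neg (by omega), if_neg (by omega), h00, hA.sub _ c1.1,
          c1.2, this, hon]; linarith
      · rw [if_neg c1, if_neg c1]
        have := hn (u (x, y)) (u (x, y + 1))
        split_ifs with c2
        · rw [h01]; linarith
        · linarith
    · intro x y
      simp only [Set.mem_ofPred_eq]
      by_cases c1 : (x, y) ∈ A ∧ y = O.yHi
      · have := hn (u (x, y)) (u (x + 1, y))
        rw [if_pos c1, if_pos c1, h00]
        split_ifs <;> linarith
      · rw [if_neg c1, if_neg c1]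
        split_ifs with c2
        · rw [h01, hA.sub _ c2.1]
          rcases hcases (x, y) with g | g | g
          · exact absurd ⟨hA.maximal _ _ (Or.inl c2.1) g, c2.2⟩ c1
          · rw [g, h00]; linarith
          · rw [g, hno]; linarith
        · linarith
  · by_contra! hcon
    have hbd : ∀ x, (x, O.yLo) ∈ A → u (x, O.yLo - 1) = -1 := fun x hx =>
      hneg _ _ (hcon x hx) (hA.ne_one (Or.inr (Or.inr (Or.inl (by simpa using hx))))
        (by simp [LatOct.mem_set]))
    refine h.peel hm (T := {p | p ∈ A ∧ p.2 = O.yLo}) (a := κ) (a' := -(2 - κ)) (b := κ) (b' := 0)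
      ?_ ⟨_, e1, f1⟩ (by ring) ?_ ?_
    · rintro ⟨x, y⟩ ⟨hp, hy⟩
      dsimp only at hy
      exact ⟨hA.sub _ hp, key x y x (y - 1) (by omega) (by rw [LatOct.mem_set]; omega)⟩
    · intro x y
      simp only [Set.mem_ofPred_eq]
      by_cases c2 : (x, y + 1) ∈ A ∧ y + 1 = O.yLo
      · have := hbd x (by rw [← c2.2]; exact c2.1)
        rw [if_pos c2, if_pos c2, if_neg (by omega), if_neg (by omega), h01, hA.sub _ c2.1,
          show y = O.yLo - 1 by omega, this, hno]; linarith
      · rw [if_neg c2, if_neg c2]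
        have := hn (u (x, y)) (u (x, y + 1))
        split_ifs with c1
        · rw [h00]; linarith
        · linarith
    · intro x y
      simp only [Set.mem_ofPred_eq]
      by_cases c1 : (x, y) ∈ A ∧ y = O.yLo
      · have := hn (u (x, y)) (u (x + 1, y))
        rw [if_pos c1, if_pos c1, h00]
        split_ifs <;> linarith
      · rw [if_neg c1, if_neg c1]
        split_ifs with c2
        · rw [h01, hA.sub _ c2.1]
          rcases hcases (x, y) with g | g | g
          · exact absurd ⟨hA.maximal _ _ (Or.inl c2.1) g, c2.2⟩ c1
          · rw [g, h00]; linarith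
          · rw [g, hno]; linarith
        · linarith

end

section

variable {κ η δ : ℝ} {K : ℤ} {J O : LatOct} {W : Pt → ℝ} {n0 : ℝ} {u : Pt → ℤ}

/-- All bounds of `O` are at least as strong as those of `J`. -/
def LatOct.Le (O J : LatOct) : Prop :=
  (J.yLo ≤ O.yLo ∧ O.yHi ≤ J.yHi) ∧ (J.xLo ≤ O.xLo ∧ O.xHi ≤ J.xHi) ∧
    (J.sLo ≤ O.sLo ∧ O.sHi ≤ J.sHi) ∧ (J.mLo ≤ O.mLo ∧ O.mHi ≤ J.mHi)

theorem LatOct.Le.sub (h : O.Le J) : ∀ p ∈ O.set, p ∈ J.set := by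
  rintro ⟨x, y⟩ hp
  simp only [LatOct.Le, LatOct.mem_set] at *; omega

theorem LatOct.Le.inWin (h : O.Le J) (hJ : J.In K) : O.In K := by
  simp only [LatOct.Le, LatOct.In] at *; omega

theorem IsHull.le {A : Set Pt} (hO : IsHull A O) (h : ∀ p ∈ A, p ∈ J.set) : O.Le J := by
  obtain ⟨h0, ⟨a1, b1, h1, e1⟩, ⟨a2, b2, h2, e2⟩, ⟨a3, b3, h3, e3⟩, ⟨a4, b4, h4, e4⟩,
    ⟨a5, b5, h5, e5⟩, ⟨a6, b6, h6, e6⟩, ⟨a7, b7, h7, e7⟩, ⟨a8, b8, h8, e8⟩⟩ := hO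
  have h1 := h _ h1
  have h2 := h _ h2
  have h3 := h _ h3
  have h4 := h _ h4
  have h5 := h _ h5
  have h6 := h _ h6
  have h7 := h _ h7
  have h8 := h _ h8
  clear h
  simp only [LatOct.Le, LatOct.mem_set] at *; omega

/-- `O` is contained in the `1`-phase and is surrounded by zeros. -/
structure OctCore (u : Pt → ℤ) (J O : LatOct) : Prop where
  tight : O.Tight
  le : O.Le J
  one : ∀ p ∈ O.set, u p = 1
  zero : ∀ x y, (x, y) ∉ O.set → Adj O.set x y → u (x, y) = 0

theorem LatOct.exists_step {O : LatOct} (hs : O.sLo < O.sHi) (hm : O.mLo < O.mHi) {a b x y : ℤ}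
    (h1 : (a, b) ∈ O.set) (h2 : (x, y) ∈ O.set) (hne : (a, b) ≠ (x, y)) :
    ∃ a' b', (a', b') ∈ O.set ∧ ((a' = a + 1 ∨ a' = a - 1) ∧ b' = b ∨
      a' = a ∧ (b' = b + 1 ∨ b' = b - 1)) ∧ |x - a'| + |y - b'| < |x - a| + |y - b| := by
  have hne : ¬ (a = x ∧ b = y) := fun h => hne (by rw [h.1, h.2])
  have key : ∀ a' b', ((a' = a + 1 ∧ a < x ∨ a' = a - 1 ∧ x < a) ∧ b' = b ∨
      a' = a ∧ (b' = b + 1 ∧ b < y ∨ b' = b - 1 ∧ y < b)) → (a', b') ∈ O.set →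
      ∃ a' b', (a', b') ∈ O.set ∧ ((a' = a + 1 ∨ a' = a - 1) ∧ b' = b ∨
      a' = a ∧ (b' = b + 1 ∨ b' = b - 1)) ∧ |x - a'| + |y - b'| < |x - a| + |y - b| :=
    fun a' b' h h' => ⟨a', b', h', by omega, by
      rcases h with ⟨⟨h, h3⟩ | ⟨h, h3⟩, rfl⟩ | ⟨rfl, ⟨h, h3⟩ | ⟨h, h3⟩⟩
      · rw [abs_of_pos (by omega : 0 < x - a), abs_of_nonneg (by omega : 0 ≤ x - a')]; omega
      · rw [abs_of_neg (by omega : x - a < 0), abs_of_nonpos (by omega : x - a' ≤ 0)]; omega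
      · rw [abs_of_pos (by omega : 0 < y - b), abs_of_nonneg (by omega : 0 ≤ y - b')]; omega
      · rw [abs_of_neg (by omega : y - b < 0), abs_of_nonpos (by omega : y - b' ≤ 0)]; omega⟩
  by_contra hcon
  have k := fun a' b' h h' => hcon (key a' b' h h')
  have k1 : ¬ (a < x ∧ (a + 1, b) ∈ O.set) := fun h => k _ _ (by omega) h.2
  have k2 : ¬ (x < a ∧ (a - 1, b) ∈ O.set) := fun h => k _ _ (by omega) h.2
  have k3 : ¬ (b < y ∧ (a, b + 1) ∈ O.set) := fun h => k _ _ (by omega) h.2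
  have k4 : ¬ (y < b ∧ (a, b - 1) ∈ O.set) := fun h => k _ _ (by omega) h.2
  clear hcon key k
  simp only [LatOct.mem_set] at h1 h2 k1 k2 k3 k4
  omega

/-- Octagons which are not diagonal segments are connected. -/
theorem LatOct.sub_of_closed {O : LatOct} (hs : O.sLo < O.sHi) (hm : O.mLo < O.mHi) {A : Set Pt}
    (hA : ∀ x y, Adj A x y → (x, y) ∈ O.set → (x, y) ∈ A) {a b : ℤ} (hab : (a, b) ∈ A)
    (habO : (a, b) ∈ O.set) : ∀ p ∈ O.set, p ∈ A := by
  rintro ⟨x, y⟩ hp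
  have key : ∀ n : ℕ, ∀ a b : ℤ, (a, b) ∈ A → (a, b) ∈ O.set → |x - a| + |y - b| < n →
      (x, y) ∈ A := by
    intro n
    induction n with
    | zero =>
      intro a b _ _ h
      have h1 := abs_nonneg (x - a)
      have h2 := abs_nonneg (y - b)
      push_cast at h; omega
    | succ n ih =>
      intro a b h1 h2 h3
      by_cases hne : (a, b) = (x, y)
      · rwa [← hne]
      · obtain ⟨a', b', g1, g2, g3⟩ := LatOct.exists_step hs hm h2 hp hne
        refine ih a' b' (hA _ _ ?_ g1) g1 (by push_cast at h3; omega)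
        rcases g2 with ⟨rfl | rfl, rfl⟩ | ⟨rfl, rfl | rfl⟩
        · exact Or.inr (Or.inl (by simpa using h1))
        · exact Or.inl (by simpa using h1)
        · exact Or.inr (Or.inr (Or.inr (by simpa using h1)))
        · exact Or.inr (Or.inr (Or.inl (by simpa using h1)))
  exact key (|x - a| + |y - b| + 1).toNat a b hab habO (by
    have h1 := abs_nonneg (x - a)
    have h2 := abs_nonneg (y - b)
    omega)

theorem dw_max_le (h : MinPb κ η δ K J W n0 u) (hO : O.Le J) (p : Pt) :
    (if p ∈ O.set ∧ u p ≠ 1 then W p else 0) ≤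
      dw W J.set u p - dw W J.set (fun p => max (u p) (O.cfg p)) p := by
  have := max_eq_one (h.cfg.spin p) (O.cfg_spin p)
  rw [LatOct.cfg_eq_one'] at this
  have hW := h.W1 p
  have hs := hO.sub p
  unfold dw
  simp only [this]
  split_ifs <;> first | linarith | (exfalso; tauto)

theorem MinPb.octCore (h : MinPb κ η δ K J W n0 u) {A : Set Pt} (hA : Core u A O)
    (hfat : ∃ x y, (x, y) ∈ A ∧ (x + 1, y) ∈ A)
    (hends : ((∃ y, (O.xHi, y) ∈ A ∧ u (O.xHi + 1, y) = 0) ∧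
      ∃ y, (O.xLo, y) ∈ A ∧ u (O.xLo - 1, y) = 0) ∧
      (∃ x, (x, O.yHi) ∈ A ∧ u (x, O.yHi + 1) = 0) ∧
      ∃ x, (x, O.yLo) ∈ A ∧ u (x, O.yLo - 1) = 0) : OctCore u J O := by
  have hle : O.Le J := hA.hull.le fun p hp => h.sub p (hA.sub p hp)
  have hin := hle.inWin h.inWin
  have hw := LatOct.gridCfg hin
  have ht := hA.hull.tight
  set v : Pt → ℤ := fun p => max (u p) (O.cfg p) with hv
  set c : Pt → ℤ := fun p => Min.min (u p) (O.cfg p) with hc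
  have hvc : GridCfg K v := h.cfg.max hw
  have hcc : GridCfg K c := h.cfg.min hw
  have hend : ∀ x y, u (x, y) = 0 → Adj O.set x y → c (x, y) ≠ -1 := fun x y h1 h2 => by
    have h3 := LatOct.cfg_ne_neg_of_adj h2
    simp only [hc, h1]; omega
  have hm := hA.hull.sub
  obtain ⟨⟨⟨y1, a1, b1⟩, y2, a2, b2⟩, ⟨x3, a3, b3⟩, x4, a4, b4⟩ := hends
  obtain ⟨d, e, hd, he, h1, h3, hce⟩ := lower_bound' h.κ0.le (by linarith [h.κ1]) hcc
    (fun x y hxy => (min_eq_one (h.cfg.spin _) (hw.spin _)).2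
      ⟨hA.sub _ hxy, LatOct.cfg_eq_one.2 (hm _ _ hxy)⟩) hA.conn hA.hull
    ⟨y1, hend _ _ b1 (Or.inr (Or.inl (by simpa using hm _ _ a1)))⟩
    ⟨y2, hend _ _ b2 (Or.inl (by simpa using hm _ _ a2))⟩
    ⟨x3, hend _ _ b3 (Or.inr (Or.inr (Or.inr (by simpa using hm _ _ a3))))⟩
    ⟨x4, hend _ _ b4 (Or.inr (Or.inr (Or.inl (by simpa using hm _ _ a4))))⟩
  obtain ⟨h4, h5⟩ := ht.lattice h.κ0 h.κ1 hin h.cfg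
  have h6 : |gridZ K v - gridZ K u| ≤ d + e := by
    rw [abs_le]; constructor <;> linarith
  have h7 := h.compare hvc (e := - (2 * κ * e + (2 - 3 * κ) * d)) (by linarith) h6
  have h8 := Finset.sum_le_sum fun p (_ : p ∈ win K) => dw_max_le h hle p
  have h8' := mul_le_mul_of_nonneg_left h8 h.η0.le
  have h9 : 0 ≤ ∑ p ∈ win K, (if p ∈ O.set ∧ u p ≠ 1 then W p else 0) :=
    Finset.sum_nonneg fun p _ => by
      have := h.W1 p
      split_ifs <;> linarith
  have h9' := mul_nonneg h.η0.le h9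
  have a1' := mul_nonneg (sub_nonneg.2 h.δq.le) hd
  have a2' := mul_nonneg (show 0 ≤ 2 * κ - δ by linarith [h.δκ, h.κ0]) he
  have hd0 : d = 0 := by
    have : (2 - 3 * κ - δ) * d = 0 := by linarith
    exact (mul_eq_zero.1 this).resolve_left (by linarith [h.δq])
  have hS : ∑ p ∈ win K, (if p ∈ O.set ∧ u p ≠ 1 then W p else 0) = 0 := by
    have : η * ∑ p ∈ win K, (if p ∈ O.set ∧ u p ≠ 1 then W p else 0) = 0 := by linarith
    exact (mul_eq_zero.1 this).resolve_left h.η0.ne'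
  have hone : ∀ p ∈ O.set, u p = 1 := fun p hp => by
    by_contra hu
    have := (Finset.sum_eq_zero_iff_of_nonneg fun p _ => by
      have := h.W1 p
      split_ifs <;> linarith).1 hS p (hin.mem_win hp)
    rw [if_pos ⟨hp, hu⟩] at this
    linarith [h.W1 p]
  have hAO : ∀ p ∈ O.set, p ∈ A := by
    obtain ⟨x, y, g1, g2⟩ := hfat
    have g1' := hm _ _ g1
    have g2 := hm _ _ g2
    rw [LatOct.mem_set] at g1' g2
    exact LatOct.sub_of_closed (by omega) (by omega)
      (fun x y h1 h2 => hA.maximal x y h1 (hone _ h2)) g1 (hm _ _ g1)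
  have hc1 : ∀ x y, c (x, y) = 1 ↔ (x, y) ∈ O.set := fun x y => by
    rw [min_eq_one (h.cfg.spin _) (hw.spin _), LatOct.cfg_eq_one]
    exact ⟨fun h => h.2, fun h => ⟨hone _ h, h⟩⟩
  have hfin : ∀ x y, (x, y) ∉ O.set → Adj O.set x y → c (x, y) = 0 → u (x, y) = 0 := by
    intro x y h1 h2 h3
    have h4 := LatOct.cfg_ne_neg_of_adj h2
    have h5 : u (x, y) ≠ 1 := fun h6 => h1 (hm _ _ (hA.maximal _ _ (by
      rcases h2 with h | h | h | h
      · exact Or.inl (hAO _ h)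
      · exact Or.inr (Or.inl (hAO _ h))
      · exact Or.inr (Or.inr (Or.inl (hAO _ h)))
      · exact Or.inr (Or.inr (Or.inr (hAO _ h)))) h6))
    have h6 := O.cfg_spin (x, y)
    have h7 := h.cfg.spin (x, y)
    simp only [hc] at h3
    unfold IsSpin at h6 h7; omega
  obtain ⟨e1, e2⟩ := hce hd0
  refine ⟨ht, hle, hone, fun x y hn hadj => hfin x y hn hadj ?_⟩
  have hO' := O.mem_set (x := x) (y := y)
  rcases hadj with g | g | g | g
  · have := ((e2 y (by simp only [LatOct.mem_set] at g; omega)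
      (by simp only [LatOct.mem_set] at g; omega)).2 (x + 1) ((hc1 _ _).2 g) (fun t ht => by
        dsimp only; rw [Ne, hc1]; simp only [LatOct.mem_set] at *; omega))
    simpa using this
  · have := ((e2 y (by simp only [LatOct.mem_set] at g; omega)
      (by simp only [LatOct.mem_set] at g; omega)).1 (x - 1) ((hc1 _ _).2 g) (fun t ht => by
        dsimp only; rw [Ne, hc1]; simp only [LatOct.mem_set] at *; omega))
    simpa using this
  · have := ((e1 x (by simp only [LatOct.mem_set] at g; omega)
      (by simp only [LatOct.mem_set] at g; omega)).2 (y + 1) ((hc1 _ _).2 g) (fun t ht => by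
        rw [Ne, hc1]; simp only [LatOct.mem_set] at *; omega))
    simpa using this
  · have := ((e1 x (by simp only [LatOct.mem_set] at g; omega)
      (by simp only [LatOct.mem_set] at g; omega)).1 (y - 1) ((hc1 _ _).2 g) (fun t ht => by
        rw [Ne, hc1]; simp only [LatOct.mem_set] at *; omega))
    simpa using this

/-- Enlarging the core inside the zeros surrounding it. -/
theorem MinPb.growth (h : MinPb κ η δ K J W n0 u) (hO : OctCore u J O) {P : LatOct} (hP : P.Tight)
    (hPJ : P.Le J) (hOP : O.Le P) (hPO : ∀ x y, (x, y) ∈ P.set → (x, y) ∉ O.set →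
      Adj O.set x y) :
    η * ∑ p ∈ win K, (if p ∈ P.set ∧ p ∉ O.set then (J.F p : ℝ) else 0) ≤
      κ * (P.en - O.en : ℤ) + δ * |((P.N - O.N : ℤ) : ℝ)| := by
  have hin := hPJ.inWin h.inWin
  have hw := LatOct.gridCfg hin
  set v : Pt → ℤ := fun p => max (u p) (P.cfg p) with hv
  set c : Pt → ℤ := fun p => Min.min (u p) (P.cfg p) with hc
  have hvc : GridCfg K v := h.cfg.max hw
  have hcc : GridCfg K c := h.cfg.min hw
  have hf := LatOct.frame hO.tight (c := c) fun x y h1 h2 => by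
    have h3 : P.cfg (x, y) ≠ -1 := LatOct.cfg_ne_neg_of_adj (by
      rcases h2 with h | h | h | h
      · exact Or.inl (hOP.sub _ h)
      · exact Or.inr (Or.inl (hOP.sub _ h))
      · exact Or.inr (Or.inr (Or.inl (hOP.sub _ h)))
      · exact Or.inr (Or.inr (Or.inr (hOP.sub _ h))))
    simp only [hc, hO.zero x y h1 h2]; omega
  obtain ⟨d, e, hd, he, h1, h3, -⟩ := lower_bound' h.κ0.le (by linarith [h.κ1]) hcc
    (fun x y hxy => (min_eq_one (h.cfg.spin _) (hw.spin _)).2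
      ⟨hO.one _ hxy, LatOct.cfg_eq_one.2 (hOP.sub _ hxy)⟩) O.conn hO.tight
    hf.1 hf.2.1 hf.2.2.1 hf.2.2.2
  obtain ⟨h4, h5⟩ := hP.lattice h.κ0 h.κ1 hin h.cfg
  have h6 : |gridZ K v - gridZ K u| ≤ |((P.N - O.N : ℤ) : ℝ)| + (d + e) := by
    have : gridZ K v - gridZ K u = ((P.N - O.N : ℤ) : ℝ) + (d - e) := by push_cast; linarith
    rw [this]
    refine (abs_add_le _ _).trans (add_le_add le_rfl ?_)
    rw [abs_le]; constructor <;> linarith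
  have h7 := h.compare hvc (e := κ * (P.en - O.en : ℤ) - (2 * κ * e + (2 - 3 * κ) * d))
    (by push_cast; linarith) h6
  have h8 : ∑ p ∈ win K, (if p ∈ P.set ∧ p ∉ O.set then (J.F p : ℝ) else 0) ≤
      ∑ p ∈ win K, (dw W J.set u p - dw W J.set v p) := by
    refine Finset.sum_le_sum fun p _ => le_trans (le_of_eq ?_) (dw_max_le h hPJ p)
    by_cases c1 : p ∈ P.set
    · by_cases c2 : p ∈ O.set
      · simp [c1, c2, hO.one p c2]
      · have : u p = 0 := hO.zero p.1 p.2 c2 (hPO _ _ c1 c2)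
        rw [if_pos ⟨c1, c2⟩, if_pos ⟨c1, by omega⟩, h.WF p (hPJ.sub p c1)]
    · simp [c1]
  have h8' := mul_le_mul_of_nonneg_left h8 h.η0.le
  have a1' := mul_nonneg (sub_nonneg.2 h.δq.le) hd
  have a2' := mul_nonneg (show 0 ≤ 2 * κ - δ by linarith [h.δκ, h.κ0]) he
  linarith

end

section

variable {κ η δ : ℝ} {K : ℤ} {J O : LatOct} {W : Pt → ℝ} {n0 : ℝ} {u : Pt → ℤ} {m M : ℤ}

/-- Reflection in the horizontal axis. -/
def LatOct.flip (O : LatOct) : LatOct :=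
  ⟨-O.yHi, -O.yLo, O.xLo, O.xHi, O.mLo, O.mHi, O.sLo, O.sHi⟩

theorem LatOct.mem_flip {O : LatOct} {x y : ℤ} : (x, y) ∈ O.flip.set ↔ (x, -y) ∈ O.set := by
  simp only [LatOct.mem_set, LatOct.flip]; omega

theorem LatOct.flip_flip (O : LatOct) : O.flip.flip = O := by
  simp [LatOct.flip]

theorem LatOct.Tight.flip (h : O.Tight) : O.flip.Tight := by
  have key : ∀ {a b}, (a, b) ∈ O.set → (a, -b) ∈ O.flip.set := fun h => by
    rwa [LatOct.mem_flip, neg_neg]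
  obtain ⟨h0, ⟨a1, b1, h1, e1⟩, ⟨a2, b2, h2, e2⟩, ⟨a3, b3, h3, e3⟩, ⟨a4, b4, h4, e4⟩,
    ⟨a5, b5, h5, e5⟩, ⟨a6, b6, h6, e6⟩, ⟨a7, b7, h7, e7⟩, ⟨a8, b8, h8, e8⟩⟩ := h
  refine ⟨fun _ _ h => h, ⟨a2, -b2, key h2, ?_⟩, ⟨a1, -b1, key h1, ?_⟩,
    ⟨a3, -b3, key h3, ?_⟩, ⟨a4, -b4, key h4, ?_⟩, ⟨a7, -b7, key h7, ?_⟩, ⟨a8, -b8, key h8, ?_⟩,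
    ⟨a5, -b5, key h5, ?_⟩, ⟨a6, -b6, key h6, ?_⟩⟩ <;> simp only [LatOct.flip] <;> omega

theorem LatOct.F_swap (J : LatOct) (x y : ℤ) : J.swap.F (x, y) = J.F (y, x) := by
  have h : ∀ t, t ≤ J.swap.F (x, y) ↔ t ≤ J.F (y, x) := fun t => by
    simp only [LatOct.le_F, LatOct.swap]; omega
  exact le_antisymm ((h _).1 le_rfl) ((h _).2 le_rfl)

theorem LatOct.F_flip (J : LatOct) (x y : ℤ) : J.flip.F (x, y) = J.F (x, -y) := by
  have h : ∀ t, t ≤ J.flip.F (x, y) ↔ t ≤ J.F (x, -y) := fun t => by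
    simp only [LatOct.le_F, LatOct.flip]; omega
  exact le_antisymm ((h _).1 le_rfl) ((h _).2 le_rfl)

theorem MinPb.map (h : MinPb κ η δ K J W n0 u) {e : Pt → Pt} (he : ∀ p, e (e p) = p)
    (hw : ∀ p ∈ win K, e p ∈ win K) (hE : ∀ f, gridE κ K (fun p => f (e p)) = gridE κ K f)
    (hC : ∀ f, GridCfg K f → GridCfg K (fun p => f (e p))) {J' : LatOct} (hT : J'.Tight)
    (hI : J'.In K) (hF : ∀ p, J'.F p = J.F (e p)) :
    MinPb κ η δ K J' (fun p => W (e p)) n0 (fun p => u (e p)) := by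
  have hs : ∀ g : Pt → ℝ, ∑ p ∈ win K, g (e p) = ∑ p ∈ win K, g p := fun g =>
    Finset.sum_nbij' e e hw hw (fun p _ => he p) (fun p _ => he p) fun p _ => rfl
  have hm : ∀ p, p ∈ J'.set ↔ e p ∈ J.set := fun p => by
    rw [LatOct.mem_iff_F, LatOct.mem_iff_F, hF]
  have hd : ∀ v p, dw (fun p => W (e p)) J'.set (fun p => v (e p)) p = dw W J.set v (e p) :=
    fun v p => by simp only [dw, hm]
  have hz : ∀ v, gridZ K (fun p => v (e p)) = gridZ K v := fun v => hs fun p => zi (v p)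
  refine ⟨h.κ0, h.κ1, h.η0, h.δ0, h.δκ, h.δq, h.δ1, hC _ h.cfg, hT, hI, fun p => h.W1 _,
    fun p hp => by rw [hF]; exact h.WF _ ((hm p).1 hp), fun v hv => ?_⟩
  have := h.min _ (hC v hv)
  have hv' : ∀ p, dw (fun p => W (e p)) J'.set v p = dw W J.set (fun q => v (e q)) (e p) :=
    fun p => by simp only [dw, hm, he]
  rw [hE v, hz v] at this
  rw [hE, hz]
  simp only [hd, hv']
  rwa [hs (dw W J.set u), hs (dw W J.set fun q => v (e q))]

theorem MinPb.swap (h : MinPb κ η δ K J W n0 u) :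
    MinPb κ η δ K J.swap (fun p => W (p.2, p.1)) n0 (fun p => u (p.2, p.1)) :=
  h.map (e := fun p => (p.2, p.1)) (fun _ => rfl)
    (fun p hp => by rw [mem_win] at *; exact hp.symm) (gridE_swap κ K) (fun _ h => h.swap)
    h.tight.swap h.inWin.swap fun p => LatOct.F_swap _ _ _

theorem sum_Ioo_neg (K : ℤ) (g : ℤ → ℝ) :
    ∑ t ∈ Finset.Ioo (-K) K, g (-t) = ∑ t ∈ Finset.Ioo (-K) K, g t :=
  Finset.sum_nbij' (fun t => -t) (fun t => -t) (fun t ht => by simp at ht ⊢; omega)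
    (fun t ht => by simp at ht ⊢; omega) (by simp) (by simp) (by simp)

theorem MinPb.flip (h : MinPb κ η δ K J W n0 u) :
    MinPb κ η δ K J.flip (fun p => W (p.1, -p.2)) n0 (fun p => u (p.1, -p.2)) :=
  h.map (e := fun p => (p.1, -p.2)) (fun _ => by simp)
    (fun p hp => by rw [mem_win] at *; dsimp only; omega)
    (fun f => by
      unfold gridE
      dsimp only
      congr 1
      · exact Finset.sum_congr rfl fun x _ => lineE_neg κ K (fun y => f (x, y))
      · exact sum_Ioo_neg K fun y => lineE κ K (fun x => f (x, y)))
    (fun _ h => ⟨fun _ => h.spin _, fun p hp => by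
      have := h.supp _ hp; dsimp only at this; omega⟩)
    h.tight.flip (by
      have := h.inWin
      simp only [LatOct.In, LatOct.flip] at *; omega) fun p => LatOct.F_flip _ _ _

theorem OctCore.swap (h : OctCore u J O) : OctCore (fun p => u (p.2, p.1)) J.swap O.swap := by
  refine ⟨h.tight.swap, ?_, ?_, ?_⟩
  · have := h.le
    simp only [LatOct.Le, LatOct.swap] at *; omega
  · rintro ⟨x, y⟩ hp
    exact h.one _ (LatOct.mem_swap.1 hp)
  · intro x y h1 h2
    rw [LatOct.mem_swap] at h1
    refine h.zero y x h1 ?_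
    simp only [Adj, LatOct.mem_swap] at *
    tauto

theorem OctCore.flip (h : OctCore u J O) : OctCore (fun p => u (p.1, -p.2)) J.flip O.flip := by
  refine ⟨h.tight.flip, ?_, ?_, ?_⟩
  · have := h.le
    simp only [LatOct.Le, LatOct.flip] at *; omega
  · rintro ⟨x, y⟩ hp
    exact h.one _ (LatOct.mem_flip.1 hp)
  · intro x y h1 h2
    rw [LatOct.mem_flip] at h1
    refine h.zero x (-y) h1 ?_
    have e1 : -y + 1 = -(y - 1) := by ring
    have e2 : -y - 1 = -(y + 1) := by ring
    simp only [Adj, LatOct.mem_flip, e1, e2] at *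
    tauto

/-- The top side has length at least `M`. -/
def LatOct.TopFlat (J : LatOct) (M : ℤ) : Prop :=
  ∃ a b, (a, J.yHi) ∈ J.set ∧ (b, J.yHi) ∈ J.set ∧ M ≤ b - a

/-- The four axis-parallel sides have length at least `M`. -/
def LatOct.Flats (J : LatOct) (M : ℤ) : Prop :=
  (J.TopFlat M ∧ J.flip.TopFlat M) ∧ J.swap.TopFlat M ∧ J.swap.flip.TopFlat M

theorem LatOct.swap_swap (O : LatOct) : O.swap.swap = O := by simp [LatOct.swap]

theorem LatOct.Flats.swap (h : J.Flats M) : J.swap.Flats M :=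
  ⟨h.2, by rw [LatOct.swap_swap]; exact h.1⟩

theorem LatOct.Flats.flip (h : J.Flats M) : J.flip.Flats M := by
  obtain ⟨⟨h1, h2⟩, ⟨a, b, g1, g2, g3⟩, a', b', g1', g2', g3'⟩ := h
  refine ⟨⟨h2, by rwa [LatOct.flip_flip]⟩, ⟨-b, -a, ?_, ?_, by omega⟩, -b', -a', ?_, ?_, by omega⟩ <;>
  simp only [LatOct.flip, LatOct.swap, LatOct.mem_set] at * <;> omega

/-- A minimizer with a fat octagonal core. -/
structure FatPb (κ η δ : ℝ) (K : ℤ) (J : LatOct) (W : Pt → ℝ) (n0 : ℝ) (u : Pt → ℤ) (O : LatOct)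
    (m M : ℤ) : Prop where
  pb : MinPb κ η δ K J W n0 u
  core : OctCore u J O
  fat : ∀ x y, m ≤ J.F (x, y) → (x, y) ∈ O.set
  m1 : 1 ≤ m
  M1 : 20 * m ≤ M
  flats : J.Flats M
  num : ∀ t : ℤ, 0 ≤ t → η * (t * (M / 2)) ≤ 2 * κ + δ → 16 * η * t ^ 2 ≤ κ

theorem FatPb.swap (h : FatPb κ η δ K J W n0 u O m M) :
    FatPb κ η δ K J.swap (fun p => W (p.2, p.1)) n0 (fun p => u (p.2, p.1)) O.swap m M :=
  ⟨h.pb.swap, h.core.swap, fun x y hxy => LatOct.mem_swap.2 (h.fat y x (by rwa [← LatOct.F_swap])),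
    h.m1, h.M1, h.flats.swap, h.num⟩

theorem FatPb.flip (h : FatPb κ η δ K J W n0 u O m M) :
    FatPb κ η δ K J.flip (fun p => W (p.1, -p.2)) n0 (fun p => u (p.1, -p.2)) O.flip m M :=
  ⟨h.pb.flip, h.core.flip, fun x y hxy => LatOct.mem_flip.2 (h.fat x (-y) (by rwa [← LatOct.F_flip])),
    h.m1, h.M1, h.flats.flip, h.num⟩

/-- Enlarging one bound of a tight octagon. -/
theorem LatOct.Tight.enlarge (h : O.Tight) {P : LatOct} (hOP : O.Le P)
    (hP : P.yLo = O.yLo ∧ P.xLo = O.xLo ∧ P.xHi = O.xHi ∧ P.sLo = O.sLo ∧ P.mLo = O.mLo ∧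
      P.mHi = O.mHi) (hy : ∃ x y, (x, y) ∈ P.set ∧ y = P.yHi) (hs : ∃ x y, (x, y) ∈ P.set ∧
      x + y = P.sHi) : P.Tight := by
  obtain ⟨h0, ⟨a1, b1, h1, e1⟩, ⟨a2, b2, h2, e2⟩, ⟨a3, b3, h3, e3⟩, ⟨a4, b4, h4, e4⟩,
    ⟨a5, b5, h5, e5⟩, ⟨a6, b6, h6, e6⟩, ⟨a7, b7, h7, e7⟩, ⟨a8, b8, h8, e8⟩⟩ := h
  obtain ⟨p1, p2, p3, p4, p5, p6⟩ := hP
  exact ⟨fun _ _ h => h, ⟨a1, b1, hOP.sub _ h1, by omega⟩, hy,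
    ⟨a3, b3, hOP.sub _ h3, by omega⟩, ⟨a4, b4, hOP.sub _ h4, by omega⟩,
    ⟨a5, b5, hOP.sub _ h5, by omega⟩, hs, ⟨a7, b7, hOP.sub _ h7, by omega⟩,
    ⟨a8, b8, hOP.sub _ h8, by omega⟩⟩

/-- Points of the core below the top side. -/
theorem FatPb.witness (h : FatPb κ η δ K J W n0 u O m M) : ∃ a b, (a, J.yHi) ∈ J.set ∧
    (b, J.yHi) ∈ J.set ∧ M ≤ b - a ∧ J.yLo + M ≤ J.yHi ∧
    ∀ x, a + 2 * m ≤ x → x ≤ b - 2 * m → (x, J.yHi - m + 1) ∈ O.set := by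
  have hm := h.m1
  have hM := h.M1
  obtain ⟨⟨⟨a, b, hA, hB, hAB⟩, -⟩, ⟨c, d, hC, hD, hCD⟩, -⟩ := h.flats
  have hH : J.yLo + M ≤ J.yHi := by
    simp only [LatOct.swap, LatOct.mem_set] at hC hD; omega
  refine ⟨a, b, hA, hB, hAB, hH, fun x h1 h2 => h.fat _ _ (LatOct.le_F.2 ?_)⟩
  rw [LatOct.mem_set] at hA hB
  omega

theorem FatPb.top (h : FatPb κ η δ K J W n0 u O m M) :
    16 * η * ((J.yHi - O.yHi : ℤ) : ℝ) ^ 2 ≤ κ := by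
  have hle := h.core.le
  have hm := h.m1
  have hM := h.M1
  obtain ⟨a, b, hA, hB, hAB, hH, hw⟩ := h.witness
  rw [LatOct.mem_set] at hA hB
  have hw1 := hw (a + 2 * m) (by omega) (by omega)
  have hw2 := hw (b - 2 * m) (by omega) (by omega)
  rw [LatOct.mem_set] at hw1 hw2
  simp only [LatOct.Le] at hle
  by_cases hlt : O.yHi < J.yHi
  swap
  · have : J.yHi - O.yHi = 0 := by omega
    rw [this]; simpa using h.pb.κ0.le
  refine h.num _ (by omega) ?_
  set P : LatOct := { O with yHi := O.yHi + 1 } with hP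
  have hrow : ∀ x, a + 3 * m ≤ x → x ≤ b - 3 * m → (x, O.yHi + 1) ∈ P.set ∧
      J.yHi - O.yHi ≤ J.F (x, O.yHi + 1) := fun x h1 h2 => by
    have := hw x (by omega) (by omega)
    rw [LatOct.mem_set] at this
    rw [LatOct.le_F, LatOct.mem_set]
    simp only [hP]; omega
  have hOP : O.Le P := by simp only [LatOct.Le, hP]; omega
  have hPJ : P.Le J := by simp only [LatOct.Le, hP]; omega
  obtain ⟨x6, y6, h6, e6⟩ := h.core.tight.sHi
  obtain ⟨x3, y3, h3, e3⟩ := h.core.tight.xLo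
  obtain ⟨x4, y4, h4, e4⟩ := h.core.tight.xHi
  have hPt : P.Tight := h.core.tight.enlarge hOP (by simp [hP])
    ⟨a + 3 * m, O.yHi + 1, (hrow _ le_rfl (by omega)).1, rfl⟩ ⟨x6, y6, hOP.sub _ h6, e6⟩
  have hg := h.pb.growth h.core hPt hPJ hOP (fun x y h1 h2 => by
    refine Or.inr (Or.inr (Or.inr ?_))
    simp only [LatOct.mem_set, hP] at *; omega)
  have e1 : P.en - O.en = 2 := by simp only [LatOct.en, LatOct.N, hP]; ring
  have e2 : P.N - O.N = 0 := by simp only [LatOct.N, hP]; ring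
  rw [e1, e2] at hg
  set S := (Finset.Icc (a + 3 * m) (b - 3 * m)).image fun x => ((x, O.yHi + 1) : Pt) with hS
  have hsum : ((b - a - 6 * m + 1 : ℤ) : ℝ) * ((J.yHi - O.yHi : ℤ) : ℝ) ≤
      ∑ p ∈ win K, (if p ∈ P.set ∧ p ∉ O.set then (J.F p : ℝ) else 0) := by
    have hSw : S ⊆ win K := fun p hp => by
      obtain ⟨x, hx, rfl⟩ := Finset.mem_image.1 hp
      rw [Finset.mem_Icc] at hx
      exact (hPJ.inWin h.pb.inWin).mem_win (hrow x hx.1 hx.2).1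
    refine le_trans ?_ (Finset.sum_le_sum_of_subset_of_nonneg hSw fun p _ _ => ?_)
    · have hc : (S.card : ℝ) = ((b - a - 6 * m + 1 : ℤ) : ℝ) := by
        rw [hS, Finset.card_image_of_injective _ fun x y hxy => (Prod.ext_iff.1 hxy).1,
          card_Icc_cast (by omega)]
        push_cast; ring
      rw [← hc, ← nsmul_eq_mul]
      refine Finset.card_nsmul_le_sum _ _ _ fun p hp => ?_
      obtain ⟨x, hx, rfl⟩ := Finset.mem_image.1 hp
      rw [Finset.mem_Icc] at hx
      obtain ⟨g1, g2⟩ := hrow x hx.1 hx.2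
      rw [if_pos ⟨g1, by rw [LatOct.mem_set]; omega⟩]
      exact_mod_cast g2
    · split_ifs with hp
      · have := LatOct.mem_iff_F.1 (hPJ.sub p hp.1)
        exact_mod_cast (by omega : 0 ≤ J.F p)
      · exact le_rfl
  have ht : (0 : ℝ) ≤ ((J.yHi - O.yHi : ℤ) : ℝ) := by exact_mod_cast (by omega : 0 ≤ J.yHi - O.yHi)
  have hM2 : (M : ℝ) / 2 ≤ ((b - a - 6 * m + 1 : ℤ) : ℝ) := by
    rw [div_le_iff₀ two_pos]
    exact_mod_cast (by omega : M ≤ (b - a - 6 * m + 1) * 2)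
  have k1 := mul_le_mul_of_nonneg_left hM2 ht
  have k2 := mul_le_mul_of_nonneg_left (k1.trans ((mul_comm _ _).le.trans hsum)) h.pb.η0.le
  refine k2.trans (hg.trans ?_)
  have := h.pb.δ0
  norm_num
  linarith

/-- The diagonal layer next to the upper right side dominates the excess in a column. -/
theorem FatPb.diag (h : FatPb κ η δ K J W n0 u O m M) (x : ℤ) :
    η * ∑ y ∈ Finset.Ioo (-K) K, (if ((x, y) ∈ J.set ∧ (x, y) ∉ O.set) ∧ (O.xLo ≤ x ∧ x ≤ O.xHi) ∧
      (O.yLo ≤ y ∧ y ≤ O.yHi) ∧ O.sHi < x + y then (J.F (x, y) : ℝ) else 0) ≤ 2 * κ + δ := by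
  have hκ := h.pb.κ0
  have hδ := h.pb.δ0
  by_cases hex : ∃ y, ((x, y) ∈ J.set ∧ (x, y) ∉ O.set) ∧ (O.xLo ≤ x ∧ x ≤ O.xHi) ∧
      (O.yLo ≤ y ∧ y ≤ O.yHi) ∧ O.sHi < x + y
  swap
  · rw [Finset.sum_eq_zero fun y _ => if_neg fun hy => hex ⟨y, hy⟩]
    linarith
  have hle := h.core.le
  have hm := h.m1
  have hM := h.M1
  obtain ⟨a, b, hA, hB, hAB, hH, hw⟩ := h.witness
  rw [LatOct.mem_set] at hA hB
  have hw1 := hw (a + 2 * m) (by omega) (by omega)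
  have hw2 := hw (b - 2 * m) (by omega) (by omega)
  rw [LatOct.mem_set] at hw1 hw2
  simp only [LatOct.Le] at hle
  set P : LatOct := { O with sHi := O.sHi + 1 } with hP
  obtain ⟨x2, y2, h2, e2⟩ := h.core.tight.yHi
  obtain ⟨x4, y4, h4, e4⟩ := h.core.tight.xHi
  have key : ∀ y, (((x, y) ∈ J.set ∧ (x, y) ∉ O.set) ∧ (O.xLo ≤ x ∧ x ≤ O.xHi) ∧
      (O.yLo ≤ y ∧ y ≤ O.yHi) ∧ O.sHi < x + y) → (O.sHi + 1 - y, y) ∈ P.set ∧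
      J.F (x, y) ≤ J.F (O.sHi + 1 - y, y) := by
    rintro y ⟨⟨g1, g1'⟩, g2, g3, g4⟩
    have hF : J.F (x, y) < m := by
      by_contra hcon
      exact g1' (h.fat x y (by omega))
    have hF' := LatOct.le_F.1 (le_refl (J.F (x, y)))
    rw [LatOct.le_F]
    simp only [LatOct.mem_set] at g1 h2 h4 ⊢
    simp only [hP]
    omega
  obtain ⟨y0, hy0⟩ := hex
  have hJs : O.sHi + 1 ≤ J.sHi := by
    have := hy0.1.1
    rw [LatOct.mem_set] at this; omega
  have hOP : O.Le P := by simp only [LatOct.Le, hP]; omega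
  have hPJ : P.Le J := by simp only [LatOct.Le, hP]; omega
  have hPt : P.Tight := h.core.tight.enlarge hOP (by simp [hP])
    ⟨x2, y2, hOP.sub _ h2, e2⟩ ⟨_, _, (key y0 hy0).1, by simp only [hP]; ring⟩
  have hg := h.pb.growth h.core hPt hPJ hOP (fun x y h1 h2' => by
    refine Or.inr (Or.inl ?_)
    simp only [LatOct.mem_set, hP] at *; omega)
  have e1 : P.en - O.en = 2 := by simp only [LatOct.en, LatOct.N, hP]; ring
  have e2 : P.N - O.N = 1 := by simp only [LatOct.N, hP]; ring
  rw [e1, e2] at hg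
  have hnn : ∀ p, (0 : ℝ) ≤ if p ∈ P.set ∧ p ∉ O.set then (J.F p : ℝ) else 0 := fun p => by
    split_ifs with hp
    · have := LatOct.mem_iff_F.1 (hPJ.sub p hp.1)
      exact_mod_cast (by omega : 0 ≤ J.F p)
    · exact le_rfl
  have hsum : ∑ y ∈ Finset.Ioo (-K) K, (if ((x, y) ∈ J.set ∧ (x, y) ∉ O.set) ∧
      (O.xLo ≤ x ∧ x ≤ O.xHi) ∧
      (O.yLo ≤ y ∧ y ≤ O.yHi) ∧ O.sHi < x + y then (J.F (x, y) : ℝ) else 0) ≤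
      ∑ p ∈ win K, (if p ∈ P.set ∧ p ∉ O.set then (J.F p : ℝ) else 0) := by
    rw [win, Finset.sum_product_right]
    refine Finset.sum_le_sum fun y _ => ?_
    split_ifs with hy
    · obtain ⟨g1, g2⟩ := key y hy
      have g3 := mem_win.1 ((hPJ.inWin h.pb.inWin).mem_win g1)
      refine le_trans ?_ (Finset.single_le_sum (f := fun x =>
        if (x, y) ∈ P.set ∧ (x, y) ∉ O.set then (J.F (x, y) : ℝ) else 0) (fun x _ => hnn (x, y))
        (Finset.mem_Ioo.2 g3.1))
      rw [if_pos ⟨g1, by rw [LatOct.mem_set]; omega⟩]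
      exact_mod_cast g2
    · exact Finset.sum_nonneg fun x _ => hnn (x, y)
  refine (mul_le_mul_of_nonneg_left hsum h.pb.η0.le).trans (hg.trans ?_)
  norm_num
  linarith

end

section

variable {κ η δ : ℝ} {K : ℤ} {J O : LatOct} {W : Pt → ℝ} {n0 : ℝ} {u : Pt → ℤ} {m M : ℤ}
  {f g : ℤ → ℤ}

/-- The indicator of a proposition. -/
noncomputable def ind (P : Prop) : ℝ := if P then 1 else 0

theorem ind_true {P : Prop} (h : P) : ind P = 1 := if_pos h
theorem ind_false {P : Prop} (h : ¬ P) : ind P = 0 := if_neg h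

theorem ind_nonneg (P : Prop) : 0 ≤ ind P := by unfold ind; split_ifs <;> norm_num

theorem LineCfg.eq_neg_one (hf : LineCfg K f) {t : ℤ} (ht : t ≤ -K ∨ K ≤ t) : f t = -1 := by
  by_contra h
  have := hf.supp t h; omega

theorem right_extra (h0 : 0 ≤ κ) (h1 : κ ≤ 1) (hf : LineCfg K f) {b : ℤ} (hb : f b = 0) :
    κ + 3 / 2 * κ * ind (∃ t, b < t ∧ f t = 1) + κ / 4 * ∑ t ∈ Finset.Ico (b + 1) K, zi (f t) ≤
      ∑ t ∈ Finset.Ico b K, bc κ (f t) (f (t + 1)) := by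
  have hbK := (hf.supp b (by omega)).2
  rw [sum_Ico_first _ hbK, hb, bc_zero_left]
  have h2 := sum_zi_le_left (f := f) h0 (b + 1) K
  have h3 : 0 ≤ κ * ∑ t ∈ Finset.Ico (b + 1) K, zi (f t) :=
    mul_nonneg h0 (Finset.sum_nonneg fun _ _ => zi_nonneg _)
  by_cases h : ∃ t, b < t ∧ f t = 1
  · rw [ind_true h]
    obtain ⟨t, ht, ht1⟩ := h
    have := two_mul_le_of_plus h0 h1 hf (a := b + 1) ⟨t, by omega, ht1⟩
    linarith
  · rw [ind_false h]; linarith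

theorem sum_zi_neg (hf : LineCfg K f) (a : ℤ) :
    ∑ t ∈ Finset.Ico (-a + 1) K, zi (f (-t)) = ∑ t ∈ Finset.Ico (-K) a, zi (f t) := by
  have h1 : ∑ t ∈ Finset.Ico (-K) a, zi (f t) = ∑ t ∈ Finset.Ioo (-K) a, zi (f t) := by
    refine (Finset.sum_subset (fun t ht => by simp at ht ⊢; omega) fun t ht h => ?_).symm
    rw [hf.eq_neg_one (by simp at ht h; omega), zi_neg_one]
  rw [h1]
  exact Finset.sum_nbij' (fun t => -t) (fun t => -t) (fun t ht => by simp at ht ⊢; omega)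
    (fun t ht => by simp at ht ⊢; omega) (by simp) (by simp) (by simp)

theorem left_extra (h0 : 0 ≤ κ) (h1 : κ ≤ 1) (hf : LineCfg K f) {a : ℤ} (ha : f a = 0) :
    κ + 3 / 2 * κ * ind (∃ t, t < a ∧ f t = 1) + κ / 4 * ∑ t ∈ Finset.Ico (-K) a, zi (f t) ≤
      ∑ t ∈ Finset.Ico (-K) a, bc κ (f t) (f (t + 1)) := by
  have h := right_extra h0 h1 hf.neg (b := -a) (by simpa using ha)
  rw [sum_bc_neg, neg_neg, sum_zi_neg hf] at h
  have e : (∃ t, -a < t ∧ f (-t) = 1) ↔ ∃ t, t < a ∧ f t = 1 :=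
    ⟨fun ⟨t, h1, h2⟩ => ⟨-t, by omega, h2⟩, fun ⟨t, h1, h2⟩ => ⟨-t, by omega, by simpa using h2⟩⟩
  rwa [e] at h

theorem line_extra (h0 : 0 ≤ κ) (h1 : κ ≤ 1) (hf : LineCfg K f) {a b : ℤ} (hab : a ≤ b)
    (hfg : ∀ t, a ≤ t → t ≤ b → f t = g t) (ga : g a = 0) (gb : g b = 0)
    (hout : ∀ t, t < a ∨ b < t → g t = -1) :
    lineE κ K g + 3 / 2 * κ * (ind (∃ t, b < t ∧ f t = 1) + ind (∃ t, t < a ∧ f t = 1)) +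
      κ / 4 * (lineZ K f - lineZ K g) ≤ lineE κ K f := by
  have fa : f a = 0 := by rw [hfg a le_rfl hab, ga]
  have fb : f b = 0 := by rw [hfg b hab le_rfl, gb]
  have hK1 := hf.supp a (by omega)
  have hK2 := hf.supp b (by omega)
  have hr := right_extra h0 h1 hf fb
  have hl := left_extra h0 h1 hf fa
  have g1 : ∑ t ∈ Finset.Ico b K, bc κ (g t) (g (t + 1)) = κ := by
    rw [sum_Ico_first _ hK2.2, gb, bc_zero_left, Finset.sum_eq_zero, add_zero]
    intro t ht
    rw [Finset.mem_Ico] at ht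
    rw [hout t (by omega), hout (t + 1) (by omega), bc_neg_neg]
  have g2 : ∑ t ∈ Finset.Ico (-K) a, bc κ (g t) (g (t + 1)) = κ := by
    rw [sum_Ico_split _ (show -K ≤ a - 1 by omega) (show a - 1 ≤ a by omega),
      sum_Ico_first _ (show a - 1 < a by omega), sub_add_cancel, ga, bc_zero_right,
      Finset.Ico_self, Finset.sum_empty, Finset.sum_eq_zero]
    · ring
    intro t ht
    rw [Finset.mem_Ico] at ht
    rw [hout t (by omega), hout (t + 1) (by omega), bc_neg_neg]
  have g3 : ∑ t ∈ Finset.Ico a b, bc κ (g t) (g (t + 1)) =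
      ∑ t ∈ Finset.Ico a b, bc κ (f t) (f (t + 1)) := Finset.sum_congr rfl fun t ht => by
    rw [Finset.mem_Ico] at ht
    rw [hfg t (by omega) (by omega), hfg (t + 1) (by omega) (by omega)]
  have g4 : ∑ t ∈ Finset.Ico a (b + 1), zi (g t) = ∑ t ∈ Finset.Ico a (b + 1), zi (f t) :=
    Finset.sum_congr rfl fun t ht => by
      rw [Finset.mem_Ico] at ht
      rw [hfg t (by omega) (by omega)]
  have g5 : ∑ t ∈ Finset.Ico (-K) a, zi (g t) = 0 := Finset.sum_eq_zero fun t ht => by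
    rw [Finset.mem_Ico] at ht
    rw [hout t (by omega), zi_neg_one]
  have g6 : ∑ t ∈ Finset.Ico (b + 1) K, zi (g t) = 0 := Finset.sum_eq_zero fun t ht => by
    rw [Finset.mem_Ico] at ht
    rw [hout t (by omega), zi_neg_one]
  have e1 : ∀ h : ℤ → ℤ, lineE κ K h = ∑ t ∈ Finset.Ico (-K) a, bc κ (h t) (h (t + 1)) +
      (∑ t ∈ Finset.Ico a b, bc κ (h t) (h (t + 1)) +
      ∑ t ∈ Finset.Ico b K, bc κ (h t) (h (t + 1))) := fun h => by
    rw [← sum_Ico_split _ hab hK2.2.le, ← sum_Ico_split _ hK1.1.le (by omega), lineE]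
  have e2 : ∀ h : ℤ → ℤ, lineZ K h = ∑ t ∈ Finset.Ico (-K) a, zi (h t) +
      (∑ t ∈ Finset.Ico a (b + 1), zi (h t) + ∑ t ∈ Finset.Ico (b + 1) K, zi (h t)) := fun h => by
    rw [← sum_Ico_split _ (by omega) (by omega), ← sum_Ico_split _ hK1.1.le (by omega), lineZ]
  rw [e1, e1, e2, e2, g1, g2, g3, g4, g5, g6]
  linarith

theorem line_extra_empty (h0 : 0 ≤ κ) (h1 : κ ≤ 1) (hf : LineCfg K f) :
    3 * κ * ind (∃ t, f t = 1) + κ / 4 * lineZ K f ≤ lineE κ K f := by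
  have hz := lineE_ge_zeros (K := K) (f := f) h0
  have hz' : 0 ≤ κ * lineZ K f := mul_nonneg h0 lineZ_nonneg
  by_cases h : ∃ t, f t = 1
  · rw [ind_true h]
    obtain ⟨q, hq⟩ := h
    have hK := hf.supp q (by omega)
    have hr := two_mul_le_of_plus h0 h1 hf (a := q) ⟨q, le_rfl, hq⟩
    have hl := two_mul_le_of_plus h0 h1 hf.neg (a := -q) ⟨-q, le_rfl, by simpa using hq⟩
    rw [sum_bc_neg, neg_neg] at hl
    have : lineE κ K f = _ := sum_Ico_split (fun t => bc κ (f t) (f (t + 1))) hK.1.le hK.2.le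
    linarith
  · rw [ind_false h]; linarith

theorem sum_ite_le {S : Finset ℤ} {P : ℤ → Prop} [DecidablePred P] {φ : ℤ → ℝ} {a b : ℤ} (hab : a ≤ b)
    (hP : ∀ t, P t → a < t ∧ t ≤ b ∧ φ t ≤ ((b - a : ℤ) : ℝ)) :
    ∑ t ∈ S, (if P t then φ t else 0) ≤ ((b - a : ℤ) : ℝ) ^ 2 := by
  have hb : (0 : ℝ) ≤ ((b - a : ℤ) : ℝ) := by exact_mod_cast (by omega : 0 ≤ b - a)
  rw [← Finset.sum_filter]
  refine (Finset.sum_le_card_nsmul _ _ _ fun t ht => (hP t (Finset.mem_filter.1 ht).2).2.2).trans ?_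
  rw [nsmul_eq_mul, sq]
  refine mul_le_mul_of_nonneg_right ?_ hb
  have h1 : (S.filter P).card ≤ (Finset.Icc (a + 1) b).card :=
    Finset.card_le_card fun t ht => by
      have := hP t (Finset.mem_filter.1 ht).2
      rw [Finset.mem_Icc]; omega
  have h2 := card_Icc_cast (a := a + 1) (b := b) (by omega)
  have h3 : ((S.filter P).card : ℝ) ≤ ((Finset.Icc (a + 1) b).card : ℝ) := by exact_mod_cast h1
  rw [h2] at h3
  push_cast at h3 ⊢
  linarith

theorem FatPb.top_sum (h : FatPb κ η δ K J W n0 u O m M) (x : ℤ) :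
    η * ∑ y ∈ Finset.Ioo (-K) K, (if (x, y) ∈ J.set ∧ O.yHi < y then (J.F (x, y) : ℝ) else 0) ≤
      κ / 16 := by
  have h1 := sum_ite_le (S := Finset.Ioo (-K) K) (P := fun y => (x, y) ∈ J.set ∧ O.yHi < y)
    (φ := fun y => (J.F (x, y) : ℝ)) h.core.le.1.2 fun y hy => by
      have hF := LatOct.le_F.1 (le_refl (J.F (x, y)))
      have := hy.1
      rw [LatOct.mem_set] at this
      exact ⟨hy.2, by omega, by exact_mod_cast (by omega : J.F (x, y) ≤ J.yHi - O.yHi)⟩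
  have h2 := mul_le_mul_of_nonneg_left h1 h.pb.η0.le
  have h3 := h.top
  linarith

/-- The share of a column in the gain of bulk energy above the core. -/
noncomputable def upShare (J O : LatOct) (x y : ℤ) : ℝ :=
  if ((x, y) ∈ J.set ∧ (x, y) ∉ O.set) ∧ (O.yHi < y ∨ O.sHi < x + y ∨ x - y < O.mLo) then
    (if O.yHi < y then (J.F (x, y) : ℝ) else J.F (x, y) / 2) else 0

theorem FatPb.upShare_right (h : FatPb κ η δ K J W n0 u O m M) {x x' : ℤ}
    (hx' : (x', O.yHi) ∈ O.set) (h1 : x' ≤ x) (h2 : x ≤ O.xHi) :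
    η * ∑ y ∈ Finset.Ioo (-K) K, upShare J O x y ≤ 5 / 4 * κ := by
  have hT := h.top_sum x
  have hD := h.diag x
  obtain ⟨x4, y4, h4, e4⟩ := h.core.tight.xHi
  rw [LatOct.mem_set] at hx' h4
  have key : ∀ y, upShare J O x y ≤
      (if (x, y) ∈ J.set ∧ O.yHi < y then (J.F (x, y) : ℝ) else 0) + 1 / 2 *
      (if ((x, y) ∈ J.set ∧ (x, y) ∉ O.set) ∧ (O.xLo ≤ x ∧ x ≤ O.xHi) ∧
      (O.yLo ≤ y ∧ y ≤ O.yHi) ∧ O.sHi < x + y then (J.F (x, y) : ℝ) else 0) := fun y => by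
    by_cases hJ : (x, y) ∈ J.set
    swap
    · simp [upShare, hJ]
    have hF : (0 : ℝ) ≤ J.F (x, y) := by
      have := LatOct.mem_iff_F.1 hJ
      exact_mod_cast (by omega : 0 ≤ J.F (x, y))
    have c0 : (if O.yHi < y then (J.F (x, y) : ℝ) else J.F (x, y) / 2) ≤ J.F (x, y) := by
      split_ifs <;> linarith
    unfold upShare
    by_cases hy : O.yHi < y
    · have e : (x, y) ∈ J.set ∧ O.yHi < y := ⟨hJ, hy⟩
      simp only [if_pos e]
      split_ifs <;> linarith
    · have e : ¬ ((x, y) ∈ J.set ∧ O.yHi < y) := fun h => hy h.2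
      simp only [if_neg e, if_neg hy]
      by_cases c1 : ((x, y) ∈ J.set ∧ (x, y) ∉ O.set) ∧
          (O.yHi < y ∨ O.sHi < x + y ∨ x - y < O.mLo)
      · have c2 : ((x, y) ∈ J.set ∧ (x, y) ∉ O.set) ∧ (O.xLo ≤ x ∧ x ≤ O.xHi) ∧
            (O.yLo ≤ y ∧ y ≤ O.yHi) ∧ O.sHi < x + y := by
          refine ⟨c1.1, ?_, ?_, ?_⟩ <;> rcases c1.2 with c | c | c <;> simp only [e4] at h4 <;> omega
        simp only [if_pos c1, if_pos c2]
        linarith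
      · simp only [if_neg c1]
        split_ifs <;> linarith
  have hs := mul_le_mul_of_nonneg_left
    (Finset.sum_le_sum fun y (_ : y ∈ Finset.Ioo (-K) K) => key y) h.pb.η0.le
  rw [Finset.sum_add_distrib, ← Finset.mul_sum] at hs
  have := h.pb.δκ
  have := h.pb.κ0
  linarith

theorem FatPb.upShare_sum (h : FatPb κ η δ K J W n0 u O m M) {x : ℤ}
    (h1 : O.xLo ≤ x) (h2 : x ≤ O.xHi) :
    η * ∑ y ∈ Finset.Ioo (-K) K, upShare J O x y ≤ 5 / 4 * κ := by
  obtain ⟨x', y', h', rfl⟩ := h.core.tight.yHi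
  rcases le_total x' x with hx | hx
  · exact h.upShare_right h' hx h2
  · have := h.swap.flip.swap.upShare_right (x := -x) (x' := -x') (by
      simp only [LatOct.swap, LatOct.flip, LatOct.mem_set] at *; omega) (by omega)
      (by simp only [LatOct.swap, LatOct.flip]; omega)
    convert this using 2
    refine Finset.sum_congr rfl fun y _ => ?_
    unfold upShare
    simp only [LatOct.mem_swap, LatOct.mem_flip, LatOct.F_swap, LatOct.F_flip, neg_neg]
    have e : (O.yHi < y ∨ O.sHi < x + y ∨ x - y < O.mLo) ↔
        (O.swap.flip.swap.yHi < y ∨ O.swap.flip.swap.sHi < -x + y ∨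
          -x - y < O.swap.flip.swap.mLo) := by
      simp only [LatOct.swap, LatOct.flip]; omega
    simp only [e]
    rfl

/-- The share of a column in the gain of bulk energy. -/
noncomputable def share (J O : LatOct) (u : Pt → ℤ) (p : Pt) : ℝ :=
  if u p = 1 ∧ p ∉ O.set then (if p.2 < O.yLo ∨ O.yHi < p.2 then (J.F p : ℝ) else
    if O.xLo ≤ p.1 ∧ p.1 ≤ O.xHi then J.F p / 2 else 0) else 0

theorem LatOct.F_nonneg {J : LatOct} {p : Pt} (hp : p ∈ J.set) : (0 : ℝ) ≤ J.F p := by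
  have := LatOct.mem_iff_F.1 hp
  exact_mod_cast (by omega : 0 ≤ J.F p)

theorem FatPb.share_out (h : FatPb κ η δ K J W n0 u O m M) {x : ℤ}
    (hx : x < O.xLo ∨ O.xHi < x) :
    η * ∑ y ∈ Finset.Ioo (-K) K, share J O u (x, y) ≤ κ / 8 * ind (∃ y, u (x, y) = 1) := by
  by_cases hex : ∃ y, u (x, y) = 1
  swap
  · have e : ∀ y, share J O u (x, y) = 0 := fun y => if_neg fun hy => hex ⟨y, hy.1⟩
    simp [e, ind_false hex]
  rw [ind_true hex]
  have hT := h.top_sum x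
  have hB := h.flip.top_sum x
  rw [← sum_Ioo_neg] at hB
  simp only [LatOct.mem_flip, LatOct.F_flip, neg_neg] at hB
  have hs := mul_le_mul_of_nonneg_left (Finset.sum_le_sum
    (g := fun y => (if (x, y) ∈ J.set ∧ O.yHi < y then (J.F (x, y) : ℝ) else 0) +
      (if (x, y) ∈ J.set ∧ O.flip.yHi < -y then (J.F (x, y) : ℝ) else 0))
    fun y (_ : y ∈ Finset.Ioo (-K) K) => show share J O u (x, y) ≤ _ by
      by_cases hy : u (x, y) = 1 ∧ (x, y) ∉ O.set
      · have hJ := h.pb.sub _ hy.1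
        have hF := LatOct.F_nonneg hJ
        have e : O.flip.yHi < -y ↔ y < O.yLo := by simp only [LatOct.flip]; omega
        simp only [share, hy, hJ, e]
        split_ifs <;> first | linarith | (exfalso; omega) | (exfalso; simp only [true_and] at *; omega)
      · rw [share, if_neg hy]
        by_cases hJ : (x, y) ∈ J.set
        · have hF := LatOct.F_nonneg hJ
          split_ifs <;> linarith
        · simp [hJ]) h.pb.η0.le
  rw [Finset.sum_add_distrib] at hs
  linarith

end

section

variable {κ η δ : ℝ} {K : ℤ} {J O : LatOct} {W : Pt → ℝ} {n0 : ℝ} {u : Pt → ℤ} {m M : ℤ}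

theorem upShare_nonneg (J O : LatOct) (x y : ℤ) : 0 ≤ upShare J O x y := by
  unfold upShare
  split_ifs with h1 h2
  · exact LatOct.F_nonneg h1.1.1
  · have := LatOct.F_nonneg h1.1.1
    linarith
  · rfl

theorem OctCore.eq_cfg (h : OctCore u J O) {p : Pt} (hp : O.cfg p ≠ -1) : u p = O.cfg p := by
  obtain ⟨x, y⟩ := p
  rcases O.cfg_spin (x, y) with h1 | h1 | h1
  · exact absurd h1 hp
  · rw [h1]
    rw [LatOct.cfg_eq_zero] at h1
    exact h.zero x y h1.1 h1.2
  · rw [h1]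
    exact h.one _ (LatOct.cfg_eq_one.1 h1)

theorem FatPb.share_hit (h : FatPb κ η δ K J W n0 u O m M) {x b t : ℤ}
    (h1 : O.xLo ≤ x) (h2 : x ≤ O.xHi)
    (hb : b = Max.max (Max.max O.yLo (O.sLo - x)) (x - O.mHi))
    (ht : t = Min.min (Min.min O.yHi (O.sHi - x)) (x - O.mLo)) (hbt : b ≤ t)
    (hone : ∀ y, O.cfg (x, y) = 1 ↔ b ≤ y ∧ y ≤ t)
    (hzero : ∀ y, O.cfg (x, y) = 0 ↔ y = b - 1 ∨ y = t + 1) :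
    η * ∑ y ∈ Finset.Ioo (-K) K, share J O u (x, y) ≤
      5 / 4 * κ * (ind (∃ y, t + 1 < y ∧ u (x, y) = 1) + ind (∃ y, y < b - 1 ∧ u (x, y) = 1)) := by
  have hU := h.upShare_sum h1 h2
  have hD := h.flip.upShare_sum (x := x) h1 h2
  rw [← sum_Ioo_neg] at hD
  set i1 := ind (∃ y, t + 1 < y ∧ u (x, y) = 1) with hi1
  set i2 := ind (∃ y, y < b - 1 ∧ u (x, y) = 1) with hi2
  have p1 : 0 ≤ i1 := ind_nonneg _
  have p2 : 0 ≤ i2 := ind_nonneg _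
  have key : ∀ y, share J O u (x, y) ≤
      i1 * upShare J O x y + i2 * upShare J.flip O.flip x (-y) := fun y => by
    have q1 := mul_nonneg p1 (upShare_nonneg J O x y)
    have q2 := mul_nonneg p2 (upShare_nonneg J.flip O.flip x (-y))
    by_cases hy : u (x, y) = 1 ∧ (x, y) ∉ O.set
    swap
    · rw [share, if_neg hy]; linarith
    have hJ := h.pb.sub _ hy.1
    have n1 : ¬ (b ≤ y ∧ y ≤ t) := fun hc => hy.2 (LatOct.cfg_eq_one.1 ((hone y).2 hc))
    have n2 : ¬ (y = b - 1 ∨ y = t + 1) := fun hc => by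
      have e := (hzero y).2 hc
      have := h.core.eq_cfg (p := (x, y)) (by rw [e]; decide)
      omega
    rw [share, if_pos hy]
    rcases (by omega : t + 1 < y ∨ y < b - 1) with c | c
    · have e1 : i1 = 1 := ind_true ⟨y, c, hy.1⟩
      have e2 : upShare J O x y = if O.yHi < y then (J.F (x, y) : ℝ) else J.F (x, y) / 2 :=
        if_pos ⟨⟨hJ, hy.2⟩, by omega⟩
      have e3 : (y < O.yLo ∨ O.yHi < y) ↔ O.yHi < y := by omega
      simp only [e3, h1, h2, and_self, if_true]
      rw [e1, ← e2]
      linarith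
    · have e1 : i2 = 1 := ind_true ⟨y, c, hy.1⟩
      have e2 : upShare J.flip O.flip x (-y) =
          if O.flip.yHi < -y then (J.flip.F (x, -y) : ℝ) else J.flip.F (x, -y) / 2 :=
        if_pos (by
          simp only [LatOct.mem_flip, neg_neg]
          exact ⟨⟨hJ, hy.2⟩, by simp only [LatOct.flip]; omega⟩)
      rw [LatOct.F_flip, neg_neg] at e2
      have e3 : (y < O.yLo ∨ O.yHi < y) ↔ O.flip.yHi < -y := by simp only [LatOct.flip]; omega
      simp only [e3, h1, h2, and_self, if_true]
      rw [e1, ← e2]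
      linarith
  have hs := mul_le_mul_of_nonneg_left
    (Finset.sum_le_sum fun y (_ : y ∈ Finset.Ioo (-K) K) => key y) h.pb.η0.le
  rw [Finset.sum_add_distrib, ← Finset.mul_sum, ← Finset.mul_sum] at hs
  have a1 := mul_le_mul_of_nonneg_left hU p1
  have a2 := mul_le_mul_of_nonneg_left hD p2
  linarith

theorem ind_mono {P Q : Prop} (h : P → Q) : ind P ≤ ind Q := by
  by_cases hP : P
  · rw [ind_true hP, ind_true (h hP)]
  · rw [ind_false hP]; exact ind_nonneg _

theorem ind_or_le (P Q : Prop) : ind (P ∨ Q) ≤ ind P + ind Q := by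
  by_cases hP : P
  · rw [ind_true hP, ind_true (Or.inl hP)]
    linarith [ind_nonneg Q]
  · rw [ind_false hP]
    simp [hP]

/-- A column adjacent to the octagon or disjoint from it. -/
theorem FatPb.col_le_out (h : FatPb κ η δ K J W n0 u O m M) {x : ℤ}
    (hx : x < O.xLo ∨ O.xHi < x) :
    lineE κ K (fun y => O.cfg (x, y)) +
      κ / 4 * (lineZ K (fun y => u (x, y)) - lineZ K (fun y => O.cfg (x, y))) +
      η * ∑ y ∈ Finset.Ioo (-K) K, share J O u (x, y) +
      κ / 4 * ind (∃ y, u (x, y) = 1 ∧ (x, y) ∉ O.set) ≤ lineE κ K (fun y => u (x, y)) := by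
  have hs := h.share_out hx
  have hκ := h.pb.κ0
  have hκ1 : κ ≤ 1 := by linarith [h.pb.κ1]
  have hT := h.core.tight
  have hle := hT.le
  have hi : ind (∃ y, u (x, y) = 1 ∧ (x, y) ∉ O.set) ≤ ind (∃ y, u (x, y) = 1) :=
    ind_mono fun ⟨y, hy⟩ => ⟨y, hy.1⟩
  have hi0 := ind_nonneg (∃ y, u (x, y) = 1)
  have hi' := mul_le_mul_of_nonneg_left hi hκ.le
  have hi0' := mul_nonneg hκ.le hi0
  have key : ∀ a b : ℤ, a ≤ b → (∀ y, O.cfg (x, y) ≠ 1 ∧ (O.cfg (x, y) = 0 ↔ a ≤ y ∧ y ≤ b)) →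
      lineE κ K (fun y => O.cfg (x, y)) +
      κ / 4 * (lineZ K (fun y => u (x, y)) - lineZ K (fun y => O.cfg (x, y))) +
      η * ∑ y ∈ Finset.Ioo (-K) K, share J O u (x, y) +
      κ / 4 * ind (∃ y, u (x, y) = 1 ∧ (x, y) ∉ O.set) ≤ lineE κ K (fun y => u (x, y)) := by
    intro a b hab hg
    have hu : ∀ y, a ≤ y → y ≤ b → u (x, y) = O.cfg (x, y) := fun y h1 h2 =>
      h.core.eq_cfg (by rw [(hg y).2.2 ⟨h1, h2⟩]; decide)
    have hl := line_extra hκ.le hκ1 (h.pb.cfg.col x) (g := fun y => O.cfg (x, y)) hab hu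
      ((hg a).2.2 ⟨le_rfl, hab⟩) ((hg b).2.2 ⟨hab, le_rfl⟩) fun y hy => by
        rcases O.cfg_spin (x, y) with e | e | e
        · exact e
        · have := (hg y).2.1 e; omega
        · exact absurd e (hg y).1
    have hor := ind_or_le (∃ y, b < y ∧ u (x, y) = 1) (∃ y, y < a ∧ u (x, y) = 1)
    have himp : ind (∃ y, u (x, y) = 1) ≤
        ind ((∃ y, b < y ∧ u (x, y) = 1) ∨ ∃ y, y < a ∧ u (x, y) = 1) := ind_mono fun ⟨y, hy⟩ => by
      rcases lt_or_ge b y with c | c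
      · exact Or.inl ⟨y, c, hy⟩
      · refine Or.inr ⟨y, ?_, hy⟩
        by_contra hc
        have := hu y (by omega) c
        exact (hg y).1 (by rw [← this, hy])
    have := mul_le_mul_of_nonneg_left (himp.trans hor) hκ.le
    linarith
  by_cases c1 : x = O.xHi + 1
  · subst c1
    obtain ⟨a4, b4, h4, e4⟩ := hT.xHi
    rw [LatOct.mem_set] at h4
    exact key _ _ (by omega) hT.col_right
  by_cases c2 : x = O.xLo - 1
  · subst c2
    obtain ⟨a4, b4, h4, e4⟩ := hT.xLo
    rw [LatOct.mem_set] at h4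
    exact key _ _ (by omega) hT.col_left
  have hg : ∀ y, O.cfg (x, y) = -1 := fun y => O.col_out (by omega) y
  have hl := line_extra_empty hκ.le hκ1 (h.pb.cfg.col x)
  have e1 : lineE κ K (fun y => O.cfg (x, y)) = 0 := by simp [lineE, hg, bc_neg_neg]
  have e2 : lineZ K (fun y => O.cfg (x, y)) = 0 := by simp [lineZ, hg, zi_neg_one]
  rw [e1, e2]
  linarith

theorem FatPb.col_le (h : FatPb κ η δ K J W n0 u O m M) (x : ℤ) :
    lineE κ K (fun y => O.cfg (x, y)) +
      κ / 4 * (lineZ K (fun y => u (x, y)) - lineZ K (fun y => O.cfg (x, y))) +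
      η * ∑ y ∈ Finset.Ioo (-K) K, share J O u (x, y) +
      κ / 4 * ind (∃ y, u (x, y) = 1 ∧ (x, y) ∉ O.set) ≤ lineE κ K (fun y => u (x, y)) := by
  by_cases hx : x < O.xLo ∨ O.xHi < x
  · exact h.col_le_out hx
  have hκ := h.pb.κ0
  have hκ1 : κ ≤ 1 := by linarith [h.pb.κ1]
  have h1 : O.xLo ≤ x := by omega
  have h2 : x ≤ O.xHi := by omega
  obtain ⟨b, t, hbt, hb, ht, hone, hzero⟩ := h.core.tight.col h1 h2
  have hs := h.share_hit h1 h2 hb ht hbt hone hzero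
  have hu : ∀ y, b - 1 ≤ y → y ≤ t + 1 → u (x, y) = O.cfg (x, y) := fun y g1 g2 =>
    h.core.eq_cfg (by
      by_cases c : b ≤ y ∧ y ≤ t
      · rw [(hone y).2 c]; decide
      · rw [(hzero y).2 (by omega)]; decide)
  have hl := line_extra hκ.le hκ1 (h.pb.cfg.col x) (g := fun y => O.cfg (x, y))
    (show b - 1 ≤ t + 1 by omega) hu ((hzero _).2 (Or.inl rfl)) ((hzero _).2 (Or.inr rfl))
    fun y hy => by
      rcases O.cfg_spin (x, y) with e | e | e
      · exact e
      · have := (hzero y).1 e; omega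
      · have := (hone y).1 e; omega
  have hor := ind_or_le (∃ y, t + 1 < y ∧ u (x, y) = 1) (∃ y, y < b - 1 ∧ u (x, y) = 1)
  have himp : ind (∃ y, u (x, y) = 1 ∧ (x, y) ∉ O.set) ≤
      ind ((∃ y, t + 1 < y ∧ u (x, y) = 1) ∨ ∃ y, y < b - 1 ∧ u (x, y) = 1) :=
    ind_mono fun ⟨y, hy⟩ => by
      by_cases c : b - 1 ≤ y ∧ y ≤ t + 1
      · exact absurd (LatOct.cfg_eq_one.1 ((hu y c.1 c.2).symm.trans hy.1)) hy.2
      · rcases (by omega : t + 1 < y ∨ y < b - 1) with c | c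
        · exact Or.inl ⟨y, c, hy.1⟩
        · exact Or.inr ⟨y, c, hy.1⟩
  have := mul_le_mul_of_nonneg_left (himp.trans hor) hκ.le
  linarith

theorem FatPb.share_add (h : FatPb κ η δ K J W n0 u O m M) (x y : ℤ) :
    (if u (x, y) = 1 ∧ (x, y) ∉ O.set then (J.F (x, y) : ℝ) else 0) ≤
      share J O u (x, y) + share J.swap O.swap (fun p => u (p.2, p.1)) (y, x) := by
  unfold share
  simp only [LatOct.mem_swap, LatOct.F_swap]
  by_cases hy : u (x, y) = 1 ∧ (x, y) ∉ O.set
  · have hF := LatOct.F_nonneg (h.pb.sub _ hy.1)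
    simp only [if_pos hy, LatOct.swap]
    by_cases c1 : y < O.yLo ∨ O.yHi < y <;> by_cases c2 : x < O.xLo ∨ O.xHi < x <;>
      by_cases c3 : O.xLo ≤ x ∧ x ≤ O.xHi <;> by_cases c4 : O.yLo ≤ y ∧ y ≤ O.yHi <;>
      first
      | (exfalso; omega)
      | (simp only [c1, c2, c3, c4, if_true, if_false, and_self]; linarith)
  · simp only [if_neg hy]; norm_num

/-- A minimizer with a fat octagonal core has no points outside it. -/
theorem FatPb.eq_cfg (h : FatPb κ η δ K J W n0 u O m M) : u = O.cfg := by
  have hκ := h.pb.κ0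
  have hη := h.pb.η0
  have hI := h.core.le.inWin h.pb.inWin
  have hw := LatOct.gridCfg hI
  have hc := Finset.sum_le_sum fun x (_ : x ∈ Finset.Ioo (-K) K) => h.col_le x
  have hr := Finset.sum_le_sum fun x (_ : x ∈ Finset.Ioo (-K) K) => h.swap.col_le x
  simp only [LatOct.cfg_swap] at hr
  simp only [Finset.sum_add_distrib, ← Finset.mul_sum, Finset.sum_sub_distrib] at hc hr
  have z1 := h.pb.cfg.gridZ_col
  have z2 := h.pb.cfg.gridZ_row
  have z3 := hw.gridZ_col
  have z4 := hw.gridZ_row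
  rw [← z1, ← z3] at hc
  rw [← z2, ← z4] at hr
  have hpos : ∀ x, 0 ≤ ind (∃ y, u (x, y) = 1 ∧ (x, y) ∉ O.set) := fun x => ind_nonneg _
  have hi1 := Finset.sum_nonneg fun x (_ : x ∈ Finset.Ioo (-K) K) => hpos x
  have hi2 : 0 ≤ ∑ x ∈ Finset.Ioo (-K) K,
      ind (∃ y, u (y, x) = 1 ∧ (x, y) ∉ O.swap.set) := Finset.sum_nonneg fun _ _ => ind_nonneg _
  have hmin := h.pb.min O.cfg hw
  have hF : ∑ p ∈ win K, dw W J.set O.cfg p ≤ ∑ p ∈ win K, dw W J.set u p +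
      ∑ p ∈ win K, (if u p = 1 ∧ p ∉ O.set then (J.F p : ℝ) else 0) := by
    rw [← Finset.sum_add_distrib]
    refine Finset.sum_le_sum fun p _ => ?_
    have g1 := h.core.one p
    have g2 := h.pb.sub p
    have g3 := h.core.le.sub p
    have g4 := h.pb.WF p
    have g5 := h.pb.W1 p
    simp only [dw, LatOct.cfg_eq_one']
    by_cases c1 : p ∈ O.set
    · have c2 := g1 c1
      have c3 := g3 c1
      simp [c1, c2, c3]
    · by_cases c2 : u p = 1
      · simp [c1, c2, g2 c2, g4 (g2 c2)]
      · simp [c1, c2]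
  have hshare : ∑ p ∈ win K, (if u p = 1 ∧ p ∉ O.set then (J.F p : ℝ) else 0) ≤
      ∑ x ∈ Finset.Ioo (-K) K, ∑ y ∈ Finset.Ioo (-K) K, share J O u (x, y) +
      ∑ x ∈ Finset.Ioo (-K) K, ∑ y ∈ Finset.Ioo (-K) K,
        share J.swap O.swap (fun p => u (p.2, p.1)) (x, y) := by
    rw [Finset.sum_comm (f := fun x y => share J.swap O.swap (fun p => u (p.2, p.1)) (x, y)),
      ← Finset.sum_add_distrib, win, Finset.sum_product]
    refine Finset.sum_le_sum fun x _ => ?_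
    rw [← Finset.sum_add_distrib]
    exact Finset.sum_le_sum fun y _ => h.share_add x y
  have hF' := mul_le_mul_of_nonneg_left (hF.trans (add_le_add_right hshare _)) hη.le
  have hz : ∀ p, zi (O.cfg p) ≤ zi (u p) := fun p => by
    by_cases c : O.cfg p = -1
    · rw [c, zi_neg_one]; exact zi_nonneg _
    · rw [h.core.eq_cfg c]
  have hZ : gridZ K O.cfg ≤ gridZ K u := Finset.sum_le_sum fun p _ => hz p
  have habs : |gridZ K O.cfg - n0| ≤ gridZ K u - gridZ K O.cfg + |gridZ K u - n0| := by
    have := abs_add_le (gridZ K O.cfg - gridZ K u) (gridZ K u - n0)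
    rw [sub_add_sub_cancel, abs_of_nonpos (sub_nonpos.2 hZ)] at this
    linarith
  have habs' := mul_le_mul_of_nonneg_left habs h.pb.δ0
  have hδ := mul_le_mul_of_nonneg_right h.pb.δκ (sub_nonneg.2 hZ)
  unfold gridE at hmin
  have hκZ := mul_nonneg hκ.le (sub_nonneg.2 hZ)
  have hκ1 := mul_nonneg hκ.le hi1
  have hκ2 := mul_nonneg hκ.le hi2
  have f1 : κ * (gridZ K u - gridZ K O.cfg) = 0 := by linarith
  have f2 : κ * ∑ x ∈ Finset.Ioo (-K) K, ind (∃ y, u (x, y) = 1 ∧ (x, y) ∉ O.set) = 0 := by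
    linarith
  have f1' : gridZ K u - gridZ K O.cfg = 0 := (mul_eq_zero.1 f1).resolve_left hκ.ne'
  have f2' := (mul_eq_zero.1 f2).resolve_left hκ.ne'
  rw [Finset.sum_eq_zero_iff_of_nonneg fun x _ => hpos x] at f2'
  have hone : ∀ p, u p = 1 → p ∈ O.set := by
    rintro ⟨x, y⟩ hp
    by_contra hc
    have hx := h.pb.cfg.mem_win (p := (x, y)) (by omega)
    rw [mem_win] at hx
    have := f2' x (Finset.mem_Ioo.2 hx.1)
    rw [ind_true ⟨y, hp, hc⟩] at this
    exact one_ne_zero this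
  have hzero : ∀ p ∈ win K, zi (u p) - zi (O.cfg p) = 0 := by
    rw [← Finset.sum_eq_zero_iff_of_nonneg fun p _ => sub_nonneg.2 (hz p),
      Finset.sum_sub_distrib]
    exact f1'
  funext p
  by_cases c : O.cfg p = -1
  swap
  · exact h.core.eq_cfg c
  rw [c]
  rcases h.pb.cfg.spin p with e | e | e
  · exact e
  · have := hzero p (h.pb.cfg.mem_win (by omega))
    rw [e, c, zi_zero, zi_neg_one] at this
    norm_num at this
  · have := LatOct.cfg_eq_one'.2 (hone p e)
    omega

end

section

variable {ε k ζ γ : ℝ} {K : ℤ} {J O : LatOct} {I : Set Pt}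

theorem distTo_le {p q : Pt} {S : Set Pt} (hq : q ∈ S) : distTo p S ≤ (d1 p q : ℕ) :=
  iInf₂_le q hq

theorem one_le_d1 {p q : Pt} (h : p ≠ q) : 1 ≤ d1 p q := by
  by_contra hc
  refine h (Prod.ext ?_ ?_) <;> unfold d1 at hc <;> omega

theorem one_le_distTo {p : Pt} {S : Set Pt} (hp : p ∉ S) : 1 ≤ distTo p S :=
  le_iInf₂ fun q hq => by exact_mod_cast one_le_d1 fun h : p = q => hp (h ▸ hq)

theorem one_le_dB (p : Pt) (I : Set Pt) : 1 ≤ dB p I := by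
  unfold dB
  split_ifs with h
  · exact one_le_distTo fun hc => hc h
  · exact one_le_distTo h

theorem dB_ne_top {p : Pt} (h1 : I.Nonempty) (h2 : Iᶜ.Nonempty) : dB p I ≠ ⊤ := by
  obtain ⟨a, ha⟩ := h1
  obtain ⟨b, hb⟩ := h2
  unfold dB
  split_ifs
  · exact ((distTo_le hb).trans_lt (ENNReal.natCast_lt_top _)).ne
  · exact ((distTo_le ha).trans_lt (ENNReal.natCast_lt_top _)).ne

theorem LatOct.F_le_add (J : LatOct) (x y x' y' : ℤ) :
    J.F (x, y) ≤ J.F (x', y') + d1 (x, y) (x', y') := by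
  have h1 := LatOct.le_F.1 (le_refl (J.F (x, y)))
  rw [← sub_le_iff_le_add, LatOct.le_F]
  unfold d1
  dsimp only
  omega

theorem LatOct.exists_exit (J : LatOct) {x y : ℤ} (h : (x, y) ∈ J.set) :
    ∃ q ∉ J.set, (d1 (x, y) q : ℤ) = J.F (x, y) := by
  have h1 := LatOct.mem_iff_F.1 h
  have h2 := LatOct.le_F.1 (le_refl (J.F (x, y)))
  have h3 : ¬ J.F (x, y) + 1 ≤ J.F (x, y) := by omega
  rw [LatOct.le_F] at h3
  generalize J.F (x, y) = f at *
  have key : ∀ x' y', (x', y') ∉ J.set → (d1 (x, y) (x', y') : ℤ) = f →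
    ∃ q ∉ J.set, (d1 (x, y) q : ℤ) = f := fun x' y' h h' => ⟨_, h, h'⟩
  by_cases c1 : y - J.yLo + 1 ≤ f ∨ x + y - J.sLo + 1 ≤ f ∨ J.mHi - (x - y) + 1 ≤ f
  · exact key x (y - f) (by rw [LatOct.mem_set]; omega) (by unfold d1; dsimp only; omega)
  by_cases c2 : J.yHi - y + 1 ≤ f ∨ J.sHi - (x + y) + 1 ≤ f ∨ x - y - J.mLo + 1 ≤ f
  · exact key x (y + f) (by rw [LatOct.mem_set]; omega) (by unfold d1; dsimp only; omega)
  by_cases c3 : x - J.xLo + 1 ≤ f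
  · exact key (x - f) y (by rw [LatOct.mem_set]; omega) (by unfold d1; dsimp only; omega)
  · exact key (x + f) y (by rw [LatOct.mem_set]; omega) (by unfold d1; dsimp only; omega)

theorem LatOct.dB_eq (J : LatOct) {p : Pt} (h : p ∈ J.set) : (dB p J.set).toReal = J.F p := by
  obtain ⟨x, y⟩ := p
  have h1 := LatOct.mem_iff_F.1 h
  have e : dB (x, y) J.set = ((J.F (x, y)).toNat : ℕ) := by
    rw [dB, if_pos h]
    refine le_antisymm ?_ (le_iInf₂ fun q hq => ?_)
    · obtain ⟨q, hq, hd⟩ := J.exists_exit h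
      refine (distTo_le hq).trans ?_
      exact_mod_cast (by omega : d1 (x, y) q ≤ (J.F (x, y)).toNat)
    · obtain ⟨x', y'⟩ := q
      have h2 := J.F_le_add x y x' y'
      have h3 : ¬ 1 ≤ J.F (x', y') := fun hc => hq (LatOct.mem_iff_F.2 hc)
      exact_mod_cast (by omega : (J.F (x, y)).toNat ≤ d1 (x, y) (x', y'))
  rw [e, ENNReal.toReal_natCast]
  have : (((J.F (x, y)).toNat : ℤ) : ℝ) = (J.F (x, y) : ℝ) := by
    rw [Int.toNat_of_nonneg (by omega)]
  exact_mod_cast this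

theorem mem_bdryOut {x y : ℤ} : (x, y) ∈ bdryOut I ↔ (x, y) ∉ I ∧ Adj I x y := by
  refine and_congr_right fun h => ?_
  rw [dB, if_neg h]
  constructor
  · intro h1
    have h2 : distTo (x, y) I < 2 := by rw [h1]; norm_num
    simp only [distTo, iInf_lt_iff] at h2
    obtain ⟨⟨a, b⟩, hq, hd⟩ := h2
    have h3 : d1 (x, y) (a, b) < 2 := by exact_mod_cast hd
    have h4 := one_le_d1 (p := (x, y)) (q := (a, b)) fun hc => h (hc ▸ hq)
    unfold d1 at h3 h4
    dsimp only at h3 h4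
    have : (a = x + 1 ∧ b = y) ∨ (a = x - 1 ∧ b = y) ∨ (a = x ∧ b = y + 1) ∨ a = x ∧ b = y - 1 := by
      omega
    rcases this with ⟨rfl, rfl⟩ | ⟨rfl, rfl⟩ | ⟨rfl, rfl⟩ | ⟨rfl, rfl⟩
    exacts [Or.inl hq, Or.inr (Or.inl hq), Or.inr (Or.inr (Or.inl hq)), Or.inr (Or.inr (Or.inr hq))]
  · intro h1
    refine le_antisymm ?_ (one_le_distTo h)
    rcases h1 with h1 | h1 | h1 | h1 <;> refine (distTo_le h1).trans ?_ <;> simp [d1]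

theorem LatOct.isDiscreteOctagon (O : LatOct) (h : O.set.Nonempty) : IsDiscreteOctagon O.set := by
  refine ⟨⟨O.yLo, O.yHi, O.xLo, O.xHi, O.sLo, O.sHi, O.mLo, O.mHi⟩, ?_, ?_⟩
  · obtain ⟨⟨x, y⟩, hp⟩ := h
    rw [LatOct.mem_set] at hp
    refine ⟨((x : ℝ), (y : ℝ)), ?_⟩
    simp only [Oct.region, Set.mem_ofPred_eq]
    norm_cast
    omega
  · ext ⟨x, y⟩
    rw [LatOct.mem_set]
    simp only [Oct.region, Set.mem_ofPred_eq]
    norm_cast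
    omega

theorem exists_latOct (h : IsDiscreteOctagon I) (hf : I.Finite) (hne : I.Nonempty) :
    ∃ J : LatOct, J.Tight ∧ I = J.set := by
  obtain ⟨P, -, hP⟩ := h
  obtain ⟨J, hJ⟩ := exists_isHull hf hne
  refine ⟨J, hJ.tight, Set.Subset.antisymm (fun p hp => hJ.sub p.1 p.2 hp) ?_⟩
  rintro ⟨x, y⟩ hp
  obtain ⟨-, ⟨a1, b1, h1, e1⟩, ⟨a2, b2, h2, e2⟩, ⟨a3, b3, h3, e3⟩, ⟨a4, b4, h4, e4⟩,
    ⟨a5, b5, h5, e5⟩, ⟨a6, b6, h6, e6⟩, ⟨a7, b7, h7, e7⟩, ⟨a8, b8, h8, e8⟩⟩ := hJ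
  rw [LatOct.mem_set, ← e1, ← e2, ← e3, ← e4, ← e5, ← e6, ← e7, ← e8] at hp
  obtain ⟨⟨g1, g2⟩, ⟨g3, g4⟩, ⟨g5, g6⟩, g7, g8⟩ := hp
  have r1 : (b1 : ℝ) ≤ y := by exact_mod_cast g1
  have r2 : (y : ℝ) ≤ b2 := by exact_mod_cast g2
  have r3 : (a3 : ℝ) ≤ x := by exact_mod_cast g3
  have r4 : (x : ℝ) ≤ a4 := by exact_mod_cast g4
  have r5 : (a5 + b5 : ℝ) ≤ x + y := by exact_mod_cast g5
  have r6 : (x + y : ℝ) ≤ a6 + b6 := by exact_mod_cast g6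
  have r7 : (a7 - b7 : ℝ) ≤ x - y := by exact_mod_cast g7
  have r8 : (x - y : ℝ) ≤ a8 - b8 := by exact_mod_cast g8
  subst hP
  simp only [Oct.region, Set.mem_ofPred_eq] at *
  refine ⟨?_, ?_, ?_, ?_, ?_, ?_, ?_, ?_⟩ <;> linarith

theorem bond_eq {a b : ℤ} (ha : IsSpin a) (hb : IsSpin b) :
    bond ε k a b = ENNReal.ofReal (ε * bc (1 - k) a b) := by
  unfold bond
  congr 2
  rcases ha with rfl | rfl | rfl <;> rcases hb with rfl | rfl | rfl <;> norm_num [bc]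

theorem energy_eq (hε : 0 < ε) (hk : k < 1) {u : Config} (hu : GridCfg K u.val) :
    energy ε k u = ENNReal.ofReal (ε * gridE (1 - k) K u.val) := by
  have hbc : ∀ a b, 0 ≤ ε * bc (1 - k) a b := fun a b =>
    mul_nonneg hε.le (bc_nonneg (by linarith) a b)
  have hneg : ∀ p, p ∉ win K → u.val p = -1 := fun p hp => by
    by_contra hc
    exact hp (hu.mem_win hc)
  have h1 : ∑' p : Pt, bond ε k (u.val p) (u.val (p + (1, 0))) = ENNReal.ofReal
      (ε * ∑ y ∈ Finset.Ioo (-K) K, lineE (1 - k) K (fun x => u.val (x, y))) := by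
    simp_rw [bond_eq (hu.spin _) (hu.spin _)]
    rw [tsum_eq_sum (s := Finset.Ico (-K) K ×ˢ Finset.Ioo (-K) K),
      ← ENNReal.ofReal_sum_of_nonneg fun _ _ => hbc _ _, Finset.sum_product_right, Finset.mul_sum]
    · simp [lineE, Finset.mul_sum]
    · rintro ⟨x, y⟩ hp
      rw [hneg, hneg, bc_neg_neg, mul_zero, ENNReal.ofReal_zero] <;>
      · rw [mem_win]
        simp only [Finset.mem_product, Finset.mem_Ico, Finset.mem_Ioo, Prod.mk_add_mk] at *
        omega
  have h2 : ∑' p : Pt, bond ε k (u.val p) (u.val (p + (0, 1))) = ENNReal.ofReal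
      (ε * ∑ x ∈ Finset.Ioo (-K) K, lineE (1 - k) K (fun y => u.val (x, y))) := by
    simp_rw [bond_eq (hu.spin _) (hu.spin _)]
    rw [tsum_eq_sum (s := Finset.Ioo (-K) K ×ˢ Finset.Ico (-K) K),
      ← ENNReal.ofReal_sum_of_nonneg fun _ _ => hbc _ _, Finset.sum_product, Finset.mul_sum]
    · simp [lineE, Finset.mul_sum]
    · rintro ⟨x, y⟩ hp
      rw [hneg, hneg, bc_neg_neg, mul_zero, ENNReal.ofReal_zero] <;>
      · rw [mem_win]
        simp only [Finset.mem_product, Finset.mem_Ico, Finset.mem_Ioo, Prod.mk_add_mk] at *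
        omega
  have hl : ∀ f : ℤ → ℤ → ℤ, 0 ≤ ε * ∑ y ∈ Finset.Ioo (-K) K, lineE (1 - k) K (f y) := fun f =>
    mul_nonneg hε.le (Finset.sum_nonneg fun _ _ => Finset.sum_nonneg fun _ _ =>
      bc_nonneg (by linarith) _ _)
  rw [energy, ENNReal.tsum_add, h1, h2, ← ENNReal.ofReal_add (hl _) (hl _)]
  unfold gridE
  ring_nf

theorem dw_nonneg {W : Pt → ℝ} (hW : ∀ p, 0 ≤ W p) (S : Set Pt) (u : Pt → ℤ) (p : Pt) :
    0 ≤ dw W S u p := by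
  unfold dw; split_ifs
  exacts [le_rfl, hW p]

theorem diss1_eq (hε : 0 < ε) {u : Config} (hu : GridCfg K u.val) (hI : ∀ p ∈ I, p ∈ win K)
    (h1 : I.Nonempty) (h2 : Iᶜ.Nonempty) : diss1 ε (Iset u) I =
      ENNReal.ofReal (ε ^ 3 * ∑ p ∈ win K, dw (fun p => (dB p I).toReal) I u.val p) := by
  have h0 : ∀ p, 0 ≤ ε ^ 3 * dw (fun p => (dB p I).toReal) I u.val p := fun p =>
    mul_nonneg (by positivity) (dw_nonneg (fun _ => ENNReal.toReal_nonneg) _ _ _)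
  have key : ∀ p, (if p ∈ Iset u ∆ I then ENNReal.ofReal (ε ^ 3) * dB p I else 0) =
      ENNReal.ofReal (ε ^ 3 * dw (fun p => (dB p I).toReal) I u.val p) := fun p => by
    have e : p ∈ Iset u ∆ I ↔ ¬ (u.val p = 1 ↔ p ∈ I) := by
      rw [Set.mem_symmDiff]
      simp only [Iset, Set.mem_ofPred_eq]
      tauto
    unfold dw
    by_cases h : u.val p = 1 ↔ p ∈ I
    · rw [if_neg (by rw [e]; exact not_not.2 h), if_pos h, mul_zero, ENNReal.ofReal_zero]
    · rw [if_pos (e.2 h), if_neg h, ENNReal.ofReal_mul (by positivity),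
        ENNReal.ofReal_toReal (dB_ne_top h1 h2)]
  unfold diss1
  simp_rw [key]
  rw [tsum_eq_sum (s := win K), ← ENNReal.ofReal_sum_of_nonneg fun _ _ => h0 _, Finset.mul_sum]
  intro p hp
  have a1 : p ∉ I := fun h => hp (hI p h)
  have a2 : u.val p ≠ 1 := fun h => hp (hu.mem_win (by rw [h]; decide))
  rw [dw, if_pos (by tauto), mul_zero, ENNReal.ofReal_zero]

theorem ncard_Zset {u : Config} (hu : GridCfg K u.val) :
    ((Zset u).ncard : ℝ) = gridZ K u.val := by
  have e : Zset u = ((win K).filter fun p => u.val p = 0 : Finset Pt) := by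
    ext p
    simp only [Zset, Set.mem_ofPred_eq, Finset.coe_filter]
    exact ⟨fun h => ⟨hu.mem_win (by rw [h]; decide), h⟩, fun h => h.2⟩
  rw [e, Set.ncard_coe_finset, gridZ, Finset.card_filter]
  push_cast
  rfl

theorem totalF_eq (hε : 0 < ε) (hζ : 0 < ζ) (hk : k < 1) {u w : Config} (hu : GridCfg K u.val)
    (hI : ∀ p ∈ Iset w, p ∈ win K) (h1 : (Iset w).Nonempty) (h2 : (Iset w)ᶜ.Nonempty) :
    totalF ε k ζ γ u w = ENNReal.ofReal (ε * (gridE (1 - k) K u.val +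
      ε / ζ * ∑ p ∈ win K, dw (fun p => (dB p (Iset w)).toReal) (Iset w) u.val p +
      ε ^ (γ - 2) / ζ * |gridZ K u.val - (Zset w).ncard|)) := by
  have hE : 0 ≤ gridE (1 - k) K u.val := add_nonneg
    (Finset.sum_nonneg fun _ _ => Finset.sum_nonneg fun _ _ => bc_nonneg (by linarith) _ _)
    (Finset.sum_nonneg fun _ _ => Finset.sum_nonneg fun _ _ => bc_nonneg (by linarith) _ _)
  have hD : 0 ≤ ∑ p ∈ win K, dw (fun p => (dB p (Iset w)).toReal) (Iset w) u.val p :=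
    Finset.sum_nonneg fun _ _ => dw_nonneg (fun _ => ENNReal.toReal_nonneg) _ _ _
  have hZ : diss0 (Zset u) (Zset w) = ENNReal.ofReal |gridZ K u.val - (Zset w).ncard| := by
    rw [diss0, ← ncard_Zset hu, ← ENNReal.ofReal_natCast]
    congr 1
    rcases le_total (Zset u).ncard (Zset w).ncard with h | h
    · have : ((Zset u).ncard : ℝ) ≤ (Zset w).ncard := by exact_mod_cast h
      rw [Nat.dist_eq_sub_of_le h, Nat.cast_sub h, abs_of_nonpos (by linarith)]
      ring
    · have : ((Zset w).ncard : ℝ) ≤ (Zset u).ncard := by exact_mod_cast h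
      rw [Nat.dist_eq_sub_of_le_right h, Nat.cast_sub h, abs_of_nonneg (by linarith)]
  have hp : 0 < ε ^ γ := Real.rpow_pos_of_pos hε _
  have hg : ε ^ (γ - 2) = ε ^ γ / ε ^ 2 := by
    rw [Real.rpow_sub hε, Real.rpow_ofNat]
  rw [totalF, energy_eq hε hk hu, diss1_eq hε hu hI h1 h2, hZ, ← ENNReal.ofReal_mul hp.le,
    ← ENNReal.ofReal_add (by positivity) (by positivity),
    ← ENNReal.ofReal_inv_of_pos (by positivity), ← ENNReal.ofReal_mul (by positivity),
    ← ENNReal.ofReal_add (by positivity) (by positivity), hg]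
  congr 1
  field_simp
  ring

theorem exists_window {S : Set Pt} (hS : S.Finite) :
    ∃ K₀ : ℤ, ∀ K, K₀ ≤ K → ∀ p ∈ S, (-K < p.1 ∧ p.1 < K) ∧ (-K < p.2 ∧ p.2 < K) := by
  obtain ⟨B, hB⟩ := (hS.image fun p : Pt => |p.1| + |p.2| + 1).bddAbove
  refine ⟨B, fun K hK p hp => ?_⟩
  have h1 := hB (Set.mem_image_of_mem _ hp)
  have := le_abs_self p.1
  have := neg_abs_le p.1
  have := le_abs_self p.2
  have := neg_abs_le p.2
  have h2 : |p.1| + |p.2| + 1 ≤ B := h1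
  have := abs_nonneg p.1
  have := abs_nonneg p.2
  refine ⟨⟨?_, ?_⟩, ?_, ?_⟩ <;> linarith

theorem gridCfg_of_finite {u : Config} (h : (Iset u).Finite) :
    ∃ K₀ : ℤ, ∀ K, K₀ ≤ K → GridCfg K u.val := by
  obtain ⟨K₀, hK⟩ := exists_window (h.union u.finiteZero)
  refine ⟨K₀, fun K hle => ⟨u.val_mem, fun p hp => hK K hle p ?_⟩⟩
  rcases u.val_mem p with e | e | e
  exacts [absurd e hp, Or.inr e, Or.inl e]

theorem Iset_finite (hε : 0 < ε) {u w : Config} (hw : (Iset w).Finite)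
    (hu : totalF ε k ζ γ u w ≠ ⊤) : (Iset u).Finite := by
  have h1 : diss1 ε (Iset u) (Iset w) ≠ ⊤ := fun h => hu (by
    rw [totalF, h, top_add, ENNReal.mul_top, add_top]
    exact ENNReal.inv_ne_zero.2 ENNReal.ofReal_ne_top)
  have h2 := ENNReal.finite_const_le_of_tsum_ne_top h1
    (ENNReal.ofReal_pos.2 (by positivity : 0 < ε ^ 3)).ne'
  refine (h2.union hw).subset fun p hp => ?_
  by_cases h : p ∈ Iset w
  · exact Or.inr h
  · left
    have hm : p ∈ Iset u ∆ Iset w := Or.inl ⟨hp, h⟩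
    rw [Set.mem_ofPred_eq, if_pos hm]
    exact le_mul_of_one_le_right' (one_le_dB _ _)

/-- Reduction to a finite window. -/
theorem exists_minPb (hε : 0 < ε) (hζ : 0 < ζ) (hk₁ : 1 / 3 < k) (hk₂ : k < 1) {u w : Config}
    (hJ : J.Tight) (hI : Iset w = J.set) (hw : (Iset w).Finite) (hmin : Minimizes ε k ζ γ u w)
    (hδκ : ε ^ (γ - 2) / ζ ≤ (1 - k) / 4) (hδq : ε ^ (γ - 2) / ζ < 2 - 3 * (1 - k))
    (hδ1 : ε ^ (γ - 2) / ζ ≤ 1) :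
    ∃ K W n0, MinPb (1 - k) (ε / ζ) (ε ^ (γ - 2) / ζ) K J W n0 u.val := by
  have hne : (Iset w).Nonempty := by
    obtain ⟨x, y, h, -⟩ := hJ.yHi
    exact ⟨(x, y), hI ▸ h⟩
  have hne' : (Iset w)ᶜ.Nonempty := hw.infinite_compl.nonempty
  obtain ⟨K₁, h1⟩ := gridCfg_of_finite hw
  have hmw : ∀ {K}, GridCfg K w.val → ∀ p ∈ Iset w, p ∈ win K := fun h p hp =>
    h.mem_win (by rw [show w.val p = 1 from hp]; decide)
  have hfin : (Iset u).Finite := by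
    refine Iset_finite hε hw (ne_top_of_le_ne_top ?_ (hmin w))
    rw [totalF_eq hε hζ hk₂ (h1 K₁ le_rfl) (hmw (h1 K₁ le_rfl)) hne hne']
    exact ENNReal.ofReal_ne_top
  obtain ⟨K₂, h2⟩ := gridCfg_of_finite hfin
  set K := max (max K₁ K₂) (|J.xLo| + |J.xHi| + |J.yLo| + |J.yHi| + 2) with hK
  have g1 := h1 K (by omega)
  have g2 := h2 K (by omega)
  refine ⟨K, fun p => (dB p (Iset w)).toReal, (Zset w).ncard, ⟨by linarith, by linarith,
    by positivity, by positivity, hδκ, hδq, hδ1, g2, hJ, ?_, fun p => ?_, fun p hp => ?_,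
    fun v hv => ?_⟩⟩
  · have h : |J.xLo| + |J.xHi| + |J.yLo| + |J.yHi| + 2 ≤ K := le_max_right _ _
    have := le_abs_self J.xHi
    have := neg_abs_le J.xLo
    have := le_abs_self J.yHi
    have := neg_abs_le J.yLo
    have := abs_nonneg J.xHi
    have := abs_nonneg J.xLo
    have := abs_nonneg J.yHi
    have := abs_nonneg J.yLo
    unfold LatOct.In
    omega
  · have := ENNReal.toReal_mono (dB_ne_top hne hne') (one_le_dB p (Iset w))
    simpa using this
  · rw [hI]; exact J.dB_eq hp
  · let v' : Config := ⟨v, hv.spin, (win K).finite_toSet.subset fun p (hp : v p = 0) =>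
      hv.mem_win (by rw [hp]; decide)⟩
    have h := hmin v'
    rw [totalF_eq hε hζ hk₂ g2 (hmw g1) hne hne', totalF_eq (K := K) hε hζ hk₂ hv (hmw g1) hne hne',
      hI, ENNReal.ofReal_le_ofReal_iff'] at h
    simp only [hI]
    rcases h with h | h
    · exact le_of_mul_le_mul_left h hε
    · have h' := le_of_mul_le_mul_left (h.trans_eq (mul_zero ε).symm) hε
      refine h'.trans ?_
      have hE : 0 ≤ gridE (1 - k) K v := add_nonneg
        (Finset.sum_nonneg fun _ _ => Finset.sum_nonneg fun _ _ => bc_nonneg (by linarith) _ _)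
        (Finset.sum_nonneg fun _ _ => Finset.sum_nonneg fun _ _ => bc_nonneg (by linarith) _ _)
      have hD : 0 ≤ ∑ p ∈ win K, dw (fun p => (dB p J.set).toReal) J.set v p :=
        Finset.sum_nonneg fun _ _ => dw_nonneg (fun _ => ENNReal.toReal_nonneg) _ _ _
      positivity

end

section

variable {J : LatOct} {M m : ℤ} {ε : ℝ}

theorem LatOct.Flats.center (h : J.Flats M) (hm : 1 ≤ m) (hM : 20 * m ≤ M) :
    m ≤ J.F ((J.xLo + J.xHi) / 2, (J.yLo + J.yHi) / 2) ∧
      m ≤ J.F ((J.xLo + J.xHi) / 2 + 1, (J.yLo + J.yHi) / 2) := by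
  obtain ⟨⟨⟨a1, b1, h1⟩, a2, b2, h2⟩, ⟨a3, b3, h3⟩, a4, b4, h4⟩ := h
  simp only [LatOct.flip, LatOct.swap, LatOct.mem_set] at h1 h2 h3 h4
  simp only [LatOct.le_F]
  omega

theorem exists_wide {S : Set Pt} {f : Pt → ℤ} (hS : S.Finite) (hf : Set.InjOn f S)
    (hM : 0 ≤ M) (h : M + 1 ≤ S.ncard) : ∃ p ∈ S, ∃ q ∈ S, M ≤ f q - f p := by
  have hne : S.Nonempty := Set.nonempty_of_ncard_ne_zero (by omega)
  obtain ⟨p, hp, hp'⟩ := Set.exists_min_image S f hS hne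
  obtain ⟨q, hq, hq'⟩ := Set.exists_max_image S f hS hne
  refine ⟨p, hp, q, hq, ?_⟩
  have h1 : (f '' S).ncard ≤ ((Finset.Icc (f p) (f q) : Finset ℤ) : Set ℤ).ncard :=
    Set.ncard_le_ncard (by
      rintro _ ⟨r, hr, rfl⟩
      simpa using ⟨hp' r hr, hq' r hr⟩) (Finset.finite_toSet _)
  rw [hf.ncard_image, Set.ncard_coe_finset, Int.card_Icc] at h1
  have := hp' q hq
  omega

theorem AssumpH.flats {cbar Rbar : ℝ} (hJ : J.Tight) (h : AssumpH cbar Rbar ε J.set)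
    (hM : 0 ≤ M) (hn : ∀ n : ℕ, cbar / ε ≤ n → M + 1 ≤ n) : J.Flats M := by
  obtain ⟨-, hfin, -, yLo, yHi, xLo, xHi, hb, h1, h2, h3, h4⟩ := h
  have hx : ∀ y, Set.InjOn Prod.fst {p ∈ J.set | p.2 = y} := fun y p hp q hq e =>
    Prod.ext e (hp.2.trans hq.2.symm)
  have hy : ∀ x, Set.InjOn Prod.snd {p ∈ J.set | p.1 = x} := fun x p hp q hq e =>
    Prod.ext (hp.2.trans hq.2.symm) e
  obtain ⟨⟨a1, b1⟩, ⟨g1, e1⟩, ⟨c1, d1⟩, ⟨g1', e1'⟩, i1⟩ :=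
    exists_wide (hfin.subset (Set.sep_subset _ _)) (hx _) hM (hn _ h1)
  obtain ⟨⟨a2, b2⟩, ⟨g2, e2⟩, ⟨c2, d2⟩, ⟨g2', e2'⟩, i2⟩ :=
    exists_wide (hfin.subset (Set.sep_subset _ _)) (hx _) hM (hn _ h2)
  obtain ⟨⟨a3, b3⟩, ⟨g3, e3⟩, ⟨c3, d3⟩, ⟨g3', e3'⟩, i3⟩ :=
    exists_wide (hfin.subset (Set.sep_subset _ _)) (hy _) hM (hn _ h3)
  obtain ⟨⟨a4, b4⟩, ⟨g4, e4⟩, ⟨c4, d4⟩, ⟨g4', e4'⟩, i4⟩ :=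
    exists_wide (hfin.subset (Set.sep_subset _ _)) (hy _) hM (hn _ h4)
  dsimp only at *
  subst e1 e1' e2 e2' e3 e3' e4 e4'
  obtain ⟨x1, y1, j1, k1⟩ := hJ.yLo
  obtain ⟨x2, y2, j2, k2⟩ := hJ.yHi
  obtain ⟨x3, y3, j3, k3⟩ := hJ.xLo
  obtain ⟨x4, y4, j4, k4⟩ := hJ.xHi
  have l1 := hb _ j1
  have l2 := hb _ j2
  have l3 := hb _ j3
  have l4 := hb _ j4
  dsimp only at l1 l2 l3 l4
  refine ⟨⟨⟨a2, c2, ?_, ?_, by omega⟩, a1, c1, ?_, ?_, by omega⟩,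
    ⟨b4, d4, ?_, ?_, by omega⟩, b3, d3, ?_, ?_, by omega⟩ <;>
  simp only [LatOct.flip, LatOct.swap, LatOct.mem_set] at * <;> omega

end

section

variable {J : LatOct} {ε : ℝ}

theorem AssumpH.box {cbar Rbar : ℝ} (hR : 0 < Rbar) (hJ : J.Tight)
    (h : AssumpH cbar Rbar ε J.set) :
    ε * (J.xHi - J.xLo : ℝ) ≤ 2 * Rbar ∧ ε * (J.yHi - J.yLo : ℝ) ≤ 2 * Rbar := by
  obtain ⟨-, -, ⟨c, hc⟩, -⟩ := h
  have key : ∀ p ∈ J.set, |ε * p.1 - c.1| ≤ Rbar ∧ |ε * p.2 - c.2| ≤ Rbar := fun p hp =>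
    ⟨abs_le_of_sq_le_sq (by nlinarith [hc p hp, sq_nonneg (ε * p.2 - c.2)]) hR.le,
      abs_le_of_sq_le_sq (by nlinarith [hc p hp, sq_nonneg (ε * p.1 - c.1)]) hR.le⟩
  obtain ⟨x1, y1, j1, k1⟩ := hJ.yLo
  obtain ⟨x2, y2, j2, k2⟩ := hJ.yHi
  obtain ⟨x3, y3, j3, k3⟩ := hJ.xLo
  obtain ⟨x4, y4, j4, k4⟩ := hJ.xHi
  have l1 := (abs_le.1 (key _ j1).2).1
  have l2 := (abs_le.1 (key _ j2).2).2
  have l3 := (abs_le.1 (key _ j3).1).1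
  have l4 := (abs_le.1 (key _ j4).1).2
  dsimp only at *
  rw [← k1, ← k2, ← k3, ← k4]
  constructor <;> linarith

/-- The scales used in the proof: the depth `m` of the bulk and the length `M` of the flats. -/
structure Scales (κ q ζ γ c R ε : ℝ) (m : ℕ) (M : ℤ) : Prop where
  δκ : ε ^ (γ - 2) / ζ ≤ κ / 4
  δq : ε ^ (γ - 2) / ζ < q
  δ1 : ε ^ (γ - 2) / ζ ≤ 1
  m1 : 1 ≤ m
  m9 : ε / ζ * m ≤ 9
  mq : ε / ζ * (2 * m) + ε ^ (γ - 2) / ζ < q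
  decay : ∀ a b : ℝ, 0 ≤ a → 0 ≤ b → ε * a ≤ 2 * R → ε * b ≤ 2 * R →
    (1 - ε / ζ * m / 9) ^ m * ((a + 1) * (b + 1)) < 1
  mM : 20 * (2 * m) ≤ M
  Mn : ∀ n : ℕ, c / ε ≤ n → M + 1 ≤ n
  num : ∀ t : ℤ, 0 ≤ t → ε / ζ * (t * (M / 2)) ≤ 2 * κ + ε ^ (γ - 2) / ζ →
    16 * (ε / ζ) * t ^ 2 ≤ κ

theorem decay_lt_one {x C ρ : ℝ} {m : ℕ} {a b : ℝ} (hε : 0 < ε) (hε1 : ε ≤ 1) (hρ : 0 < ρ)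
    (hx1 : x ≤ 1) (hx : ρ / ε ≤ x * m) (ha : 0 ≤ a) (hb : 0 ≤ b) (hC : 0 ≤ C) (hεa : ε * a ≤ C)
    (hεb : ε * b ≤ C) (h : 6 * (C + 1) ^ 2 * ε < ρ ^ 3) :
    (1 - x) ^ m * ((a + 1) * (b + 1)) < 1 := by
  have h1 : (1 - x) ^ m ≤ Real.exp (-(ρ / ε)) := by
    calc (1 - x) ^ m ≤ Real.exp (-x) ^ m :=
          pow_le_pow_left₀ (by linarith) (Real.one_sub_le_exp_neg x) m
      _ = Real.exp (-(x * m)) := by rw [← Real.exp_nat_mul]; ring_nf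
      _ ≤ _ := Real.exp_le_exp.2 (by linarith)
  have h2 : (ρ / ε) ^ 3 / 6 ≤ Real.exp (ρ / ε) := by
    simpa [Nat.factorial] using Real.pow_div_factorial_le_exp (ρ / ε) (by positivity) 3
  have h3 : (a + 1) * (b + 1) ≤ ((C + 1) / ε) ^ 2 := by
    have h4 : a + 1 ≤ (C + 1) / ε := by rw [le_div_iff₀ hε]; linarith
    have h5 : b + 1 ≤ (C + 1) / ε := by rw [le_div_iff₀ hε]; linarith
    rw [sq]
    gcongr
  calc (1 - x) ^ m * ((a + 1) * (b + 1)) ≤ Real.exp (-(ρ / ε)) * ((C + 1) / ε) ^ 2 := by gcongr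
    _ < 1 := by
      rw [Real.exp_neg, inv_mul_lt_iff₀ (Real.exp_pos _), mul_one]
      refine lt_of_lt_of_le ?_ h2
      rw [div_pow, div_pow, div_div, div_lt_div_iff₀ (by positivity) (by positivity)]
      have : 0 < ε ^ 2 := by positivity
      nlinarith

theorem exists_scales {κ q ζ γ c R : ℝ} (hκ : 0 < κ) (hκ1 : κ ≤ 1) (hq : 0 < q) (hζ : 0 < ζ)
    (hγ : 2 < γ) (hc : 0 < c) (hR : 0 < R) :
    ∃ e > 0, ∀ ε, 0 < ε → ε ≤ e → ∃ m M, Scales κ q ζ γ c R ε m M := by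
  have hT : Filter.Tendsto (fun ε : ℝ => ε ^ (γ - 2) / ζ) (nhdsWithin 0 (Set.Ioi 0)) (nhds 0) := by
    have h := (Real.continuousAt_rpow_const 0 (γ - 2) (Or.inr (by linarith))).tendsto
    rw [Real.zero_rpow (by linarith)] at h
    simpa using (h.div_const ζ).mono_left nhdsWithin_le_nhds
  set d := Min.min (Min.min (κ / 4) (q / 2)) 1 with hd
  have hd0 : 0 < d := by positivity
  obtain ⟨e₀, he₀, hδ⟩ := mem_nhdsGT_iff_exists_Ioc_subset.1 (hT.eventually_lt_const hd0)
  rw [Set.mem_Ioi] at he₀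
  set ρ := Min.min (Min.min (c / 80) (ζ * q / 8)) (9 * ζ) with hρ
  have hρ0 : 0 < ρ := by positivity
  have r1 : ρ ≤ c / 80 := (min_le_left _ _).trans (min_le_left _ _)
  have r2 : ρ ≤ ζ * q / 8 := (min_le_left _ _).trans (min_le_right _ _)
  have r3 : ρ ≤ 9 * ζ := min_le_right _ _
  set σ := ρ ^ 2 / (36 * ζ) with hσ
  have hσ0 : 0 < σ := by positivity
  set e := Min.min (Min.min (Min.min e₀ 1) (Min.min ρ (c / 2)))
    (Min.min (κ * c ^ 2 / (2304 * ζ)) (σ ^ 3 / (12 * (2 * R + 1) ^ 2))) with he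
  refine ⟨e, by positivity, fun ε hε hle => ?_⟩
  have e1 : ε ≤ e₀ := hle.trans (by simp [he])
  have e2 : ε ≤ 1 := hle.trans (by simp [he])
  have e3 : ε ≤ ρ := hle.trans (by simp [he])
  have e4 : ε ≤ c / 2 := hle.trans (by simp [he])
  have e5 : ε ≤ κ * c ^ 2 / (2304 * ζ) := hle.trans (by simp [he])
  have e6 : ε ≤ σ ^ 3 / (12 * (2 * R + 1) ^ 2) := hle.trans (by simp [he])
  have hδd : ε ^ (γ - 2) / ζ < d := hδ ⟨hε, e1⟩
  have d1 : d ≤ κ / 4 := (min_le_left _ _).trans (min_le_left _ _)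
  have d2 : d ≤ q / 2 := (min_le_left _ _).trans (min_le_right _ _)
  have d3 : d ≤ 1 := min_le_right _ _
  have m1 : 1 ≤ ⌊ρ / ε⌋₊ := Nat.le_floor (by rw [Nat.cast_one, le_div_iff₀ hε]; linarith)
  have m2 : (⌊ρ / ε⌋₊ : ℝ) ≤ ρ / ε := Nat.floor_le (by positivity)
  have m3 : ρ / ε < ⌊ρ / ε⌋₊ + 1 := Nat.lt_floor_add_one _
  set m := ⌊ρ / ε⌋₊
  have m1' : (1 : ℝ) ≤ m := by exact_mod_cast m1
  have m4 : ε * m ≤ ρ := by rwa [le_div_iff₀ hε, mul_comm] at m2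
  have m5 : ρ ≤ 2 * (ε * m) := by
    rw [div_lt_iff₀ hε] at m3; nlinarith
  have M1 : c / ε ≤ ⌈c / ε⌉ := Int.le_ceil _
  have M2 : c ≤ ε * (⌈c / ε⌉ : ℤ) := by rwa [div_le_iff₀ hε, mul_comm] at M1
  refine ⟨m, ⌈c / ε⌉ - 1, by linarith, by linarith, by linarith, m1, ?_, ?_,
    fun a b ha hb h1 h2 => ?_, ?_, fun n hn => ?_, fun t ht h => ?_⟩
  · rw [div_mul_eq_mul_div, div_le_iff₀ hζ]; linarith
  · have : ε / ζ * (2 * m) ≤ q / 4 := by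
      rw [div_mul_eq_mul_div, div_le_iff₀ hζ]; linarith
    linarith
  · refine decay_lt_one (C := 2 * R) (ρ := σ) hε e2 hσ0 ?_ ?_ ha hb (by linarith) h1 h2 ?_
    · rw [div_mul_eq_mul_div, div_div, div_le_one (by positivity)]; linarith
    · rw [hσ, div_div, show ε / ζ * m / 9 * m = 4 * (ε * m) ^ 2 / (36 * ζ * ε) by
        field_simp; ring]
      gcongr
      rw [show 4 * (ε * m) ^ 2 = (2 * (ε * m)) ^ 2 by ring]
      gcongr
    · rw [le_div_iff₀ (by positivity)] at e6
      have : 0 < ε * (2 * R + 1) ^ 2 := by positivity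
      have : 0 < σ ^ 3 := by positivity
      nlinarith
  · have : (20 * (2 * m) : ℝ) ≤ ⌈c / ε⌉ - 1 := by
      refine le_of_mul_le_mul_left ?_ hε
      linarith
    exact_mod_cast this
  · have := Int.ceil_le.2 (show c / ε ≤ ((n : ℤ) : ℝ) by simpa using hn)
    omega
  · push_cast at h
    have ht' : (0 : ℝ) ≤ t := by exact_mod_cast ht
    have h1 : c / 4 ≤ ε * (((⌈c / ε⌉ : ℝ) - 1) / 2) := by linarith
    have h2 : t * (c / 4) ≤ 3 * ζ := by
      have h3 : ε / ζ * (t * (((⌈c / ε⌉ : ℝ) - 1) / 2)) ≤ 3 := by linarith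
      rw [div_mul_eq_mul_div, div_le_iff₀ hζ] at h3
      linarith [mul_le_mul_of_nonneg_left h1 ht']
    have h4 : (t * c) ^ 2 ≤ (12 * ζ) ^ 2 := pow_le_pow_left₀ (by positivity) (by linarith) 2
    rw [le_div_iff₀ (by positivity)] at e5
    have h5 : 16 * ε * (t : ℝ) ^ 2 * c ^ 2 ≤ κ * ζ * c ^ 2 := by
      calc 16 * ε * (t : ℝ) ^ 2 * c ^ 2 = 16 * ε * (t * c) ^ 2 := by ring
        _ ≤ 16 * ε * (12 * ζ) ^ 2 := by gcongr
        _ = ζ * (ε * (2304 * ζ)) := by ring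
        _ ≤ ζ * (κ * c ^ 2) := by gcongr
        _ = κ * ζ * c ^ 2 := by ring
    have h6 := le_of_mul_le_mul_right h5 (by positivity)
    rw [← mul_div_assoc, div_mul_eq_mul_div, div_le_iff₀ hζ]
    exact h6

end

/-- Lemma 4.3: for `γ > 2` the minimizer is a discrete octagon completely
surrounded by surfactant. -/
theorem statement10 (k ζ γ cbar Rbar : ℝ) (hk₁ : 1 / 3 < k) (hk₂ : k < 1) (hζ : 0 < ζ)
    (hγ : 2 < γ) (hc : 0 < cbar) (hR : 0 < Rbar) :
    ∃ εbar > 0, ∀ ε : ℝ, 0 < ε → ε ≤ εbar →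
      ∀ u₀ u₁ : Config, AssumpH cbar Rbar ε (Iset u₀) →
        IsDiscreteOctagon (Iset u₀) →
        Minimizes ε k ζ γ u₁ u₀ →
        IsDiscreteOctagon (Iset u₁) ∧ Iset u₁ ⊆ Iset u₀ ∧
          bdryOut (Iset u₁) = Zset u₁ := by
  obtain ⟨e, he, hS⟩ := exists_scales (κ := 1 - k) (q := 2 - 3 * (1 - k)) (by linarith)
    (by linarith) (by linarith) hζ hγ hc hR
  refine ⟨e, he, fun ε hε hle u₀ u₁ hH hoct hmin => ?_⟩
  obtain ⟨m, M, h⟩ := hS ε hε hle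
  have hfin : (Iset u₀).Finite := hH.2.1
  have hne : (Iset u₀).Nonempty := by
    obtain ⟨-, -, -, yLo, -, -, -, -, h1, -⟩ := hH
    have h2 : ({p ∈ Iset u₀ | p.2 = yLo}.ncard) ≠ 0 := by
      have : (0 : ℝ) < {p ∈ Iset u₀ | p.2 = yLo}.ncard := (by positivity : 0 < cbar / ε).trans_le h1
      exact_mod_cast this.ne'
    exact (Set.nonempty_of_ncard_ne_zero h2).mono (Set.sep_subset _ _)
  obtain ⟨J, hJ, hI⟩ := exists_latOct hoct hfin hne
  obtain ⟨K, W, n0, pb⟩ := exists_minPb hε hζ hk₁ hk₂ hJ hI hfin hmin h.δκ h.δq h.δ1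
  rw [hI] at hH
  have hm : (1 : ℤ) ≤ 2 * m := by have := h.m1; omega
  have hflat : J.Flats M := hH.flats hJ (by have := h.mM; omega) h.Mn
  have hcen := hflat.center hm h.mM
  have hbox := hH.box hR hJ
  have hx : (J.xLo : ℝ) ≤ J.xHi := by
    obtain ⟨x, y, hp, -⟩ := hJ.yHi
    rw [LatOct.mem_set] at hp
    exact_mod_cast (by omega : J.xLo ≤ J.xHi)
  have hy : (J.yLo : ℝ) ≤ J.yHi := by
    obtain ⟨x, y, hp, -⟩ := hJ.yHi
    rw [LatOct.mem_set] at hp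
    exact_mod_cast (by omega : J.yLo ≤ J.yHi)
  have hbulk := pb.bulk h.m1 h.m9
    (h.decay _ _ (by linarith) (by linarith) hbox.1 hbox.2)
  obtain ⟨A, O, hBA, hA⟩ := pb.exists_core (J.shrink (2 * m)).conn
    ⟨_, LatOct.mem_shrink.2 hcen.1⟩ fun p hp => hbulk p (LatOct.mem_shrink.1 hp)
  have hBA' : ∀ x y, 2 * (m : ℤ) ≤ J.F (x, y) → (x, y) ∈ A := fun x y hp =>
    hBA (LatOct.mem_shrink.2 hp)
  have hcore := pb.octCore hA ⟨_, _, hBA' _ _ hcen.1, hBA' _ _ hcen.2⟩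
    (pb.core_ends (by have := h.mq; push_cast; linarith) hA hBA')
  have hu : u₁.val = O.cfg := FatPb.eq_cfg (m := 2 * m) (M := M) ⟨pb, hcore, fun x y hp =>
    hA.hull.sub _ _ (hBA' x y hp), hm, h.mM, hflat, h.num⟩
  have hI₁ : Iset u₁ = O.set := by
    ext ⟨x, y⟩
    rw [← LatOct.cfg_eq_one, ← hu]
    rfl
  refine ⟨?_, ?_, ?_⟩
  · rw [hI₁]
    exact O.isDiscreteOctagon ⟨_, hA.hull.sub _ _ (hBA' _ _ hcen.1)⟩
  · rw [hI₁, hI]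
    exact hcore.le.sub
  · ext ⟨x, y⟩
    rw [mem_bdryOut, hI₁, ← LatOct.cfg_eq_zero, ← hu]
    rfl

end BEG
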